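/- Suppose Assumption 1 holds and that γ·(σ−1) ≤ 1. Then the value function V is a viscosity supersolution of the HJB equation in (0,∞)²: for every C² function ψ : (0,∞)² → ℝ and every local minimum point (k_m,h_m) ∈ (0,∞)² of V − ψ, one has θ·V(k_m,h_m) − H_max(k_m,h_m, ∇ψ(k_m,h_m), D²ψ(k_m,h_m)) ≥ 0. -/

import Mathlib

open MeasureTheory ProbabilityTheory Real Set Matrix
open scoped ENNReal NNReal

noncomputable section

namespace HabitModel

/-- A standard Brownian motion with respect to the filtration `F`: adapted, with continuous
paths started at `0`, whose increments are independent of the past and Gaussian. -/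
structure IsStdBM {Ω : Type*} {mΩ : MeasurableSpace Ω} (P : Measure Ω)
    (F : Filtration ℝ mΩ) (W : ℝ → Ω → ℝ) : Prop where
  adapted : Adapted F W
  cont : ∀ ω, Continuous fun t => W t ω
  init : ∀ ω, W 0 ω = 0
  indep_incr : ∀ s t : ℝ, 0 ≤ s → s ≤ t →
    Indep (MeasurableSpace.comap (fun ω => W t ω - W s ω) inferInstance) (F s) P
  gauss_incr : ∀ s t : ℝ, 0 ≤ s → s ≤ t →
    P.map (fun ω => W t ω - W s ω) = gaussianReal 0 (Real.toNNReal (t - s))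

/-- The stochastic setting of the model: a filtered probability space carrying two
independent standard Brownian motions, together with the model parameters. -/
structure Setting (Ω : Type*) [mΩ : MeasurableSpace Ω] where
  P : Measure Ω
  isProb : IsProbabilityMeasure P
  F : Filtration ℝ mΩ
  W1 : ℝ → Ω → ℝ
  W2 : ℝ → Ω → ℝ
  bm1 : IsStdBM P F W1
  bm2 : IsStdBM P F W2
  indepW : Indep (⨆ t : ℝ, MeasurableSpace.comap (W1 t) inferInstance)
      (⨆ t : ℝ, MeasurableSpace.comap (W2 t) inferInstance) P
  B : ℝ
  β₁ : ℝ
  β₂ : ℝ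
  ρ : ℝ
  θ : ℝ
  σ : ℝ
  γ : ℝ
  R : ℝ
  hB : 0 ≤ B
  hβ₁ : 0 < β₁
  hβ₂ : 0 < β₂
  hρ₀ : 0 < ρ
  hρ₁ : ρ < 1
  hθ : 0 < θ
  hσ : 1 < σ
  hγ₀ : 0 ≤ γ
  hγ₁ : γ < 1
  hR : 0 < R

variable {Ω : Type*} [mΩ : MeasurableSpace Ω]

/-- Pathwise-explicit solution of `dk_t = (B k_t - c_t) dt + β₁ k_t dW¹_t`, `k_0 = k₀`. -/
def kProc (S : Setting Ω) (k₀ : ℝ) (c : ℝ → Ω → ℝ) (t : ℝ) (ω : Ω) : ℝ :=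
  Real.exp ((S.B - S.β₁ ^ 2 / 2) * t + S.β₁ * S.W1 t ω) *
    (k₀ - ∫ s in (0:ℝ)..t, c s ω * Real.exp (-((S.B - S.β₁ ^ 2 / 2) * s) - S.β₁ * S.W1 s ω))

/-- Pathwise-explicit solution of `dh_t = ρ (c_t - h_t) dt + β₂ h_t dW²_t`, `h_0 = h₀`. -/
def hProc (S : Setting Ω) (h₀ : ℝ) (c : ℝ → Ω → ℝ) (t : ℝ) (ω : Ω) : ℝ :=
  Real.exp ((-S.ρ - S.β₂ ^ 2 / 2) * t + S.β₂ * S.W2 t ω) *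
    (h₀ + S.ρ * ∫ s in (0:ℝ)..t, c s ω * Real.exp ((S.ρ + S.β₂ ^ 2 / 2) * s - S.β₂ * S.W2 s ω))

/-- Admissibility of a control `c` for the initial condition `(k₀, h₀)`: progressively
measurable, a.s. locally integrable trajectories, `c > 0` ℙ⊗dt-a.e., positive state
processes, and `c ≤ R·k` ℙ⊗dt-a.e. -/
structure IsAdmissible (S : Setting Ω) (k₀ h₀ : ℝ) (c : ℝ → Ω → ℝ) : Prop where
  prog : ProgMeasurable S.F c
  locInt : ∀ᵐ ω ∂S.P, ∀ t : ℝ, 0 ≤ t → IntervalIntegrable (fun s => c s ω) volume 0 t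
  cpos : ∀ᵐ ω ∂S.P, ∀ᵐ t ∂(volume.restrict (Set.Ici (0:ℝ))), 0 < c t ω
  kpos : ∀ᵐ ω ∂S.P, ∀ t : ℝ, 0 ≤ t → 0 < kProc S k₀ c t ω
  hpos : ∀ᵐ ω ∂S.P, ∀ t : ℝ, 0 ≤ t → 0 < hProc S h₀ c t ω
  cbdd : ∀ᵐ ω ∂S.P, ∀ᵐ t ∂(volume.restrict (Set.Ici (0:ℝ))), c t ω ≤ S.R * kProc S k₀ c t ω

/-- The (nonnegative) cost `-J(k₀,h₀;c) ∈ [0,∞]`; note that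
`(1/(1-σ))·(c/h^γ)^(1-σ) = -(1/(σ-1))·(h^γ/c)^(σ-1)`. -/
def Jcost (S : Setting Ω) (k₀ h₀ : ℝ) (c : ℝ → Ω → ℝ) : ℝ≥0∞ :=
  ∫⁻ ω, (∫⁻ t in Set.Ioi (0:ℝ),
    ENNReal.ofReal ((S.σ - 1)⁻¹ * ((hProc S h₀ c t ω) ^ S.γ / c t ω) ^ (S.σ - 1) *
      Real.exp (-S.θ * t))) ∂S.P

/-- The utility functional `J(k₀,h₀;c) ∈ [-∞,0]`. -/
def J (S : Setting Ω) (k₀ h₀ : ℝ) (c : ℝ → Ω → ℝ) : EReal := -(Jcost S k₀ h₀ c : EReal)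

/-- The infimum of the costs `-J(k₀,h₀;c)` over admissible controls. -/
def Vcost (S : Setting Ω) (k₀ h₀ : ℝ) : ℝ≥0∞ :=
  ⨅ c : {c : ℝ → Ω → ℝ // IsAdmissible S k₀ h₀ c}, Jcost S k₀ h₀ c.1

/-- The value function `V(k₀,h₀) = sup_{c ∈ 𝓐(k₀,h₀)} J(k₀,h₀;c) ∈ [-∞,0]`
(the supremum of `J = -Jcost` equals minus the infimum of the costs). -/
def V (S : Setting Ω) (k₀ h₀ : ℝ) : EReal := -(Vcost S k₀ h₀ : EReal)

/-- Assumption 1 on the model parameters (with `λ = max{2, 1/(γ(σ-1))}`; it forces `γ > 0`). -/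
def Assumption1 (S : Setting Ω) : Prop :=
  S.B ≤ S.R ∧ 0 < S.γ ∧
    (S.ρ + (S.β₂ ^ 2 - S.β₁ ^ 2) / 2 ≤ 0 →
      (S.σ - 1) * (-S.γ * S.ρ - (S.γ * S.β₂ ^ 2 - S.β₁ ^ 2) / 2 +
        max 2 (1 / (S.γ * (S.σ - 1))) * (S.σ - 1) * (S.β₁ ^ 2 + S.γ ^ 2 * S.β₂ ^ 2)) < S.θ) ∧
    (0 < S.ρ + (S.β₂ ^ 2 - S.β₁ ^ 2) / 2 →
      (S.σ - 1) * (S.β₁ ^ 2 * (1 - S.γ) / 2 +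
        max 2 (1 / (S.γ * (S.σ - 1))) * (S.σ - 1) * (S.β₁ ^ 2 + S.γ ^ 2 * S.β₂ ^ 2)) < S.θ)

/-- The function `g(c; h, p_k, p_h) = -c·(p_k - ρ·p_h) - (1/(σ-1))·(h^γ/c)^(σ-1)`. -/
def gFun (ρ σ γ : ℝ) (c h pk ph : ℝ) : ℝ :=
  -c * (pk - ρ * ph) - (σ - 1)⁻¹ * (h ^ γ / c) ^ (σ - 1)

/-- The maximized Hamiltonian term `G(k,h,p_k,p_h)`. -/
def GFun (ρ σ γ R : ℝ) (k h pk ph : ℝ) : ℝ :=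
  if pk - ρ * ph ≤ h ^ (γ * (σ - 1)) * (R * k) ^ (-σ) then
    -(R * k) * (pk - ρ * ph) - (σ - 1)⁻¹ * (h ^ γ / (R * k)) ^ (σ - 1)
  else
    -(1 + (σ - 1)⁻¹) * (h ^ γ * (pk - ρ * ph)) ^ (1 - 1 / σ)

/-- The maximum value Hamiltonian `H_max(k,h,p,Q)` (only the diagonal entries of `Q` enter). -/
def Hmax (B β₁ β₂ ρ σ γ R : ℝ) (k h : ℝ) (p : ℝ × ℝ)
    (Q : Matrix (Fin 2) (Fin 2) ℝ) : ℝ :=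
  B * k * p.1 - ρ * h * p.2 + (1 / 2) * β₁ ^ 2 * k ^ 2 * Q 0 0
    + (1 / 2) * β₂ ^ 2 * h ^ 2 * Q 1 1 + GFun ρ σ γ R k h p.1 p.2

/-- `F̃(Q, p, v, (k,h)) = -θ·v + H_max(k,h,p,Q)`. -/
def Ftilde (B β₁ β₂ ρ θ σ γ R : ℝ) (Q : Matrix (Fin 2) (Fin 2) ℝ)
    (p : ℝ × ℝ) (v : ℝ) (z : ℝ × ℝ) : ℝ :=
  -θ * v + Hmax B β₁ β₂ ρ σ γ R z.1 z.2 p Q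

/-- First partial derivative in the first (capital) variable. -/
def pd1 (v : ℝ × ℝ → ℝ) (z : ℝ × ℝ) : ℝ := fderiv ℝ v z (1, 0)

/-- First partial derivative in the second (habit) variable. -/
def pd2 (v : ℝ × ℝ → ℝ) (z : ℝ × ℝ) : ℝ := fderiv ℝ v z (0, 1)

/-- The gradient `∇v` as a pair. -/
def gradVec (v : ℝ × ℝ → ℝ) (z : ℝ × ℝ) : ℝ × ℝ := (pd1 v z, pd2 v z)

/-- The Hessian `D²v` as a 2×2 matrix. -/
def hessMat (v : ℝ × ℝ → ℝ) (z : ℝ × ℝ) : Matrix (Fin 2) (Fin 2) ℝ :=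
  Matrix.of ![![pd1 (pd1 v) z, pd2 (pd1 v) z], ![pd1 (pd2 v) z, pd2 (pd2 v) z]]

section
lemma intble_of_bdd {P : Measure Ω} [IsProbabilityMeasure P] {f : Ω → ℂ} (hf : Measurable f) {K : ℝ}
    (hb : ∀ ω, ‖f ω‖ ≤ K) : Integrable f P :=
  Integrable.of_bound hf.aestronglyMeasurable K (Filter.Eventually.of_forall hb)

lemma levy_abstract {P : Measure Ω} [IsProbabilityMeasure P] (𝓕 : ℕ → MeasurableSpace Ω)
    (h𝓕 : ∀ i, 𝓕 i ≤ mΩ) (hmono : Monotone 𝓕) (M N : ℕ → Ω → ℂ)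
    (hMm : ∀ j, Measurable[𝓕 j] (M j)) (hNm : ∀ j, Measurable[𝓕 j] (N j)) (K : ℝ)
    (hMK : ∀ j ω, ‖M j ω‖ ≤ K) (hNK : ∀ j ω, ‖N j ω‖ ≤ K)
    (hM : ∀ j, ∀ Z : Ω → ℂ, Measurable[𝓕 j] Z → (∃ K, ∀ ω, ‖Z ω‖ ≤ K) →
      ∫ ω, Z ω * (M (j+1) ω - M j ω) ∂P = 0)
    (hN : ∀ j, ∀ Z : Ω → ℂ, Measurable[𝓕 j] Z → (∃ K, ∀ ω, ‖Z ω‖ ≤ K) →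
      ∫ ω, Z ω * (N (j+1) ω - N j ω) ∂P = 0)
    (hind : ∀ i j, IndepFun
      (fun ω => (M (i+1) ω - M i ω) * star (M (j+1) ω - M j ω))
      (fun ω => (N (i+1) ω - N i ω) * star (N (j+1) ω - N j ω)) P)
    (dM dN : ℝ) (hdM : ∀ j, ∫ ω, ‖M (j+1) ω - M j ω‖ ^ 2 ∂P ≤ dM)
    (hdN : ∀ j, ∫ ω, ‖N (j+1) ω - N j ω‖ ^ 2 ∂P ≤ dN)
    (hM0 : ∀ ω, M 0 ω = 1) (hN0 : ∀ ω, N 0 ω = 1) (A : Set Ω) (hA : MeasurableSet[𝓕 0] A) (n : ℕ)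
    (ε : ℝ) (hε : 0 < ε) :
    ‖∫ ω, A.indicator 1 ω * (M n ω * N n ω) ∂P - (P.real A : ℂ)‖ ≤ (ε + n * (dM * dN) / ε) / 2 := by
  have hMm' : ∀ j, Measurable (M j) := fun j => (hMm j).mono (h𝓕 j) le_rfl
  have hNm' : ∀ j, Measurable (N j) := fun j => (hNm j).mono (h𝓕 j) le_rfl
  have hA' : MeasurableSet A := h𝓕 0 A hA
  set I : Ω → ℂ := A.indicator 1 with hI
  have hIm : Measurable[𝓕 0] I := by
    rw [hI]; exact (measurable_const (a := (1:ℂ))).indicator hA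
  have hIm' : Measurable I := hIm.mono (h𝓕 0) le_rfl
  have hI1 : ∀ ω, ‖I ω‖ ≤ 1 := by
    intro ω; by_cases h : ω ∈ A <;> simp [hI, h]
  have hK0 : 0 ≤ K := by
    by_contra h
    have : Nonempty Ω := by
      by_contra h'
      rw [not_nonempty_iff] at h'
      have := IsProbabilityMeasure.ne_zero P
      exact this (Measure.eq_zero_of_isEmpty P)
    exact h ((norm_nonneg _).trans (hMK 0 this.some))
  set U : ℕ → Ω → ℂ := fun j ω => M (j+1) ω - M j ω with hU
  set T : ℕ → Ω → ℂ := fun j ω => N (j+1) ω - N j ω with hT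
  have hUm : ∀ j, Measurable (U j) := fun j => (hMm' _).sub (hMm' _)
  have hTm : ∀ j, Measurable (T j) := fun j => (hNm' _).sub (hNm' _)
  have hUm1 : ∀ j, Measurable[𝓕 (j+1)] (U j) := fun j =>
    (hMm _).sub ((hMm _).mono (hmono (Nat.le_succ j)) le_rfl)
  have hTm1 : ∀ j, Measurable[𝓕 (j+1)] (T j) := fun j =>
    (hNm _).sub ((hNm _).mono (hmono (Nat.le_succ j)) le_rfl)
  have hUK : ∀ j ω, ‖U j ω‖ ≤ 2 * K := fun j ω => by
    have := norm_sub_le (M (j+1) ω) (M j ω); have := hMK j ω; have := hMK (j+1) ω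
    simp only [hU]; linarith
  have hTK : ∀ j ω, ‖T j ω‖ ≤ 2 * K := fun j ω => by
    have := norm_sub_le (N (j+1) ω) (N j ω); have := hNK j ω; have := hNK (j+1) ω
    simp only [hT]; linarith
  set Q : ℕ → Ω → ℂ := fun n ω => ∑ j ∈ Finset.range n, U j ω * T j ω with hQ
  have hUT : ∀ j ω, ‖U j ω * T j ω‖ ≤ 2 * K * (2 * K) := fun j ω => by
    rw [norm_mul]; exact mul_le_mul (hUK _ _) (hTK _ _) (norm_nonneg _) (by positivity)
  have hQm : ∀ n, Measurable (Q n) := fun n =>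
    Finset.measurable_sum _ fun j _ => (hUm j).mul (hTm j)
  have hQK : ∀ n ω, ‖Q n ω‖ ≤ n * (2 * K * (2 * K)) := fun n ω => by
    refine (norm_sum_le _ _).trans ?_
    refine (Finset.sum_le_sum fun j _ => hUT j ω).trans ?_
    simp
  -- first: integral identity
  have h1 : ∀ n, ∫ ω, I ω * (M n ω * N n ω) ∂P = P.real A + ∫ ω, I ω * Q n ω ∂P := by
    intro n
    induction n with
    | zero =>
      simp only [hM0, hN0, hQ, Finset.range_zero, Finset.sum_empty, mul_one, mul_zero, integral_zero, add_zero]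
      rw [hI, integral_indicator hA']; simp [Measure.real]
    | succ n ih =>
      have e : ∀ ω, I ω * (M (n+1) ω * N (n+1) ω) = (I ω * (M n ω * N n ω) + I ω * (U n ω * T n ω)) +
          ((I ω * M n ω) * (N (n+1) ω - N n ω) + (I ω * N n ω) * (M (n+1) ω - M n ω)) := by
        intro ω; simp only [hU, hT]; ring
      have e2 : ∀ ω, I ω * Q (n+1) ω = I ω * Q n ω + I ω * (U n ω * T n ω) := by
        intro ω; simp only [hQ, Finset.sum_range_succ]; ring
      have b1 : ∀ {f : Ω → ℂ} {C : ℝ}, Measurable f → (∀ ω, ‖f ω‖ ≤ C) → Integrable (fun ω => I ω * f ω) P := by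
        intro f C hf hC
        refine intble_of_bdd (hIm'.mul hf) (K := C) fun ω => ?_
        rw [norm_mul]
        calc ‖I ω‖ * ‖f ω‖ ≤ 1 * ‖f ω‖ := by gcongr; exact hI1 ω
          _ ≤ C := by rw [one_mul]; exact hC ω
      have i1 : Integrable (fun ω => I ω * (M n ω * N n ω)) P := b1 ((hMm' n).mul (hNm' n)) (C := K * K)
        fun ω => by rw [norm_mul]; exact mul_le_mul (hMK _ _) (hNK _ _) (norm_nonneg _) hK0
      have i2 : Integrable (fun ω => I ω * (U n ω * T n ω)) P := b1 ((hUm n).mul (hTm n)) (hUT n)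
      have i3 : Integrable (fun ω => (I ω * M n ω) * (N (n+1) ω - N n ω)) P := by
        have := b1 ((hMm' n).mul (hTm n)) (C := K * (2 * K))
          fun ω => by rw [Pi.mul_apply, norm_mul]; exact mul_le_mul (hMK _ _) (hTK _ _) (norm_nonneg _) hK0
        simpa [hT, mul_assoc] using this
      have i4 : Integrable (fun ω => (I ω * N n ω) * (M (n+1) ω - M n ω)) P := by
        have := b1 ((hNm' n).mul (hUm n)) (C := K * (2 * K))
          fun ω => by rw [Pi.mul_apply, norm_mul]; exact mul_le_mul (hNK _ _) (hUK _ _) (norm_nonneg _) hK0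
        simpa [hU, mul_assoc] using this
      have i5 : Integrable (fun ω => I ω * Q n ω) P := b1 (hQm n) (hQK n)
      have z1 : ∫ ω, (I ω * M n ω) * (N (n+1) ω - N n ω) ∂P = 0 := by
        refine hN n (fun ω => I ω * M n ω) ((hIm.mono (hmono (Nat.zero_le n)) le_rfl).mul (hMm n)) ⟨1 * K, fun ω => ?_⟩
        rw [norm_mul]; exact mul_le_mul (hI1 _) (hMK _ _) (norm_nonneg _) zero_le_one
      have z2 : ∫ ω, (I ω * N n ω) * (M (n+1) ω - M n ω) ∂P = 0 := by
        refine hM n (fun ω => I ω * N n ω) ((hIm.mono (hmono (Nat.zero_le n)) le_rfl).mul (hNm n)) ⟨1 * K, fun ω => ?_⟩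
        rw [norm_mul]; exact mul_le_mul (hI1 _) (hNK _ _) (norm_nonneg _) zero_le_one
      simp_rw [e, e2]
      rw [integral_add (i1.fun_add i2) (i3.fun_add i4), integral_add i1 i2, integral_add i3 i4, integral_add i5 i2, z1, z2, ih]
      ring
  -- orthogonality
  have orth : ∀ j n, j < n → ∫ ω, U j ω * star (U n ω) ∂P = 0 := by
    intro j n hjn
    have := hM n (fun ω => star (U j ω)) (continuous_star.measurable.comp ((hUm1 j).mono (hmono hjn) le_rfl))
      ⟨2 * K, fun ω => by rw [norm_star]; exact hUK j ω⟩
    have e : ∀ ω, U j ω * star (U n ω) = (starRingEnd ℂ) (star (U j ω) * (M (n+1) ω - M n ω)) := by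
      intro ω; simp [hU]
    simp_rw [e]
    rw [integral_conj, this, map_zero]
  have hUU : ∀ i j, Measurable (fun ω => U i ω * star (U j ω)) := fun i j =>
    (hUm i).mul (continuous_star.measurable.comp (hUm j))
  have hTT : ∀ i j, Measurable (fun ω => T i ω * star (T j ω)) := fun i j =>
    (hTm i).mul (continuous_star.measurable.comp (hTm j))
  have prodE : ∀ i j, ∫ ω, (U i ω * star (U j ω)) * (T i ω * star (T j ω)) ∂P
      = (∫ ω, U i ω * star (U j ω) ∂P) * ∫ ω, T i ω * star (T j ω) ∂P := fun i j =>
    (hind i j).integral_mul_eq_mul_integral (hUU i j).aestronglyMeasurable (hTT i j).aestronglyMeasurable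
  have diag : ∀ j, ∫ ω, ‖U j ω * T j ω‖ ^ 2 ∂P = (∫ ω, ‖U j ω‖ ^ 2 ∂P) * ∫ ω, ‖T j ω‖ ^ 2 ∂P := by
    intro j
    have := prodE j j
    have e1 : ∀ x : ℂ, x * star x = ((‖x‖ ^ 2 : ℝ) : ℂ) := by
      intro x; rw [Complex.star_def, Complex.mul_conj, Complex.normSq_eq_norm_sq]
    simp_rw [e1] at this
    have e2 : ∀ ω, (((‖U j ω‖ ^ 2 : ℝ) : ℂ)) * ((‖T j ω‖ ^ 2 : ℝ) : ℂ) = ((‖U j ω * T j ω‖ ^ 2 : ℝ) : ℂ) := by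
      intro ω; rw [norm_mul, mul_pow]; push_cast; ring
    simp_rw [e2] at this
    rw [integral_complex_ofReal, integral_complex_ofReal, integral_complex_ofReal] at this
    exact_mod_cast this
  have h2 : ∀ n, ∫ ω, ‖Q n ω‖ ^ 2 ∂P ≤ n * (dM * dN) := by
    intro n
    induction n with
    | zero => simp [hQ]
    | succ n ih =>
      have e : ∀ ω, ‖Q (n+1) ω‖ ^ 2 = ‖Q n ω‖ ^ 2 + ‖U n ω * T n ω‖ ^ 2 +
          2 * (∑ j ∈ Finset.range n, (U j ω * star (U n ω)) * (T j ω * star (T n ω))).re := by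
        intro ω
        have : ∑ j ∈ Finset.range n, (U j ω * star (U n ω)) * (T j ω * star (T n ω))
            = Q n ω * star (U n ω * T n ω) := by
          simp only [hQ, Finset.sum_mul]
          refine Finset.sum_congr rfl fun j _ => ?_
          simp only [star_mul']
          ring
        rw [this]
        have e3 : Q (n+1) ω = Q n ω + U n ω * T n ω := by simp only [hQ, Finset.sum_range_succ]
        rw [e3, ← Complex.normSq_eq_norm_sq, ← Complex.normSq_eq_norm_sq, ← Complex.normSq_eq_norm_sq,
          Complex.normSq_add]
        rfl
      have j1 : Integrable (fun ω => ‖Q n ω‖ ^ 2) P :=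
        Integrable.of_bound ((hQm n).norm.pow_const 2).aestronglyMeasurable ((n * (2 * K * (2 * K))) ^ 2)
          (Filter.Eventually.of_forall fun ω => by
            rw [Real.norm_of_nonneg (by positivity)]
            exact pow_le_pow_left₀ (norm_nonneg _) (hQK n ω) 2)
      have j2 : Integrable (fun ω => ‖U n ω * T n ω‖ ^ 2) P :=
        Integrable.of_bound (((hUm n).mul (hTm n)).norm.pow_const 2).aestronglyMeasurable ((2 * K * (2 * K)) ^ 2)
          (Filter.Eventually.of_forall fun ω => by
            rw [Real.norm_of_nonneg (by positivity)]
            exact pow_le_pow_left₀ (norm_nonneg _) (hUT n ω) 2)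
      have j3 : ∀ j ∈ Finset.range n, Integrable (fun ω => (U j ω * star (U n ω)) * (T j ω * star (T n ω))) P := by
        intro j _
        refine intble_of_bdd ((hUU j n).mul (hTT j n)) (K := (2 * K * (2 * K)) * (2 * K * (2 * K))) fun ω => ?_
        simp only [norm_mul, norm_star]
        have a := hUK j ω; have b := hUK n ω; have c := hTK j ω; have d := hTK n ω
        gcongr
      have j4 := integrable_finsetSum (Finset.range n) j3
      have z : ∫ ω, (∑ j ∈ Finset.range n, (U j ω * star (U n ω)) * (T j ω * star (T n ω))).re ∂P = 0 := by
        have := integral_re j4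
        simp only [RCLike.re_eq_complex_re] at this
        rw [this, integral_finsetSum _ j3, Finset.sum_eq_zero, Complex.zero_re]
        intro j hj
        rw [prodE, orth j n (Finset.mem_range.mp hj), zero_mul]
      simp_rw [e]
      have j5 := j4.re.const_mul 2
      simp only [RCLike.re_eq_complex_re] at j5
      rw [integral_add (j1.fun_add j2) j5, integral_add j1 j2, integral_const_mul]
      rw [z, diag]
      have : (∫ ω, ‖U n ω‖ ^ 2 ∂P) * ∫ ω, ‖T n ω‖ ^ 2 ∂P ≤ dM * dN := by
        have h0 : 0 ≤ ∫ ω, ‖T n ω‖ ^ 2 ∂P := integral_nonneg fun ω => by positivity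
        have h1 : 0 ≤ ∫ ω, ‖U n ω‖ ^ 2 ∂P := integral_nonneg fun ω => by positivity
        exact mul_le_mul (hdM n) (hdN n) h0 (h1.trans (hdM n))
      push_cast
      linarith
  rw [h1, add_sub_cancel_left]
  have j1 : Integrable (fun ω => ‖Q n ω‖ ^ 2) P :=
        Integrable.of_bound ((hQm n).norm.pow_const 2).aestronglyMeasurable ((n * (2 * K * (2 * K))) ^ 2)
          (Filter.Eventually.of_forall fun ω => by
            rw [Real.norm_of_nonneg (by positivity)]
            exact pow_le_pow_left₀ (norm_nonneg _) (hQK n ω) 2)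
  calc ‖∫ ω, I ω * Q n ω ∂P‖ ≤ ∫ ω, (ε + ‖Q n ω‖ ^ 2 / ε) / 2 ∂P := by
        refine norm_integral_le_of_norm_le (((integrable_const ε).fun_add (j1.div_const ε)).div_const 2)
          (Filter.Eventually.of_forall fun ω => ?_)
        rw [norm_mul]
        have a1 : ‖I ω‖ * ‖Q n ω‖ ≤ ‖Q n ω‖ := by
          have := mul_le_mul_of_nonneg_right (hI1 ω) (norm_nonneg (Q n ω)); linarith
        refine a1.trans ?_
        rw [le_div_iff₀ two_pos, ← sub_nonneg]
        have : ε + ‖Q n ω‖ ^ 2 / ε - ‖Q n ω‖ * 2 = (ε - ‖Q n ω‖) ^ 2 / ε := by field_simp; ring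
        rw [this]; positivity
    _ = (ε + (∫ ω, ‖Q n ω‖ ^ 2 ∂P) / ε) / 2 := by
        rw [integral_div, integral_add (integrable_const ε) (j1.div_const ε), integral_div]; simp
    _ ≤ _ := by have := h2 n; gcongr
end

section
lemma bm_char {P : Measure Ω} [IsProbabilityMeasure P] {F : Filtration ℝ mΩ} {W : ℝ → Ω → ℝ}
    (hW : IsStdBM P F W) {s t : ℝ} (hs : 0 ≤ s) (hst : s ≤ t) (p : ℝ) (Z : Ω → ℂ)
    (hZ : Measurable[F s] Z) :
    ∫ ω, Z ω * Complex.exp (p * (W t ω - W s ω : ℝ) * Complex.I) ∂P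
      = (∫ ω, Z ω ∂P) * Complex.exp (-(p ^ 2 * (t - s) / 2 : ℝ)) := by
  have hWm : ∀ r, Measurable (W r) := fun r => (hW.adapted r).mono (F.le r) le_rfl
  have hind : IndepFun Z (fun ω => Complex.exp (p * (W t ω - W s ω : ℝ) * Complex.I)) P := by
    have h1 := (hW.indep_incr s t hs hst).symm
    rw [IndepFun_iff_Indep]
    refine indep_of_indep_of_le_left (indep_of_indep_of_le_right h1 ?_) hZ.comap_le
    have : (fun ω => Complex.exp (p * (W t ω - W s ω : ℝ) * Complex.I))
      = (fun x : ℝ => Complex.exp (p * x * Complex.I)) ∘ (fun ω => W t ω - W s ω) := rfl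
    rw [this, ← MeasurableSpace.comap_comp]
    refine MeasurableSpace.comap_mono ?_
    exact (by fun_prop : Measurable (fun x : ℝ => Complex.exp (p * x * Complex.I))).comap_le
  have hm : Measurable (fun ω => Complex.exp (p * (W t ω - W s ω : ℝ) * Complex.I)) := by
    have := hWm t; have := hWm s; fun_prop
  rw [show (fun ω => Z ω * Complex.exp (p * (W t ω - W s ω : ℝ) * Complex.I))
    = Z * (fun ω => Complex.exp (p * (W t ω - W s ω : ℝ) * Complex.I)) from rfl,
    hind.integral_mul_eq_mul_integral (hZ.mono (F.le s) le_rfl).aestronglyMeasurable hm.aestronglyMeasurable]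
  congr 1
  have h2 := charFun_gaussianReal (μ := 0) (v := Real.toNNReal (t - s)) p
  rw [← hW.gauss_incr s t hs hst, charFun_apply_real, integral_map] at h2
  · rw [h2, Real.coe_toNNReal _ (sub_nonneg.mpr hst)]
    congr 1; push_cast; ring
  · exact ((hWm t).sub (hWm s)).aemeasurable
  · exact (by fun_prop : Measurable (fun x : ℝ => Complex.exp (p * x * Complex.I))).aestronglyMeasurable

/-- exponential martingale -/
def expM (W : ℝ → Ω → ℝ) (p u t : ℝ) (ω : Ω) : ℂ :=
  Complex.exp ((p * (W t ω - W u ω) : ℝ) * Complex.I + (p ^ 2 * (t - u) / 2 : ℝ))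

lemma norm_expM (W : ℝ → Ω → ℝ) (p u t : ℝ) (ω : Ω) : ‖expM W p u t ω‖ = Real.exp (p ^ 2 * (t - u) / 2) := by
  rw [expM, Complex.norm_exp, Complex.add_re, Complex.ofReal_re, Complex.re_ofReal_mul]; simp

lemma expM_mul (W : ℝ → Ω → ℝ) (p u s t : ℝ) (ω : Ω) : expM W p u t ω = expM W p u s ω * expM W p s t ω := by
  rw [expM, expM, expM, ← Complex.exp_add]; congr 1; push_cast; ring

lemma measurable_expM {m : MeasurableSpace Ω} {W : ℝ → Ω → ℝ} {u t : ℝ} (p : ℝ) (h1 : Measurable[m] (W t))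
    (h2 : Measurable[m] (W u)) : Measurable[m] (expM W p u t) := by
  unfold expM; fun_prop

lemma expM_mart {P : Measure Ω} [IsProbabilityMeasure P] {F : Filtration ℝ mΩ} {W : ℝ → Ω → ℝ}
    (hW : IsStdBM P F W) {s t : ℝ} (hs : 0 ≤ s) (hst : s ≤ t) (p : ℝ) (Z : Ω → ℂ)
    (hZ : Measurable[F s] Z) : ∫ ω, Z ω * expM W p s t ω ∂P = ∫ ω, Z ω ∂P := by
  have e : ∀ ω, Z ω * expM W p s t ω = (Z ω * Complex.exp (p * (W t ω - W s ω : ℝ) * Complex.I)) *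
      Complex.exp ((p ^ 2 * (t - s) / 2 : ℝ)) := by
    intro ω; rw [expM, Complex.exp_add]; push_cast; ring
  simp_rw [e]
  rw [integral_mul_const, bm_char hW hs hst p Z hZ, mul_assoc, ← Complex.exp_add]
  simp

lemma expM_var {P : Measure Ω} [IsProbabilityMeasure P] {F : Filtration ℝ mΩ} {W : ℝ → Ω → ℝ}
    (hW : IsStdBM P F W) {s t : ℝ} (hs : 0 ≤ s) (hst : s ≤ t) (p : ℝ) :
    ∫ ω, ‖expM W p s t ω - 1‖ ^ 2 ∂P = Real.exp (p ^ 2 * (t - s)) - 1 := by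
  have hWm : ∀ r, Measurable (W r) := fun r => (hW.adapted r).mono (F.le r) le_rfl
  have e : ∀ ω, ‖expM W p s t ω - 1‖ ^ 2 = (Real.exp (p ^ 2 * (t - s)) + 1) - 2 * (expM W p s t ω).re := by
    intro ω
    rw [← Complex.normSq_eq_norm_sq, Complex.normSq_sub, Complex.normSq_eq_norm_sq, norm_expM, ← Real.exp_nat_mul]
    simp
    ring_nf
  have hi : Integrable (expM W p s t) P := intble_of_bdd (measurable_expM p (hWm t) (hWm s)) (fun ω => (norm_expM W p s t ω).le)
  have hi2 : Integrable (fun ω => (expM W p s t ω).re) P := hi.re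
  simp_rw [e]
  rw [integral_sub (integrable_const _) (hi2.const_mul 2), integral_const_mul]
  have h1 := expM_mart hW hs hst p (fun _ => 1) measurable_const
  simp only [one_mul] at h1
  have h2 := integral_re hi
  simp only [RCLike.re_eq_complex_re] at h2
  rw [h2, h1]
  simp
  ring

lemma levy_char (S : Setting Ω) {u t : ℝ} (hu : 0 ≤ u) (hut : u ≤ t) (p q : ℝ) (A : Set Ω)
    (hA : MeasurableSet[S.F u] A) :
    ∫ ω, A.indicator 1 ω * (expM S.W1 p u t ω * expM S.W2 q u t ω) ∂S.P = (S.P.real A : ℂ) := by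
  haveI := S.isProb
  set τ := t - u with hτ
  have hτ0 : 0 ≤ τ := sub_nonneg.mpr hut
  set K : ℝ := Real.exp (p ^ 2 * τ / 2) + Real.exp (q ^ 2 * τ / 2) with hK
  set D : ℝ := K ^ 2 * (p ^ 2 * τ * Real.exp (p ^ 2 * τ)) * (K ^ 2 * (q ^ 2 * τ * Real.exp (q ^ 2 * τ))) with hD
  have key : ∀ n : ℕ, 0 < n → ∀ ε : ℝ, 0 < ε →
      ‖∫ ω, A.indicator 1 ω * (expM S.W1 p u t ω * expM S.W2 q u t ω) ∂S.P - (S.P.real A : ℂ)‖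
        ≤ (ε + D / n / ε) / 2 := by
    intro n hn ε hε
    have hn' : (0:ℝ) < n := by exact_mod_cast hn
    set δ := τ / n with hδ
    have hδ0 : 0 ≤ δ := by positivity
    have hδτ : δ ≤ τ := div_le_self hτ0 (by exact_mod_cast hn)
    set g : ℕ → ℝ := fun j => min (u + j * δ) t with hg
    have g0 : g 0 = u := by simp [hg, hut]
    have gn : g n = t := by
      simp only [hg, hδ]; rw [mul_div_cancel₀ _ hn'.ne']; simp [hτ]
    have gmono : Monotone g := by
      intro i j hij
      have : (i:ℝ) ≤ j := by exact_mod_cast hij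
      exact min_le_min (by have := mul_le_mul_of_nonneg_right this hδ0; linarith) le_rfl
    have gu : ∀ j, u ≤ g j := fun j => g0 ▸ gmono (Nat.zero_le j)
    have gt : ∀ j, g j ≤ t := fun j => min_le_right _ _
    have gst : ∀ j, g j ≤ g (j+1) := fun j => gmono (Nat.le_succ j)
    have gd : ∀ j, g (j+1) - g j ≤ δ := by
      intro j
      simp only [hg]; push_cast
      rcases le_total (u + j * δ) t with h | h
      · rw [min_eq_left h]; have := min_le_left (u + (j+1) * δ) t; linarith
      · rw [min_eq_right h]; have := min_le_right (u + (j+1) * δ) t; linarith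
    have gen : ∀ (W : ℝ → Ω → ℝ) (hW : IsStdBM S.P S.F W) (p : ℝ), Real.exp (p ^ 2 * τ / 2) ≤ K →
        (∀ j, Measurable[S.F (g j)] (expM W p u (g j))) ∧ (∀ j ω, ‖expM W p u (g j) ω‖ ≤ K) ∧
        (∀ j, ∀ Z : Ω → ℂ, Measurable[S.F (g j)] Z → (∃ K, ∀ ω, ‖Z ω‖ ≤ K) →
          ∫ ω, Z ω * (expM W p u (g (j+1)) ω - expM W p u (g j) ω) ∂S.P = 0) ∧
        (∀ j, ∫ ω, ‖expM W p u (g (j+1)) ω - expM W p u (g j) ω‖ ^ 2 ∂S.P ≤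
          K ^ 2 * (p ^ 2 * δ * Real.exp (p ^ 2 * τ))) := by
      intro W hW p hpK
      have hWm : ∀ r, Measurable (W r) := fun r => (hW.adapted r).mono (S.F.le r) le_rfl
      have m1 : ∀ j, Measurable[S.F (g j)] (expM W p u (g j)) := fun j =>
        measurable_expM p (hW.adapted _) ((hW.adapted u).mono (S.F.mono (gu j)) le_rfl)
      have m2 : ∀ j ω, ‖expM W p u (g j) ω‖ ≤ K := by
        intro j ω
        rw [norm_expM]
        refine le_trans (Real.exp_le_exp.mpr ?_) hpK
        have : g j - u ≤ τ := by have := gt j; simp only [hτ]; linarith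
        gcongr
      have e1 : ∀ j ω, expM W p u (g (j+1)) ω - expM W p u (g j) ω =
          expM W p u (g j) ω * (expM W p (g j) (g (j+1)) ω - 1) := by
        intro j ω; rw [expM_mul W p u (g j) (g (j+1))]; ring
      refine ⟨m1, m2, ?_, ?_⟩
      · intro j Z hZ hb
        obtain ⟨K', hb⟩ := hb
        have e : ∀ ω, Z ω * (expM W p u (g (j+1)) ω - expM W p u (g j) ω) =
          (Z ω * expM W p u (g j) ω) * expM W p (g j) (g (j+1)) ω - Z ω * expM W p u (g j) ω := by
          intro ω; rw [e1]; ring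
        simp_rw [e]
        have hZm := hZ.mono (S.F.le _) le_rfl
        have a1 : Measurable (fun ω => Z ω * expM W p u (g j) ω) := hZm.mul (measurable_expM p (hWm _) (hWm _))
        have a2 : ∀ ω, ‖Z ω * expM W p u (g j) ω‖ ≤ K' * K := fun ω => by
          rw [norm_mul]; exact mul_le_mul (hb ω) (m2 j ω) (norm_nonneg _) ((norm_nonneg _).trans (hb ω))
        have a3 : Integrable (fun ω => (Z ω * expM W p u (g j) ω) * expM W p (g j) (g (j+1)) ω) S.P := by
          refine intble_of_bdd (a1.mul (measurable_expM p (hWm _) (hWm _)))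
            (K := K' * K * Real.exp (p ^ 2 * (g (j+1) - g j) / 2)) fun ω => ?_
          rw [norm_mul, norm_expM W p (g j) (g (j+1)) ω]
          exact mul_le_mul_of_nonneg_right (a2 ω) (Real.exp_pos _).le
        rw [integral_sub a3 (intble_of_bdd a1 a2),
          expM_mart hW (hu.trans (gu j)) (gst j) p (fun ω => Z ω * expM W p u (g j) ω) (hZ.mul (m1 j)), sub_self]
      · intro j
        have b0 : ∫ ω, ‖expM W p (g j) (g (j+1)) ω - 1‖ ^ 2 ∂S.P ≤ p ^ 2 * δ * Real.exp (p ^ 2 * τ) := by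
          rw [expM_var hW (hu.trans (gu j)) (gst j) p]
          have h1 : p ^ 2 * (g (j+1) - g j) ≤ p ^ 2 * δ := by have := gd j; gcongr
          have h2 : p ^ 2 * δ ≤ p ^ 2 * τ := by gcongr
          have h3 := Real.exp_le_exp.mpr h1
          have h4 := Real.exp_le_exp.mpr h2
          have h5 := Real.add_one_le_exp (-(p ^ 2 * δ))
          have h6 : Real.exp (p ^ 2 * δ) * Real.exp (-(p ^ 2 * δ)) = 1 := by rw [← Real.exp_add]; simp
          have h7 : 0 ≤ p ^ 2 * δ := by positivity
          have h8 := Real.exp_pos (p ^ 2 * δ)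
          nlinarith
        have b1 : ∀ ω, ‖expM W p u (g (j+1)) ω - expM W p u (g j) ω‖ ^ 2 ≤
            K ^ 2 * ‖expM W p (g j) (g (j+1)) ω - 1‖ ^ 2 := by
          intro ω
          rw [e1, norm_mul, mul_pow]
          have := m2 j ω
          gcongr
        refine le_trans (integral_mono_of_nonneg (Filter.Eventually.of_forall fun ω => by positivity) ?_
          (Filter.Eventually.of_forall b1)) ?_
        · refine Integrable.const_mul ?_ _
          refine Integrable.of_bound (((measurable_expM p (hWm _) (hWm _)).sub measurable_const).norm.pow_const 2).aestronglyMeasurable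
            ((Real.exp (p ^ 2 * (g (j+1) - g j) / 2) + 1) ^ 2) (Filter.Eventually.of_forall fun ω => ?_)
          rw [Real.norm_of_nonneg (by positivity)]
          have := norm_sub_le (expM W p (g j) (g (j+1)) ω) 1
          rw [norm_expM, norm_one] at this
          gcongr
        · rw [integral_const_mul]
          gcongr
    obtain ⟨M1, M2, M3, M4⟩ := gen S.W1 S.bm1 p (by simp only [hK]; have := Real.exp_pos (q ^ 2 * τ / 2); linarith)
    obtain ⟨N1, N2, N3, N4⟩ := gen S.W2 S.bm2 q (by simp only [hK]; have := Real.exp_pos (p ^ 2 * τ / 2); linarith)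
    have hsup : ∀ (W : ℝ → Ω → ℝ) (p : ℝ) (i j : ℕ), MeasurableSpace.comap
        (fun ω => (expM W p u (g (i+1)) ω - expM W p u (g i) ω) * star (expM W p u (g (j+1)) ω - expM W p u (g j) ω))
        inferInstance ≤ ⨆ t : ℝ, MeasurableSpace.comap (W t) inferInstance := by
      intro W p i j
      have hm : ∀ r, Measurable[⨆ t : ℝ, MeasurableSpace.comap (W t) inferInstance] (W r) := fun r =>
        Measurable.mono (comap_measurable (W r)) (le_iSup (fun t : ℝ => MeasurableSpace.comap (W t) inferInstance) r) le_rfl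
      have h1 : ∀ i, Measurable[⨆ t : ℝ, MeasurableSpace.comap (W t) inferInstance] (expM W p u (g i)) := fun i =>
        measurable_expM p (hm _) (hm _)
      exact (((h1 _).sub (h1 _)).mul (continuous_star.measurable.comp ((h1 _).sub (h1 _)))).comap_le
    have := levy_abstract (P := S.P) (fun j => S.F (g j)) (fun j => S.F.le _) (fun i j hij => S.F.mono (gmono hij))
      (fun j => expM S.W1 p u (g j)) (fun j => expM S.W2 q u (g j)) M1 N1 K M2 N2 M3 N3
      (fun i j => by
        rw [IndepFun_iff_Indep]
        exact indep_of_indep_of_le_left (indep_of_indep_of_le_right S.indepW (hsup S.W2 q i j)) (hsup S.W1 p i j))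
      _ _ M4 N4 (fun ω => by simp [g0, expM]) (fun ω => by simp [g0, expM]) A (by show MeasurableSet[S.F (g 0)] A; rw [g0]; exact hA) n ε hε
    simp only [gn] at this
    refine this.trans (le_of_eq ?_)
    simp only [hD, hδ]
    field_simp
  have lim : ∀ ε : ℝ, 0 < ε →
      ‖∫ ω, A.indicator 1 ω * (expM S.W1 p u t ω * expM S.W2 q u t ω) ∂S.P - (S.P.real A : ℂ)‖ ≤ ε := by
    intro ε hε
    obtain ⟨n, hn⟩ := exists_nat_gt (D / ε ^ 2)
    have hD0 : 0 ≤ D := by positivity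
    have hn0 : (0:ℝ) < n := lt_of_le_of_lt (by positivity) hn
    refine (key n (by exact_mod_cast hn0) ε hε).trans ?_
    have : D / n / ε ≤ ε := by
      rw [div_le_iff₀ hε, div_le_iff₀ hn0]
      rw [div_lt_iff₀ (by positivity)] at hn
      nlinarith
    linarith
  have h0 : ‖∫ ω, A.indicator 1 ω * (expM S.W1 p u t ω * expM S.W2 q u t ω) ∂S.P - (S.P.real A : ℂ)‖ ≤ 0 :=
    le_of_forall_pos_le_add fun ε hε => by simpa using lim ε hε
  exact sub_eq_zero.mp (norm_le_zero_iff.mp h0)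
end

section
/-- law of the increments over a time step `d` -/
def nu (d : ℝ) : Measure (ℝ × ℝ) := (gaussianReal 0 (Real.toNNReal d)).prod (gaussianReal 0 (Real.toNNReal d))

instance (d : ℝ) : IsProbabilityMeasure (nu d) := by unfold nu; infer_instance

/-- joint increments -/
def dW (S : Setting Ω) (u t : ℝ) (ω : Ω) : ℝ × ℝ := (S.W1 t ω - S.W1 u ω, S.W2 t ω - S.W2 u ω)

lemma measurable_W1 (S : Setting Ω) (t : ℝ) : Measurable (S.W1 t) := (S.bm1.adapted t).mono (S.F.le t) le_rfl
lemma measurable_W2 (S : Setting Ω) (t : ℝ) : Measurable (S.W2 t) := (S.bm2.adapted t).mono (S.F.le t) le_rfl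

lemma measurable_dW (S : Setting Ω) (u t : ℝ) : Measurable (dW S u t) :=
  ((measurable_W1 S t).sub (measurable_W1 S u)).prodMk ((measurable_W2 S t).sub (measurable_W2 S u))

lemma charFunDual_nu (d : ℝ) (hd : 0 ≤ d) (L : StrongDual ℝ (ℝ × ℝ)) :
    charFunDual (nu d) L = Complex.exp (-(((L (1,0)) ^ 2 + (L (0,1)) ^ 2) * d / 2 : ℝ)) := by
  have g : ∀ (L' : StrongDual ℝ ℝ), charFunDual (gaussianReal 0 (Real.toNNReal d)) L'
      = Complex.exp (-((L' 1) ^ 2 * d / 2 : ℝ)) := by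
    intro L'
    have h := charFun_gaussianReal (μ := 0) (v := Real.toNNReal d) (L' 1)
    rw [charFun_apply_real, Real.coe_toNNReal _ hd] at h
    rw [charFunDual_apply]
    have e : ∀ x : ℝ, ((L' x : ℝ) : ℂ) = (L' 1 : ℝ) * (x : ℂ) := by
      intro x
      have : L' x = x * L' 1 := by
        conv_lhs => rw [← mul_one x, ← smul_eq_mul, L'.map_smul, smul_eq_mul]
      rw [this]; push_cast; ring
    rw [show (fun x : ℝ => Complex.exp ((L' x : ℝ) * Complex.I)) = fun x : ℝ => Complex.exp ((L' 1 : ℝ) * x * Complex.I)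
      from funext fun x => by rw [e x], h]
    congr 1; push_cast; ring
  rw [nu, charFunDual_prod, g, g, ← Complex.exp_add]
  simp only [ContinuousLinearMap.comp_apply, ContinuousLinearMap.inl_apply, ContinuousLinearMap.inr_apply]
  congr 1; push_cast; ring

lemma dW_law (S : Setting Ω) {u t : ℝ} (hu : 0 ≤ u) (hut : u ≤ t) (A : Set Ω)
    (hA : MeasurableSet[S.F u] A) :
    (S.P.restrict A).map (dW S u t) = S.P A • nu (t - u) := by
  haveI := S.isProb
  have hA' : MeasurableSet A := S.F.le u A hA
  haveI : IsFiniteMeasure (S.P A • nu (t - u)) := by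
    refine ⟨?_⟩
    simp [measure_lt_top]
  haveI : IsFiniteMeasure ((S.P.restrict A).map (dW S u t)) := by infer_instance
  refine Measure.ext_of_charFunDual ?_
  ext L
  have e1 : charFunDual (S.P A • nu (t - u)) L = (S.P.real A : ℂ) * charFunDual (nu (t-u)) L := by
    rw [charFunDual_apply, charFunDual_apply, integral_smul_measure]; simp [Measure.real]
  rw [e1, charFunDual_nu _ (sub_nonneg.mpr hut), charFunDual_apply, integral_map (measurable_dW S u t).aemeasurable
    (by fun_prop)]
  have h := levy_char S hu hut (L (1,0)) (L (0,1)) A hA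
  have e2 : ∀ ω, A.indicator 1 ω * (expM S.W1 (L (1,0)) u t ω * expM S.W2 (L (0,1)) u t ω) =
      A.indicator (fun ω => Complex.exp ((L (dW S u t ω) : ℝ) * Complex.I)) ω *
        Complex.exp (((((L (1,0)) ^ 2 + (L (0,1)) ^ 2) * (t - u) / 2 : ℝ))) := by
    intro ω
    by_cases hω : ω ∈ A
    · simp only [hω, Set.indicator_of_mem, Pi.one_apply, one_mul, expM]
      rw [← Complex.exp_add, ← Complex.exp_add]
      have : L (dW S u t ω) = L (1,0) * (S.W1 t ω - S.W1 u ω) + L (0,1) * (S.W2 t ω - S.W2 u ω) := by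
        have : dW S u t ω = (S.W1 t ω - S.W1 u ω) • ((1:ℝ),(0:ℝ)) + (S.W2 t ω - S.W2 u ω) • ((0:ℝ),(1:ℝ)) := by
          simp [dW]
        rw [this, map_add, map_smul, map_smul, smul_eq_mul, smul_eq_mul]; ring
      rw [this]
      congr 1; push_cast; ring
    · simp [hω]
  simp_rw [e2] at h
  rw [integral_mul_const, integral_indicator hA'] at h
  rw [← h, mul_assoc, ← Complex.exp_add]
  simp

/-- One-step disintegration. -/
lemma one_step (S : Setting Ω) {u t : ℝ} (hu : 0 ≤ u) (hut : u ≤ t) {α : Type*} [MeasurableSpace α]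
    (ξ : Ω → α) (hξ : Measurable[S.F u] ξ) (f : α × (ℝ × ℝ) → ℝ≥0∞) (hf : Measurable f) :
    ∫⁻ ω, f (ξ ω, dW S u t ω) ∂S.P = ∫⁻ ω, ∫⁻ y, f (ξ ω, y) ∂(nu (t - u)) ∂S.P := by
  haveI := S.isProb
  have hξ' : Measurable ξ := hξ.mono (S.F.le u) le_rfl
  have hmap : S.P.map (fun ω => (ξ ω, dW S u t ω)) = (S.P.map ξ).prod (nu (t - u)) := by
    haveI : IsProbabilityMeasure (S.P.map ξ) := Measure.isProbabilityMeasure_map hξ'.aemeasurable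
    symm
    refine Measure.prod_eq fun s r hs hr => ?_
    rw [Measure.map_apply (hξ'.prodMk (measurable_dW S u t)) (hs.prod hr), Measure.map_apply hξ' hs]
    have h := dW_law S hu hut (ξ ⁻¹' s) (hξ hs)
    have h2 := congrArg (fun μ => μ r) h
    simp only [Measure.smul_apply, smul_eq_mul] at h2
    rw [Measure.map_apply (measurable_dW S u t) hr, Measure.restrict_apply (measurable_dW S u t hr)] at h2
    rw [← h2]
    congr 1
    ext ω; simp [and_comm]
  calc ∫⁻ ω, f (ξ ω, dW S u t ω) ∂S.P = ∫⁻ z, f z ∂(S.P.map (fun ω => (ξ ω, dW S u t ω))) :=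
        (lintegral_map hf (hξ'.prodMk (measurable_dW S u t))).symm
    _ = ∫⁻ x, ∫⁻ y, f (x, y) ∂(nu (t - u)) ∂(S.P.map ξ) := by rw [hmap, lintegral_prod _ hf.aemeasurable]
    _ = _ := lintegral_map hf.lintegral_prod_right' hξ'
end

section
lemma gauss_exp_abs (K τ : ℝ) (hτ : 0 ≤ τ) :
    ∫⁻ x, ENNReal.ofReal (Real.exp (K * |x|)) ∂(gaussianReal 0 (Real.toNNReal τ))
      ≤ ENNReal.ofReal (2 * Real.exp (K ^ 2 * τ / 2)) := by
  have h : ∀ K : ℝ, ∫⁻ x, ENNReal.ofReal (Real.exp (K * x)) ∂(gaussianReal 0 (Real.toNNReal τ))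
      = ENNReal.ofReal (Real.exp (K ^ 2 * τ / 2)) := by
    intro K
    have h1 := mgf_gaussianReal (p := gaussianReal 0 (Real.toNNReal τ)) (X := id) (μ := 0) (v := Real.toNNReal τ)
      (by simp) K
    rw [mgf, Real.coe_toNNReal _ hτ] at h1
    simp only [id] at h1
    rw [← ofReal_integral_eq_lintegral_ofReal, h1]
    · congr 2; ring
    · exact integrable_exp_mul_gaussianReal K
    · exact Filter.Eventually.of_forall fun x => (Real.exp_pos _).le
  calc _ ≤ ∫⁻ x, (ENNReal.ofReal (Real.exp (K * x)) + ENNReal.ofReal (Real.exp ((-K) * x)))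
        ∂(gaussianReal 0 (Real.toNNReal τ)) := by
        refine lintegral_mono fun x => ?_
        rcases abs_cases x with ⟨h, _⟩ | ⟨h, _⟩
        · rw [h]; exact le_self_add
        · rw [h, mul_neg, ← neg_mul]; exact le_add_self
    _ = _ := by
        rw [lintegral_add_left (by fun_prop), h, h, ← ENNReal.ofReal_add (Real.exp_pos _).le (Real.exp_pos _).le]
        congr 1; rw [neg_sq]; ring

lemma exp_le_conv (a c : ℝ) (hc : 0 < c) (hc1 : c ≤ 1) : Real.exp a ≤ 1 + c * Real.exp (a / c) := by
  have h := convexOn_exp.2 (Set.mem_univ (a / c)) (Set.mem_univ 0) hc.le (sub_nonneg.mpr hc1) (by ring)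
  simp only [smul_eq_mul, mul_zero, add_zero, Real.exp_zero, mul_one] at h
  rw [mul_div_cancel₀ _ hc.ne'] at h
  linarith

/-- size of the noise over a time step -/
def tt (d : ℝ) (y : ℝ × ℝ) : ℝ := d + |y.1| + |y.2|

lemma measurable_tt : Measurable (fun z : ℝ × (ℝ × ℝ) => tt z.1 z.2) := by
  unfold tt; fun_prop

lemma tt_nonneg {d : ℝ} (hd : 0 ≤ d) (y : ℝ × ℝ) : 0 ≤ tt d y := by unfold tt; positivity

lemma nu_exp_prod (K d τ A : ℝ) (hA : 0 ≤ A)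
    (h : ∫⁻ x, ENNReal.ofReal (Real.exp (K * |x|)) ∂(gaussianReal 0 (Real.toNNReal τ)) ≤ ENNReal.ofReal A) :
    ∫⁻ y, ENNReal.ofReal (Real.exp (K * tt d y)) ∂(nu τ) ≤ ENNReal.ofReal (Real.exp (K * d) * A ^ 2) := by
  have e : ∀ y : ℝ × ℝ, ENNReal.ofReal (Real.exp (K * tt d y)) = ENNReal.ofReal (Real.exp (K * d)) *
      (ENNReal.ofReal (Real.exp (K * |y.1|)) * ENNReal.ofReal (Real.exp (K * |y.2|))) := by
    intro y
    rw [← ENNReal.ofReal_mul (Real.exp_pos _).le, ← ENNReal.ofReal_mul (Real.exp_pos _).le, ← Real.exp_add, ← Real.exp_add]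
    congr 2; unfold tt; ring
  simp_rw [e]
  rw [lintegral_const_mul _ (by fun_prop), nu,
    lintegral_prod_mul (f := fun x => ENNReal.ofReal (Real.exp (K * |x|))) (g := fun x => ENNReal.ofReal (Real.exp (K * |x|)))
      (by fun_prop) (by fun_prop), ENNReal.ofReal_mul (Real.exp_pos _).le, sq, ENNReal.ofReal_mul hA]
  gcongr

/-- bound for the exponential moment of the noise -/
def vth (K d : ℝ) : ℝ := Real.exp (K * d) * (1 + 2 * √d * Real.exp (K ^ 2 / 2)) ^ 2

lemma vth_cont (K : ℝ) : Continuous (vth K) := by unfold vth; fun_prop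
lemma vth_zero (K : ℝ) : vth K 0 = 1 := by simp [vth]
lemma one_le_vth {K d : ℝ} (hK : 0 ≤ K) (hd : 0 ≤ d) : 1 ≤ vth K d := by
  unfold vth
  have h1 : 1 ≤ Real.exp (K * d) := Real.one_le_exp (by positivity)
  have h2 : 1 ≤ (1 + 2 * √d * Real.exp (K ^ 2 / 2)) ^ 2 := by
    apply one_le_pow₀; have : 0 ≤ 2 * √d * Real.exp (K ^ 2 / 2) := by positivity
    linarith
  nlinarith

lemma nu_exp_le (K d τ : ℝ) (hK : 0 ≤ K) (hτ : 0 ≤ τ) (hτd : τ ≤ d) (hd : 0 < d) (hd1 : d ≤ 1) :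
    ∫⁻ y, ENNReal.ofReal (Real.exp (K * tt τ y)) ∂(nu τ) ≤ ENNReal.ofReal (vth K d) := by
  have hc : 0 < √d := Real.sqrt_pos.mpr hd
  have hc1 : √d ≤ 1 := Real.sqrt_le_one.mpr hd1
  refine (lintegral_mono (fun y => ENNReal.ofReal_le_ofReal (Real.exp_le_exp.mpr ?_))).trans
    (nu_exp_prod K d τ (1 + 2 * √d * Real.exp (K ^ 2 / 2)) (by positivity) ?_)
  · unfold tt; gcongr
  · calc _ ≤ ∫⁻ x, (1 + ENNReal.ofReal (√d) * ENNReal.ofReal (Real.exp ((K / √d) * |x|))) ∂(gaussianReal 0 (Real.toNNReal τ)) := by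
          refine lintegral_mono fun x => ?_
          simp only
          rw [← ENNReal.ofReal_mul hc.le, ← ENNReal.ofReal_one, ← ENNReal.ofReal_add zero_le_one (by positivity)]
          refine ENNReal.ofReal_le_ofReal ?_
          have := exp_le_conv (K * |x|) (√d) hc hc1
          rwa [mul_div_right_comm] at this
      _ ≤ 1 + ENNReal.ofReal (√d) * ENNReal.ofReal (2 * Real.exp ((K / √d) ^ 2 * τ / 2)) := by
          rw [lintegral_add_left measurable_const, lintegral_const_mul _ (by fun_prop)]
          simp only [lintegral_const, measure_univ, mul_one]
          gcongr
          exact gauss_exp_abs (K / √d) τ hτ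
      _ ≤ _ := by
          rw [← ENNReal.ofReal_mul hc.le, ← ENNReal.ofReal_one, ← ENNReal.ofReal_add zero_le_one (by positivity)]
          refine ENNReal.ofReal_le_ofReal ?_
          have h1 : (K / √d) ^ 2 * τ / 2 ≤ K ^ 2 / 2 := by
            rw [div_pow, Real.sq_sqrt hd.le]
            have : K ^ 2 / d * τ ≤ K ^ 2 := by
              rw [div_mul_eq_mul_div, div_le_iff₀ hd]; gcongr
            linarith
          have := Real.exp_le_exp.mpr h1
          have : √d * (2 * Real.exp ((K / √d) ^ 2 * τ / 2)) ≤ 2 * √d * Real.exp (K ^ 2 / 2) := by nlinarith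
          linarith

lemma nu_moment4 (K d : ℝ) (hK : 0 ≤ K) (hd : 0 < d) (hd1 : d ≤ 1) :
    ∫⁻ y, ENNReal.ofReal ((tt d y) ^ 4 * Real.exp (K * tt d y)) ∂(nu d) ≤
      ENNReal.ofReal (d ^ 2 * (24 * (Real.exp (K + 1) * (2 * Real.exp ((K + 1) ^ 2 / 2)) ^ 2))) := by
  have hc : 0 < √d := Real.sqrt_pos.mpr hd
  have hc1 : √d ≤ 1 := Real.sqrt_le_one.mpr hd1
  set K' := K + 1 / √d with hK'
  have hK'1 : K' ^ 2 * d ≤ (K + 1) ^ 2 := by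
    have : K' * √d ≤ K + 1 := by
      rw [hK', add_mul, one_div_mul_cancel hc.ne']; nlinarith
    have h2 : (K' * √d) ^ 2 ≤ (K + 1) ^ 2 := pow_le_pow_left₀ (by positivity) this 2
    rwa [mul_pow, Real.sq_sqrt hd.le] at h2
  have hK'2 : K' * d ≤ K + 1 := by
    have : 1 / √d * d ≤ 1 := by
      rw [one_div_mul_eq_div, Real.div_sqrt]; exact hc1
    rw [hK', add_mul]; nlinarith
  have h0 := nu_exp_prod K' d d (2 * Real.exp (K' ^ 2 * d / 2)) (by positivity) (gauss_exp_abs K' d hd.le)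
  calc _ ≤ ∫⁻ y, ENNReal.ofReal (d ^ 2 * 24) * ENNReal.ofReal (Real.exp (K' * tt d y)) ∂(nu d) := by
        refine lintegral_mono fun y => ?_
        simp only
        rw [← ENNReal.ofReal_mul (by positivity)]
        refine ENNReal.ofReal_le_ofReal ?_
        have ht := tt_nonneg hd.le y
        have h1 := Real.pow_div_factorial_le_exp (tt d y / √d) (by positivity) 4
        rw [div_pow, show (√d) ^ 4 = d ^ 2 by rw [show (4:ℕ) = 2 * 2 by norm_num, pow_mul, Real.sq_sqrt hd.le]] at h1
        have h2 : tt d y ^ 4 ≤ d ^ 2 * 24 * Real.exp (tt d y / √d) := by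
          rw [div_div, div_le_iff₀ (by positivity)] at h1
          simpa [Nat.factorial, mul_comm, mul_left_comm] using h1
        have h3 : Real.exp (K' * tt d y) = Real.exp (tt d y / √d) * Real.exp (K * tt d y) := by
          rw [← Real.exp_add]; congr 1; rw [hK']; ring
        rw [h3, ← mul_assoc]
        gcongr
    _ ≤ ENNReal.ofReal (d ^ 2 * 24) * ENNReal.ofReal (Real.exp (K' * d) * (2 * Real.exp (K' ^ 2 * d / 2)) ^ 2) := by
        rw [lintegral_const_mul]
        · gcongr
        · unfold tt; fun_prop
    _ ≤ _ := by
        rw [← ENNReal.ofReal_mul (by positivity), mul_assoc]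
        refine ENNReal.ofReal_le_ofReal ?_
        gcongr
end

section
def sg (S : Setting Ω) : ℝ := S.σ - 1
def bb (S : Setting Ω) : ℝ := S.γ * (S.σ - 1)
def kap (S : Setting Ω) : ℝ := |S.B - S.β₁ ^ 2 / 2| + S.β₁ + (S.ρ + S.β₂ ^ 2 / 2) + S.β₂
def KK (S : Setting Ω) : ℝ := (bb S + sg S) * kap S

lemma sg_pos (S : Setting Ω) : 0 < sg S := by have := S.hσ; unfold sg; linarith
lemma bb_nonneg (S : Setting Ω) : 0 ≤ bb S := mul_nonneg S.hγ₀ (sg_pos S).le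
lemma kap_pos (S : Setting Ω) : 0 < kap S := by
  have := S.hβ₁; have := S.hβ₂; have := S.hρ₀
  unfold kap; positivity
lemma KK_nonneg (S : Setting Ω) : 0 ≤ KK S :=
  mul_nonneg (add_nonneg (bb_nonneg S) (sg_pos S).le) (kap_pos S).le

/-- next state of the discrete scheme -/
def nxt (S : Setting Ω) (d q : ℝ) (z y : ℝ × ℝ) : ℝ × ℝ :=
  (Real.exp ((S.B - S.β₁ ^ 2 / 2) * d + S.β₁ * y.1) * (z.1 - q * z.1 * d),
   Real.exp ((-S.ρ - S.β₂ ^ 2 / 2) * d + S.β₂ * y.2) * (z.2 + S.ρ * (q * z.1) * d))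

/-- running cost of the discrete scheme -/
def Lc (S : Setting Ω) (d q : ℝ) (z : ℝ × ℝ) : ℝ :=
  (sg S)⁻¹ * d * vth (KK S) d * (z.2 + S.ρ * (q * z.1) * d) ^ (bb S) * (q * z.1) ^ (-sg S)

def TT (S : Setting Ω) (d q : ℝ) (v : ℝ × ℝ → ℝ≥0∞) (z : ℝ × ℝ) : ℝ≥0∞ :=
  ENNReal.ofReal (Lc S d q z) + ENNReal.ofReal (Real.exp (-S.θ * d)) * ∫⁻ y, v (nxt S d q z y) ∂(nu d)

def act (S : Setting Ω) (δ : ℝ) (i : ℕ) : ℝ := S.R * (1 + S.R * δ)⁻¹ ^ (i + 1)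

def uu (S : Setting Ω) (δ : ℝ) : ℕ → ℝ × ℝ → ℝ≥0∞
  | 0 => fun _ => 0
  | N + 1 => fun z => ⨅ i, TT S δ (act S δ i) (uu S δ N) z

def vv (S : Setting Ω) (δ : ℝ) (z : ℝ × ℝ) : ℝ≥0∞ := ⨆ N, uu S δ N z

lemma measurable_nxt (S : Setting Ω) (d : ℝ) :
    Measurable (fun p : ℝ × (ℝ × ℝ) × (ℝ × ℝ) => nxt S d p.1 p.2.1 p.2.2) := by
  unfold nxt; fun_prop

lemma measurable_nxt' (S : Setting Ω) (d q : ℝ) :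
    Measurable (fun p : (ℝ × ℝ) × (ℝ × ℝ) => nxt S d q p.1 p.2) := by
  unfold nxt; fun_prop

lemma measurable_Lc (S : Setting Ω) (d : ℝ) : Measurable (fun p : ℝ × (ℝ × ℝ) => Lc S d p.1 p.2) := by
  unfold Lc; fun_prop

lemma measurable_TT (S : Setting Ω) (d q : ℝ) {v : ℝ × ℝ → ℝ≥0∞} (hv : Measurable v) :
    Measurable (TT S d q v) := by
  unfold TT
  have h1 : Measurable fun z => ENNReal.ofReal (Lc S d q z) :=
    ((measurable_Lc S d).comp (measurable_const.prodMk measurable_id)).ennreal_ofReal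
  have h2 : Measurable fun z => ∫⁻ y, v (nxt S d q z y) ∂(nu d) :=
    Measurable.lintegral_prod_right' (f := fun p : (ℝ × ℝ) × (ℝ × ℝ) => v (nxt S d q p.1 p.2))
      (hv.comp (measurable_nxt' S d q))
  exact h1.add (h2.const_mul _)

lemma measurable_uu (S : Setting Ω) (δ : ℝ) (N : ℕ) : Measurable (uu S δ N) := by
  induction N with
  | zero => exact measurable_const
  | succ N ih => exact Measurable.iInf fun i => measurable_TT S _ _ ih

lemma measurable_vv (S : Setting Ω) (δ : ℝ) : Measurable (vv S δ) :=
  Measurable.iSup fun N => measurable_uu S δ N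

lemma TT_mono (S : Setting Ω) (d q : ℝ) {v w : ℝ × ℝ → ℝ≥0∞} (h : v ≤ w) (z : ℝ × ℝ) :
    TT S d q v z ≤ TT S d q w z := by
  unfold TT; gcongr with y; exact h _

lemma uu_mono (S : Setting Ω) (δ : ℝ) : Monotone (uu S δ) := by
  refine monotone_nat_of_le_succ fun N => ?_
  induction N with
  | zero => intro z; exact zero_le
  | succ N ih => intro z; exact iInf_mono fun i => TT_mono S _ _ ih z

lemma TT_vv (S : Setting Ω) (δ d q : ℝ) (z : ℝ × ℝ) :
    TT S d q (vv S δ) z = ⨆ N, TT S d q (uu S δ N) z := by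
  unfold TT vv
  rw [lintegral_iSup, ENNReal.mul_iSup, ENNReal.add_iSup]
  · intro N
    exact (measurable_uu S δ N).comp ((measurable_nxt' S d q).comp (measurable_const.prodMk measurable_id))
  · intro N M h y; exact uu_mono S δ h _

lemma act_pos (S : Setting Ω) {δ : ℝ} (hδ : 0 < δ) (i : ℕ) : 0 < act S δ i := by
  have := S.hR; unfold act; positivity

lemma act_le (S : Setting Ω) {δ : ℝ} (hδ : 0 < δ) (i : ℕ) : act S δ i * (1 + S.R * δ) ≤ S.R := by
  have := S.hR
  have h1 : 0 < 1 + S.R * δ := by positivity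
  have h2 : (1 + S.R * δ)⁻¹ ^ i ≤ 1 := pow_le_one₀ (by positivity) (inv_le_one_of_one_le₀ (by nlinarith))
  unfold act
  rw [pow_succ, mul_assoc, mul_assoc, inv_mul_cancel₀ h1.ne', mul_one]
  nlinarith

lemma act_tendsto (S : Setting Ω) {δ : ℝ} (hδ : 0 < δ) : Filter.Tendsto (act S δ) Filter.atTop (nhds 0) := by
  have := S.hR
  have h1 : (1 + S.R * δ)⁻¹ < 1 := inv_lt_one_of_one_lt₀ (by nlinarith [mul_pos this hδ])
  have h := (tendsto_pow_atTop_nhds_zero_of_lt_one (by positivity) h1).comp (Filter.tendsto_add_atTop_nat 1)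
  have h' := h.const_mul S.R
  rw [mul_zero] at h'
  exact h'

/-- `q` is a feasible rate for a step `d` -/
def feas (S : Setting Ω) (d q : ℝ) : Prop := 0 < q ∧ q * (1 + S.R * d) ≤ S.R

lemma feas.mul_lt {S : Setting Ω} {d q : ℝ} (h : feas S d q) (hd : 0 ≤ d) : q * d < 1 := by
  have := S.hR
  obtain ⟨h0, h1⟩ := h
  by_contra hc
  push Not at hc
  nlinarith [mul_nonneg h0.le hd]

lemma nxt_pos (S : Setting Ω) {d q : ℝ} (hd : 0 ≤ d) (hq : feas S d q) {z : ℝ × ℝ} (h1 : 0 < z.1) (h2 : 0 < z.2)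
    (y : ℝ × ℝ) : 0 < (nxt S d q z y).1 ∧ 0 < (nxt S d q z y).2 := by
  have := hq.mul_lt hd
  have := S.hρ₀
  have := hq.1
  unfold nxt
  constructor
  · have : 0 < z.1 - q * z.1 * d := by nlinarith
    positivity
  · positivity

lemma Lc_nonneg (S : Setting Ω) {d q : ℝ} (hd : 0 ≤ d) (hq : 0 < q) {z : ℝ × ℝ} (h1 : 0 < z.1) (h2 : 0 < z.2) :
    0 ≤ Lc S d q z := by
  have := S.hρ₀
  have := sg_pos S
  have := one_le_vth (KK_nonneg S) hd
  unfold Lc; positivity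

lemma exists_sel (S : Setting Ω) {δ : ℝ} (hδ : 0 < δ) (z : ℝ × ℝ) (h1 : 0 < z.1) (h2 : 0 < z.2) :
    ∃ i, TT S δ (act S δ i) (vv S δ) z ≤ vv S δ z := by
  rcases eq_or_ne (vv S δ z) ⊤ with htop | htop
  · exact ⟨0, htop ▸ le_top⟩
  by_contra hc
  push Not at hc
  have hN : ∀ i, ∃ N, vv S δ z < TT S δ (act S δ i) (uu S δ N) z := by
    intro i
    have := hc i
    rw [TT_vv] at this
    exact lt_iSup_iff.mp this
  choose Ni hNi using hN
  have hs := sg_pos S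
  have hlim : Filter.Tendsto (fun i => Lc S δ (act S δ i) z) Filter.atTop Filter.atTop := by
    have hv : 0 < vth (KK S) δ := lt_of_lt_of_le one_pos (one_le_vth (KK_nonneg S) hδ.le)
    have e1 : Filter.Tendsto (fun i => act S δ i * z.1) Filter.atTop (nhdsWithin 0 (Set.Ioi 0)) := by
      refine tendsto_nhdsWithin_iff.mpr ⟨?_, Filter.Eventually.of_forall fun i => mul_pos (act_pos S hδ i) h1⟩
      simpa using (act_tendsto S hδ).mul_const z.1
    have e2 := (tendsto_rpow_neg_nhdsGT_zero (neg_lt_zero.mpr hs)).comp e1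
    have e3 : Filter.Tendsto (fun i => (sg S)⁻¹ * δ * vth (KK S) δ * (z.2 ) ^ (bb S) * (act S δ i * z.1) ^ (-sg S))
      Filter.atTop Filter.atTop := e2.const_mul_atTop (by positivity)
    refine Filter.tendsto_atTop_mono (fun i => ?_) e3
    unfold Lc
    have := act_pos S hδ i
    have := S.hρ₀
    have := bb_nonneg S
    gcongr
    have : 0 ≤ S.ρ * (act S δ i * z.1) * δ := by positivity
    linarith
  obtain ⟨I, hI⟩ := (hlim.eventually_ge_atTop ((vv S δ z).toReal + 1)).exists_forall_of_atTop
  set N := (Finset.range I).sup Ni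
  have key : vv S δ z < uu S δ (N + 1) z := by
    have hm : vv S δ z < ((Finset.range I).inf fun i => TT S δ (act S δ i) (uu S δ N) z) ⊓ (vv S δ z + 1) := by
      rw [lt_inf_iff, Finset.lt_inf_iff (lt_top_iff_ne_top.mpr htop)]
      refine ⟨fun i hi => (hNi i).trans_le ?_, ENNReal.lt_add_right htop one_ne_zero⟩
      exact TT_mono S _ _ (uu_mono S δ (Finset.le_sup hi)) z
    refine hm.trans_le (le_iInf fun i => ?_)
    by_cases hi : i < I
    · exact inf_le_left.trans (Finset.inf_le (Finset.mem_range.mpr hi))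
    · refine inf_le_right.trans ?_
      have := hI i (not_lt.mp hi)
      calc vv S δ z + 1 = ENNReal.ofReal ((vv S δ z).toReal + 1) := by
            rw [ENNReal.ofReal_add ENNReal.toReal_nonneg zero_le_one, ENNReal.ofReal_toReal htop, ENNReal.ofReal_one]
        _ ≤ ENNReal.ofReal (Lc S δ (act S δ i) z) := ENNReal.ofReal_le_ofReal this
        _ ≤ _ := le_self_add
  exact absurd (le_iSup (fun N => uu S δ N z) (N + 1)) (not_le.mpr key)

open Classical in
/-- measurable selector -/
def sel (S : Setting Ω) (δ : ℝ) (z : ℝ × ℝ) : ℕ :=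
  if h : ∃ i, TT S δ (act S δ i) (vv S δ) z ≤ vv S δ z then Nat.find h else 0

lemma sel_spec (S : Setting Ω) {δ : ℝ} (hδ : 0 < δ) (z : ℝ × ℝ) (h1 : 0 < z.1) (h2 : 0 < z.2) :
    TT S δ (act S δ (sel S δ z)) (vv S δ) z ≤ vv S δ z := by
  have h := exists_sel S hδ z h1 h2
  unfold sel
  rw [dif_pos h]
  exact Nat.find_spec h

lemma measurable_find_nat {α : Type*} [MeasurableSpace α] (p : α → ℕ → Prop)
    (hp : ∀ i, MeasurableSet {x | p x i}) (f : α → ℕ)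
    (hf : ∀ x, (∃ i, p x i) → p x (f x) ∧ ∀ j < f x, ¬ p x j) (hf0 : ∀ x, (¬ ∃ i, p x i) → f x = 0) :
    Measurable f := by
  refine measurable_to_countable' fun i => ?_
  have : f ⁻¹' {i} = ({x | p x i} ∩ ⋂ j ∈ {j | j < i}, {x | p x j}ᶜ) ∪ ({x | i = 0} ∩ (⋃ j, {x | p x j})ᶜ) := by
    ext x
    simp only [Set.mem_preimage, Set.mem_singleton_iff, Set.mem_union, Set.mem_inter_iff, Set.mem_ofPred_eq,
      Set.mem_iInter, Set.mem_compl_iff, Set.mem_iUnion]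
    by_cases hx : ∃ i, p x i
    · obtain ⟨a, b⟩ := hf x hx
      constructor
      · rintro rfl; exact Or.inl ⟨a, b⟩
      · rintro (⟨c, d⟩ | ⟨_, c⟩)
        · rcases lt_trichotomy (f x) i with h | h | h
          · exact absurd a (d _ h)
          · exact h
          · exact absurd c (b _ h)
        · exact absurd hx c
    · have := hf0 x hx
      constructor
      · rintro rfl; exact Or.inr ⟨this, hx⟩
      · rintro (⟨c, d⟩ | ⟨c, _⟩)
        · exact absurd ⟨_, c⟩ hx
        · rw [this, c]
  rw [this]
  refine ((hp i).inter (MeasurableSet.biInter (Set.to_countable _) fun j _ => (hp j).compl)).union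
    ((MeasurableSet.const _).inter (MeasurableSet.iUnion hp).compl)

lemma measurable_sel (S : Setting Ω) (δ : ℝ) : Measurable (sel S δ) := by
  classical
  refine measurable_find_nat (fun z i => TT S δ (act S δ i) (vv S δ) z ≤ vv S δ z) (fun i => ?_) _ ?_ ?_
  · exact measurableSet_le (measurable_TT S _ _ (measurable_vv S δ)) (measurable_vv S δ)
  · intro x h
    unfold sel
    rw [dif_pos h]
    exact ⟨Nat.find_spec h, fun j hj => Nat.find_min h hj⟩
  · intro x h; unfold sel; rw [dif_neg h]

/-- scaling for the running cost ratio -/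
lemma scale_rpow {x x' a a' l m b s : ℝ} (hx' : 0 ≤ x') (hl : 0 < l) (hm : 0 < m) (hx : 0 ≤ x) (ha : 0 < a)
    (hb : 0 ≤ b) (h : x' ≤ m * x) (haa : a' = a / l) :
    x' ^ b * a' ^ (-s) ≤ l ^ s * m ^ b * (x ^ b * a ^ (-s)) := by
  rw [haa, Real.div_rpow ha.le hl.le, Real.rpow_neg hl.le, div_inv_eq_mul]
  have : x' ^ b ≤ m ^ b * x ^ b := by
    rw [← Real.mul_rpow hm.le hx]; exact Real.rpow_le_rpow hx' h hb
  have h3 : 0 ≤ a ^ (-s) * l ^ s := by positivity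
  nlinarith [mul_le_mul_of_nonneg_right this h3]

lemma uu_scale (S : Setting Ω) {δ : ℝ} (hδ : 0 < δ) (N : ℕ) : ∀ (k h h' l m : ℝ), 0 < k → 0 < h → 0 < h' →
    0 < l → 0 < m → h' ≤ m * h → 1 ≤ m * l →
    uu S δ N (k / l, h') ≤ ENNReal.ofReal (l ^ sg S * m ^ bb S) * uu S δ N (k, h) := by
  induction N with
  | zero => intros; simp [uu]
  | succ N ih =>
    intro k h h' l m hk hh hh' hl hm h1 h2
    have hs := sg_pos S
    simp only [uu]
    rw [ENNReal.mul_iInf_of_ne (by rw [Ne, ENNReal.ofReal_eq_zero, not_le]; positivity) ENNReal.ofReal_ne_top]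
    refine iInf_mono fun i => ?_
    have hq := act_pos S hδ i
    have hqf : feas S δ (act S δ i) := ⟨hq, act_le S hδ i⟩
    set q := act S δ i
    have hρ := S.hρ₀
    have hv := one_le_vth (KK_nonneg S) hδ.le
    have hlm : 1 / l ≤ m := by rwa [div_le_iff₀ hl]
    have hstep : ∀ x, 0 ≤ x → x / l ≤ m * x := by
      intro x hx
      have := mul_le_mul_of_nonneg_right hlm hx
      rwa [one_div_mul_eq_div] at this
    have hkk : h' + S.ρ * (q * (k / l)) * δ ≤ m * (h + S.ρ * (q * k) * δ) := by
      have := hstep (S.ρ * (q * k) * δ) (by positivity)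
      have e : S.ρ * (q * (k / l)) * δ = S.ρ * (q * k) * δ / l := by ring
      rw [e]; linarith
    unfold TT
    rw [mul_add]
    refine add_le_add ?_ ?_
    · rw [← ENNReal.ofReal_mul (by positivity)]
      refine ENNReal.ofReal_le_ofReal ?_
      unfold Lc
      have := scale_rpow (x := h + S.ρ * (q * k) * δ) (x' := h' + S.ρ * (q * (k / l)) * δ) (a := q * k)
        (a' := q * (k / l)) (l := l) (m := m) (b := bb S) (s := sg S) (by positivity) hl hm (by positivity) (by positivity)
        (bb_nonneg S) hkk (by ring)
      have h0 : 0 ≤ (sg S)⁻¹ * δ * vth (KK S) δ := by positivity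
      simp only
      calc _ = (sg S)⁻¹ * δ * vth (KK S) δ * ((h' + S.ρ * (q * (k / l)) * δ) ^ bb S * (q * (k / l)) ^ (-sg S)) := by ring
        _ ≤ _ := mul_le_mul_of_nonneg_left this h0
        _ = _ := by ring
    · rw [← mul_assoc, mul_comm (ENNReal.ofReal (l ^ sg S * m ^ bb S)), mul_assoc]
      gcongr
      rw [← lintegral_const_mul' _ _ ENNReal.ofReal_ne_top]
      refine lintegral_mono fun y => ?_
      have p1 := nxt_pos S hδ.le hqf (z := (k, h)) hk hh y
      have p2 := nxt_pos S hδ.le hqf (z := (k / l, h')) (div_pos hk hl) hh' y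
      have := ih (nxt S δ q (k, h) y).1 (nxt S δ q (k, h) y).2 (nxt S δ q (k / l, h') y).2 l m p1.1 p1.2 p2.2 hl hm
        (by unfold nxt
            simp only
            calc _ ≤ Real.exp ((-S.ρ - S.β₂ ^ 2 / 2) * δ + S.β₂ * y.2) * (m * (h + S.ρ * (q * k) * δ)) := by gcongr
              _ = _ := by ring) h2
      have e : nxt S δ q (k / l, h') y = ((nxt S δ q (k, h) y).1 / l, (nxt S δ q (k / l, h') y).2) := by
        unfold nxt
        refine Prod.ext ?_ rfl
        simp only; ring
      rw [e]; exact this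

lemma vv_scale (S : Setting Ω) {δ : ℝ} (hδ : 0 < δ) (k h h' l m : ℝ) (hk : 0 < k) (hh : 0 < h) (hh' : 0 < h')
    (hl : 0 < l) (hm : 0 < m) (h1 : h' ≤ m * h) (h2 : 1 ≤ m * l) :
    vv S δ (k / l, h') ≤ ENNReal.ofReal (l ^ sg S * m ^ bb S) * vv S δ (k, h) := by
  unfold vv
  rw [ENNReal.mul_iSup]
  exact iSup_mono fun N => uu_scale S hδ N k h h' l m hk hh hh' hl hm h1 h2
end

section
def EE (S : Setting Ω) (t : ℝ) (ω : Ω) : ℝ := (S.B - S.β₁ ^ 2 / 2) * t + S.β₁ * S.W1 t ω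
def GG (S : Setting Ω) (t : ℝ) (ω : Ω) : ℝ := (-S.ρ - S.β₂ ^ 2 / 2) * t + S.β₂ * S.W2 t ω

lemma cont_EE (S : Setting Ω) (ω : Ω) : Continuous fun t => EE S t ω := by
  have := S.bm1.cont ω; unfold EE; fun_prop
lemma cont_GG (S : Setting Ω) (ω : Ω) : Continuous fun t => GG S t ω := by
  have := S.bm2.cont ω; unfold GG; fun_prop
lemma EE_zero (S : Setting Ω) (ω : Ω) : EE S 0 ω = 0 := by simp [EE, S.bm1.init]
lemma GG_zero (S : Setting Ω) (ω : Ω) : GG S 0 ω = 0 := by simp [GG, S.bm2.init]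

lemma kProc_eq (S : Setting Ω) (k₀ : ℝ) (c : ℝ → Ω → ℝ) (t : ℝ) (ω : Ω) :
    kProc S k₀ c t ω = Real.exp (EE S t ω) * (k₀ - ∫ s in (0:ℝ)..t, c s ω * Real.exp (-EE S s ω)) := by
  have e : ∀ s, -((S.B - S.β₁ ^ 2 / 2) * s) - S.β₁ * S.W1 s ω = -EE S s ω := fun s => by unfold EE; ring
  unfold kProc
  simp only [e]
  rfl

lemma hProc_eq (S : Setting Ω) (h₀ : ℝ) (c : ℝ → Ω → ℝ) (t : ℝ) (ω : Ω) :
    hProc S h₀ c t ω = Real.exp (GG S t ω) * (h₀ + S.ρ * ∫ s in (0:ℝ)..t, c s ω * Real.exp (-GG S s ω)) := by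
  have e : ∀ s, (S.ρ + S.β₂ ^ 2 / 2) * s - S.β₂ * S.W2 s ω = -GG S s ω := fun s => by unfold GG; ring
  unfold hProc
  simp only [e]
  rfl

/-- noise size between two times -/
def TTn (S : Setting Ω) (u t : ℝ) (ω : Ω) : ℝ := tt (t - u) (dW S u t ω)

lemma cont_TTn (S : Setting Ω) (u : ℝ) (ω : Ω) : Continuous fun t => TTn S u t ω := by
  have := S.bm1.cont ω; have := S.bm2.cont ω; unfold TTn tt dW; fun_prop

lemma cont_TTn' (S : Setting Ω) (t : ℝ) (ω : Ω) : Continuous fun u => TTn S u t ω := by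
  have := S.bm1.cont ω; have := S.bm2.cont ω; unfold TTn tt dW; fun_prop

lemma TTn_nonneg (S : Setting Ω) {u t : ℝ} (h : u ≤ t) (ω : Ω) : 0 ≤ TTn S u t ω := tt_nonneg (by linarith) _

lemma abs_EE_sub (S : Setting Ω) {u t : ℝ} (h : u ≤ t) (ω : Ω) : |EE S t ω - EE S u ω| ≤ kap S * TTn S u t ω := by
  have e : EE S t ω - EE S u ω = (S.B - S.β₁ ^ 2 / 2) * (t - u) + S.β₁ * (S.W1 t ω - S.W1 u ω) := by unfold EE; ring
  have h0 : 0 ≤ t - u := by linarith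
  have := S.hβ₁; have := S.hβ₂; have := S.hρ₀
  rw [e]
  refine (abs_add_le _ _).trans ?_
  rw [abs_mul, abs_mul, abs_of_nonneg h0, abs_of_pos S.hβ₁]
  unfold TTn tt dW kap
  simp only
  have a1 := abs_nonneg (S.W1 t ω - S.W1 u ω)
  have a2 := abs_nonneg (S.W2 t ω - S.W2 u ω)
  have a3 := abs_nonneg (S.B - S.β₁ ^ 2 / 2)
  have : |S.B - S.β₁ ^ 2 / 2| * (t - u) ≤ |S.B - S.β₁ ^ 2 / 2| * (t - u + |S.W1 t ω - S.W1 u ω| + |S.W2 t ω - S.W2 u ω|) := by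
    gcongr; linarith
  have : S.β₁ * |S.W1 t ω - S.W1 u ω| ≤ S.β₁ * (t - u + |S.W1 t ω - S.W1 u ω| + |S.W2 t ω - S.W2 u ω|) := by
    gcongr; linarith
  have : 0 ≤ ((S.ρ + S.β₂ ^ 2 / 2) + S.β₂) * (t - u + |S.W1 t ω - S.W1 u ω| + |S.W2 t ω - S.W2 u ω|) := by positivity
  nlinarith

lemma abs_GG_sub (S : Setting Ω) {u t : ℝ} (h : u ≤ t) (ω : Ω) : |GG S t ω - GG S u ω| ≤ kap S * TTn S u t ω := by
  have e : GG S t ω - GG S u ω = -((S.ρ + S.β₂ ^ 2 / 2) * (t - u)) + S.β₂ * (S.W2 t ω - S.W2 u ω) := by unfold GG; ring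
  have h0 : 0 ≤ t - u := by linarith
  have := S.hβ₁; have := S.hβ₂; have := S.hρ₀
  have a0 : 0 ≤ S.ρ + S.β₂ ^ 2 / 2 := by positivity
  rw [e]
  refine (abs_add_le _ _).trans ?_
  rw [abs_neg, abs_mul, abs_mul, abs_of_nonneg h0, abs_of_pos S.hβ₂, abs_of_nonneg a0]
  unfold TTn tt dW kap
  simp only
  have a1 := abs_nonneg (S.W1 t ω - S.W1 u ω)
  have a2 := abs_nonneg (S.W2 t ω - S.W2 u ω)
  have a3 := abs_nonneg (S.B - S.β₁ ^ 2 / 2)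
  have : (S.ρ + S.β₂ ^ 2 / 2) * (t - u) ≤ (S.ρ + S.β₂ ^ 2 / 2) * (t - u + |S.W1 t ω - S.W1 u ω| + |S.W2 t ω - S.W2 u ω|) := by
    gcongr; linarith
  have : S.β₂ * |S.W2 t ω - S.W2 u ω| ≤ S.β₂ * (t - u + |S.W1 t ω - S.W1 u ω| + |S.W2 t ω - S.W2 u ω|) := by
    gcongr; linarith
  have : 0 ≤ (|S.B - S.β₁ ^ 2 / 2| + S.β₁) * (t - u + |S.W1 t ω - S.W1 u ω| + |S.W2 t ω - S.W2 u ω|) := by positivity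
  nlinarith

/-- time grids -/
structure Grid (tg : ℕ → ℝ) : Prop where
  zero : tg 0 = 0
  pos : ∀ j, 0 < tg (j + 1) - tg j
  le : ∀ j, tg (j + 1) - tg j ≤ 1
  top : Filter.Tendsto tg Filter.atTop Filter.atTop

lemma Grid.mono {tg : ℕ → ℝ} (g : Grid tg) : StrictMono tg := strictMono_nat_of_lt_succ fun j => by
  have := g.pos j; linarith
lemma Grid.nonneg {tg : ℕ → ℝ} (g : Grid tg) (j : ℕ) : 0 ≤ tg j := g.zero ▸ g.mono.monotone (Nat.zero_le j)

lemma Grid.exists_lt {tg : ℕ → ℝ} (g : Grid tg) (t : ℝ) (ht : 0 < t) : ∃ j, t ∈ Set.Ioc (tg j) (tg (j + 1)) := by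
  classical
  have h : ∃ j, t ≤ tg j := (g.top.eventually_ge_atTop t).exists
  have h1 := Nat.find_spec h
  rcases Nat.eq_zero_or_pos (Nat.find h) with h0 | h0
  · rw [h0, g.zero] at h1; linarith
  · obtain ⟨m, hm⟩ := Nat.exists_eq_succ_of_ne_zero h0.ne'
    refine ⟨m, ?_, by rw [hm] at h1; exact h1⟩
    exact not_le.mp (Nat.find_min h (m := m) (by omega))

lemma Grid.uniq {tg : ℕ → ℝ} (g : Grid tg) {t : ℝ} {i j : ℕ} (hi : t ∈ Set.Ioc (tg i) (tg (i + 1)))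
    (hj : t ∈ Set.Ioc (tg j) (tg (j + 1))) : i = j := by
  by_contra hne
  rcases lt_or_gt_of_ne hne with h | h
  · have := g.mono.monotone (Nat.succ_le_of_lt h); have := hi.2; have := hj.1; simp only [Nat.succ_eq_add_one] at *; linarith
  · have := g.mono.monotone (Nat.succ_le_of_lt h); have := hj.2; have := hi.1; simp only [Nat.succ_eq_add_one] at *; linarith

/-- the controlled chain -/
def Zs (S : Setting Ω) (tg : ℕ → ℝ) (pol : ℕ → ℝ × ℝ → Ω → ℝ) (z : ℝ × ℝ) : ℕ → Ω → ℝ × ℝ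
  | 0 => fun _ => z
  | j + 1 => fun ω => nxt S (tg (j + 1) - tg j) (pol j (Zs S tg pol z j ω) ω) (Zs S tg pol z j ω) (dW S (tg j) (tg (j + 1)) ω)

def Qs (S : Setting Ω) (tg : ℕ → ℝ) (pol : ℕ → ℝ × ℝ → Ω → ℝ) (z : ℝ × ℝ) (j : ℕ) (ω : Ω) : ℝ :=
  pol j (Zs S tg pol z j ω) ω

/-- admissible policies for the chain -/
structure Pol (S : Setting Ω) (tg : ℕ → ℝ) (pol : ℕ → ℝ × ℝ → Ω → ℝ) : Prop where
  meas : ∀ j, Measurable[MeasurableSpace.prod inferInstance (S.F (tg j))] (fun p : (ℝ × ℝ) × Ω => pol j p.1 p.2)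
  feas : ∀ j z ω, feas S (tg (j + 1) - tg j) (pol j z ω)

lemma measurable_dW' (S : Setting Ω) {u t : ℝ} (h : u ≤ t) : Measurable[S.F t] (dW S u t) := by
  have a1 : Measurable[S.F t] (S.W1 t) := S.bm1.adapted t
  have a2 : Measurable[S.F t] (S.W2 t) := S.bm2.adapted t
  have a3 : Measurable[S.F t] (S.W1 u) := (S.bm1.adapted u).mono (S.F.mono h) le_rfl
  have a4 : Measurable[S.F t] (S.W2 u) := (S.bm2.adapted u).mono (S.F.mono h) le_rfl
  exact (a1.sub a3).prodMk (a2.sub a4)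

variable {S : Setting Ω} {tg : ℕ → ℝ} {pol : ℕ → ℝ × ℝ → Ω → ℝ}

lemma QZ_meas_aux (hp : Pol S tg pol) {z : ℝ × ℝ} {j : ℕ} (h : Measurable[S.F (tg j)] (Zs S tg pol z j)) :
    Measurable[S.F (tg j)] (Qs S tg pol z j) := by
  exact (hp.meas j).comp (h.prodMk (@measurable_id Ω (S.F (tg j))))

lemma Z_meas (g : Grid tg) (hp : Pol S tg pol) (z : ℝ × ℝ) (j : ℕ) : Measurable[S.F (tg j)] (Zs S tg pol z j) := by
  induction j with
  | zero => exact measurable_const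
  | succ j ih =>
    have hle : tg j ≤ tg (j + 1) := g.mono.monotone (Nat.le_succ j)
    have h1 := (QZ_meas_aux hp ih).mono (S.F.mono hle) le_rfl
    have h2 := ih.mono (S.F.mono hle) le_rfl
    have h3 := measurable_dW' S hle
    exact (measurable_nxt S (tg (j + 1) - tg j)).comp (h1.prodMk (h2.prodMk h3))

lemma Q_meas (g : Grid tg) (hp : Pol S tg pol) (z : ℝ × ℝ) (j : ℕ) : Measurable[S.F (tg j)] (Qs S tg pol z j) :=
  QZ_meas_aux hp (Z_meas g hp z j)

lemma Z_pos (g : Grid tg) (hp : Pol S tg pol) {z : ℝ × ℝ} (h1 : 0 < z.1) (h2 : 0 < z.2) (j : ℕ) (ω : Ω) :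
    0 < (Zs S tg pol z j ω).1 ∧ 0 < (Zs S tg pol z j ω).2 := by
  induction j with
  | zero => exact ⟨h1, h2⟩
  | succ j ih => exact nxt_pos S (g.pos j).le (hp.feas j _ ω) ih.1 ih.2 _

lemma Z_step (g : Grid tg) (hp : Pol S tg pol) (z : ℝ × ℝ) (j : ℕ) {v : ℝ × ℝ → ℝ≥0∞} (hv : Measurable v) :
    ∫⁻ ω, v (Zs S tg pol z (j + 1) ω) ∂S.P = ∫⁻ ω, ∫⁻ y, v (nxt S (tg (j + 1) - tg j) (Qs S tg pol z j ω)
      (Zs S tg pol z j ω) y) ∂(nu (tg (j + 1) - tg j)) ∂S.P := by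
  have hle : tg j ≤ tg (j + 1) := g.mono.monotone (Nat.le_succ j)
  have hm : Measurable (fun p : (ℝ × (ℝ × ℝ)) × (ℝ × ℝ) => (p.1.1, p.1.2, p.2)) := by fun_prop
  exact one_step S (g.nonneg j) hle (fun ω => (Qs S tg pol z j ω, Zs S tg pol z j ω))
    ((Q_meas g hp z j).prodMk (Z_meas g hp z j))
    (fun p => v (nxt S (tg (j + 1) - tg j) p.1.1 p.1.2 p.2))
    (hv.comp ((measurable_nxt S _).comp hm))

lemma TT_step (g : Grid tg) (hp : Pol S tg pol) (z : ℝ × ℝ) (j : ℕ) {v : ℝ × ℝ → ℝ≥0∞} (hv : Measurable v) :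
    ∫⁻ ω, ENNReal.ofReal (Lc S (tg (j + 1) - tg j) (Qs S tg pol z j ω) (Zs S tg pol z j ω)) ∂S.P +
     ENNReal.ofReal (Real.exp (-S.θ * (tg (j + 1) - tg j))) * ∫⁻ ω, v (Zs S tg pol z (j + 1) ω) ∂S.P
    = ∫⁻ ω, TT S (tg (j + 1) - tg j) (Qs S tg pol z j ω) v (Zs S tg pol z j ω) ∂S.P := by
  rw [Z_step g hp z j hv, ← lintegral_const_mul' _ _ ENNReal.ofReal_ne_top, ← lintegral_add_left]
  · rfl
  · exact ((measurable_Lc S _).comp (((Q_meas g hp z j).mono (S.F.le _) le_rfl).prodMk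
      ((Z_meas g hp z j).mono (S.F.le _) le_rfl))).ennreal_ofReal
end

section
variable {S : Setting Ω} {tg : ℕ → ℝ} {pol : ℕ → ℝ × ℝ → Ω → ℝ}

def gj (S : Setting Ω) (tg : ℕ → ℝ) (pol : ℕ → ℝ × ℝ → Ω → ℝ) (z : ℝ × ℝ) (j : ℕ) (t : ℝ) (ω : Ω) : ℝ :=
  Qs S tg pol z j ω * (Zs S tg pol z j ω).1 * Real.exp (-(kap S * TTn S (tg j) t ω))

def ctl (S : Setting Ω) (tg : ℕ → ℝ) (pol : ℕ → ℝ × ℝ → Ω → ℝ) (z : ℝ × ℝ) (t : ℝ) (ω : Ω) : ℝ :=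
  ∑' j, (Set.Ioc (tg j) (tg (j + 1))).indicator (fun t => gj S tg pol z j t ω) t

lemma ctl_eq (g : Grid tg) (z : ℝ × ℝ) {j : ℕ} {t : ℝ} (ht : t ∈ Set.Ioc (tg j) (tg (j + 1))) (ω : Ω) :
    ctl S tg pol z t ω = gj S tg pol z j t ω := by
  unfold ctl
  rw [tsum_eq_single j, Set.indicator_of_mem ht]
  intro i hi
  exact Set.indicator_of_notMem (fun h => hi (g.uniq h ht)) _

lemma prog_gj (g : Grid tg) (hp : Pol S tg pol) (z : ℝ × ℝ) (j : ℕ) :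
    IsStronglyProgressive S.F (fun t ω => (Set.Ioc (tg j) (tg (j + 1))).indicator (fun t => gj S tg pol z j t ω) t) := by
  intro i
  have w1 := StronglyAdapted.isStronglyProgressive_of_continuous (f := S.F) (u := S.W1) (fun t => (S.bm1.adapted t).stronglyMeasurable) S.bm1.cont i
  have w2 := StronglyAdapted.isStronglyProgressive_of_continuous (f := S.F) (u := S.W2) (fun t => (S.bm2.adapted t).stronglyMeasurable) S.bm2.cont i
  letI m : MeasurableSpace (Set.Iic i × Ω) := Subtype.instMeasurableSpace.prod (S.F i)
  by_cases hij : tg j ≤ i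
  · have q := (Q_meas g hp z j).mono (S.F.mono hij) le_rfl
    have k := ((measurable_fst.comp (Z_meas g hp z j)) : Measurable[S.F (tg j)] fun ω => (Zs S tg pol z j ω).1).mono (S.F.mono hij) le_rfl
    have v1 := (S.bm1.adapted (tg j)).mono (S.F.mono hij) le_rfl
    have v2 := (S.bm2.adapted (tg j)).mono (S.F.mono hij) le_rfl
    have sn : @Measurable (Set.Iic i × Ω) Ω m (S.F i) Prod.snd := @measurable_snd _ _ _ (S.F i)
    have fs : @Measurable (Set.Iic i × Ω) (Set.Iic i) m _ Prod.fst := @measurable_fst _ _ _ (S.F i)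
    have fs' : Measurable[m] (fun p : Set.Iic i × Ω => (p.1 : ℝ)) := measurable_subtype_coe.comp fs
    have q' := q.comp sn
    have k' := k.comp sn
    have v1' := v1.comp sn
    have v2' := v2.comp sn
    have w1' := w1.measurable
    have w2' := w2.measurable
    refine Measurable.stronglyMeasurable ?_
    have : Measurable[m] (fun p : Set.Iic i × Ω => gj S tg pol z j p.1 p.2) := by
      unfold gj TTn tt dW
      refine (q'.mul k').mul (Real.measurable_exp.comp (Measurable.neg (Measurable.const_mul ?_ _)))
      refine ((fs'.sub measurable_const).add ?_).add ?_
      · exact measurable_norm.comp (w1'.sub v1')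
      · exact measurable_norm.comp (w2'.sub v2')
    exact this.indicator (fs' measurableSet_Ioc)
  · have : (fun p : Set.Iic i × Ω => (Set.Ioc (tg j) (tg (j + 1))).indicator (fun t => gj S tg pol z j t p.2) (p.1 : ℝ)) = fun _ => 0 := by
      funext p
      refine Set.indicator_of_notMem (fun h => ?_) _
      have := p.1.2
      simp only [Set.mem_Iic] at this
      linarith [h.1]
    rw [this]
    exact stronglyMeasurable_const

lemma prog_ctl (g : Grid tg) (hp : Pol S tg pol) (z : ℝ × ℝ) : IsStronglyProgressive S.F (ctl S tg pol z) := by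
  refine isStronglyProgressive_of_tendsto (U := fun n t ω => ∑ j ∈ Finset.range n, (Set.Ioc (tg j) (tg (j + 1))).indicator (fun t => gj S tg pol z j t ω) t)
    (fun n => IsStronglyProgressive.finsetSum (fun j _ => prog_gj g hp z j)) ?_
  rw [tendsto_pi_nhds]
  intro t
  rw [tendsto_pi_nhds]
  intro ω
  have hs : Summable (fun j => (Set.Ioc (tg j) (tg (j + 1))).indicator (fun t => gj S tg pol z j t ω) t) := by
    by_cases h : ∃ j, t ∈ Set.Ioc (tg j) (tg (j + 1))
    · obtain ⟨j, hj⟩ := h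
      refine summable_of_ne_finset_zero (s := {j}) fun i hi => ?_
      exact Set.indicator_of_notMem (fun h => hi (by simp [g.uniq h hj])) _
    · push Not at h
      refine summable_of_ne_finset_zero (s := ∅) fun i hi => ?_
      exact Set.indicator_of_notMem (h i) _
  exact hs.hasSum.tendsto_sum_nat

lemma gj_cont (z : ℝ × ℝ) (j : ℕ) (ω : Ω) : Continuous (fun t => gj S tg pol z j t ω) := by
  have := cont_TTn S (tg j) ω
  unfold gj; fun_prop

lemma ctl_int_block (g : Grid tg) (z : ℝ × ℝ) (j : ℕ) (ω : Ω) (f : ℝ → ℝ) (hf : Continuous f) {t : ℝ}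
    (ht : t ∈ Set.Icc (tg j) (tg (j + 1))) :
    IntervalIntegrable (fun s => ctl S tg pol z s ω * f s) volume (tg j) t ∧
    ∫ s in (tg j)..t, ctl S tg pol z s ω * f s = ∫ s in (tg j)..t, gj S tg pol z j s ω * f s := by
  have e : Set.EqOn (fun s => gj S tg pol z j s ω * f s) (fun s => ctl S tg pol z s ω * f s) (Set.uIoc (tg j) t) := by
    intro s hs
    rw [Set.uIoc_of_le ht.1] at hs
    simp only
    rw [ctl_eq g z ⟨hs.1, hs.2.trans ht.2⟩]
  constructor
  · refine (intervalIntegrable_congr e).mp ?_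
    exact ((gj_cont z j ω).mul hf).intervalIntegrable _ _
  · rw [intervalIntegral.integral_of_le ht.1, intervalIntegral.integral_of_le ht.1]
    refine setIntegral_congr_fun measurableSet_Ioc fun s hs => ?_
    exact (e (by rwa [Set.uIoc_of_le ht.1])).symm

lemma ctl_int (g : Grid tg) (z : ℝ × ℝ) (ω : Ω) (f : ℝ → ℝ) (hf : Continuous f) (j : ℕ) {t : ℝ}
    (ht : t ∈ Set.Icc (tg j) (tg (j + 1))) :
    IntervalIntegrable (fun s => ctl S tg pol z s ω * f s) volume 0 t := by
  have h1 : IntervalIntegrable (fun s => ctl S tg pol z s ω * f s) volume (tg 0) (tg j) :=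
    IntervalIntegrable.trans_iterate fun k _ => (ctl_int_block g z k ω f hf ⟨g.mono.monotone (Nat.le_succ k), le_rfl⟩).1
  rw [g.zero] at h1
  exact h1.trans (ctl_int_block g z j ω f hf ht).1

lemma gj_pos (g : Grid tg) (hp : Pol S tg pol) {z : ℝ × ℝ} (h1 : 0 < z.1) (h2 : 0 < z.2) (j : ℕ) (t : ℝ) (ω : Ω) :
    0 < gj S tg pol z j t ω := by
  have := (Z_pos g hp h1 h2 j ω).1
  have := (hp.feas j (Zs S tg pol z j ω) ω).1
  unfold gj Qs; positivity

lemma block_k (g : Grid tg) (hp : Pol S tg pol) {z : ℝ × ℝ} (h1 : 0 < z.1) (h2 : 0 < z.2) (j : ℕ) (ω : Ω)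
    (ih : (Zs S tg pol z j ω).1 ≤ kProc S z.1 (ctl S tg pol z) (tg j) ω) {t : ℝ} (ht : t ∈ Set.Icc (tg j) (tg (j + 1))) :
    Real.exp (EE S t ω - EE S (tg j) ω) * ((Zs S tg pol z j ω).1 - Qs S tg pol z j ω * (Zs S tg pol z j ω).1 * (t - tg j))
      ≤ kProc S z.1 (ctl S tg pol z) t ω := by
  have hk := (Z_pos g hp h1 h2 j ω).1
  have hq : 0 < Qs S tg pol z j ω := (hp.feas j (Zs S tg pol z j ω) ω).1
  set w := Qs S tg pol z j ω * (Zs S tg pol z j ω).1 with hw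
  have hw0 : 0 < w := by positivity
  have hc : Continuous fun s => Real.exp (-EE S s ω) := by have := cont_EE S ω; fun_prop
  have i1 := ctl_int (S := S) (pol := pol) g z ω _ hc j (t := tg j) ⟨le_rfl, g.mono.monotone (Nat.le_succ j)⟩
  have i2 := ctl_int_block (S := S) (pol := pol) g z j ω _ hc ht
  rw [kProc_eq] at ih ⊢
  have hsum := intervalIntegral.integral_add_adjacent_intervals i1 i2.1
  rw [i2.2] at hsum
  have bd : ∫ s in (tg j)..t, gj S tg pol z j s ω * Real.exp (-EE S s ω) ≤ w * Real.exp (-EE S (tg j) ω) * (t - tg j) := by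
    have : ∫ s in (tg j)..t, w * Real.exp (-EE S (tg j) ω) = w * Real.exp (-EE S (tg j) ω) * (t - tg j) := by
      rw [intervalIntegral.integral_const, smul_eq_mul]; ring
    rw [← this]
    refine intervalIntegral.integral_mono_on ht.1 (((gj_cont z j ω).mul hc).intervalIntegrable _ _) (by simp) fun s hs => ?_
    unfold gj
    rw [← hw, mul_assoc, ← Real.exp_add]
    gcongr
    have := abs_le.mp (abs_EE_sub S hs.1 ω)
    linarith
  set I0 := ∫ s in (0:ℝ)..(tg j), ctl S tg pol z s ω * Real.exp (-EE S s ω)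
  rw [← hsum]
  have e1 : Real.exp (-EE S (tg j) ω) * (Zs S tg pol z j ω).1 ≤ z.1 - I0 := by
    rw [Real.exp_neg, inv_mul_le_iff₀ (Real.exp_pos _)]; exact ih
  rw [sub_eq_add_neg (EE S t ω), Real.exp_add, mul_assoc]
  refine mul_le_mul_of_nonneg_left ?_ (Real.exp_pos _).le
  nlinarith

lemma block_h (g : Grid tg) (hp : Pol S tg pol) {z : ℝ × ℝ} (h1 : 0 < z.1) (h2 : 0 < z.2) (j : ℕ) (ω : Ω)
    (ih : hProc S z.2 (ctl S tg pol z) (tg j) ω ≤ (Zs S tg pol z j ω).2) {t : ℝ} (ht : t ∈ Set.Icc (tg j) (tg (j + 1))) :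
    hProc S z.2 (ctl S tg pol z) t ω ≤
    Real.exp (GG S t ω - GG S (tg j) ω) * ((Zs S tg pol z j ω).2 + S.ρ * (Qs S tg pol z j ω * (Zs S tg pol z j ω).1) * (t - tg j)) := by
  have hk := (Z_pos g hp h1 h2 j ω).1
  have hρ := S.hρ₀
  have hq : 0 < Qs S tg pol z j ω := (hp.feas j (Zs S tg pol z j ω) ω).1
  set w := Qs S tg pol z j ω * (Zs S tg pol z j ω).1 with hw
  have hw0 : 0 < w := by positivity
  have hc : Continuous fun s => Real.exp (-GG S s ω) := by have := cont_GG S ω; fun_prop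
  have i1 := ctl_int (S := S) (pol := pol) g z ω _ hc j (t := tg j) ⟨le_rfl, g.mono.monotone (Nat.le_succ j)⟩
  have i2 := ctl_int_block (S := S) (pol := pol) g z j ω _ hc ht
  rw [hProc_eq] at ih ⊢
  have hsum := intervalIntegral.integral_add_adjacent_intervals i1 i2.1
  rw [i2.2] at hsum
  have bd : ∫ s in (tg j)..t, gj S tg pol z j s ω * Real.exp (-GG S s ω) ≤ w * Real.exp (-GG S (tg j) ω) * (t - tg j) := by
    have : ∫ s in (tg j)..t, w * Real.exp (-GG S (tg j) ω) = w * Real.exp (-GG S (tg j) ω) * (t - tg j) := by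
      rw [intervalIntegral.integral_const, smul_eq_mul]; ring
    rw [← this]
    refine intervalIntegral.integral_mono_on ht.1 (((gj_cont z j ω).mul hc).intervalIntegrable _ _) (by simp) fun s hs => ?_
    unfold gj
    rw [← hw, mul_assoc, ← Real.exp_add]
    gcongr
    have := abs_le.mp (abs_GG_sub S hs.1 ω)
    linarith
  set I0 := ∫ s in (0:ℝ)..(tg j), ctl S tg pol z s ω * Real.exp (-GG S s ω)
  rw [← hsum]
  have e1 : z.2 + S.ρ * I0 ≤ Real.exp (-GG S (tg j) ω) * (Zs S tg pol z j ω).2 := by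
    rw [Real.exp_neg, le_inv_mul_iff₀ (Real.exp_pos _)]; exact ih
  rw [sub_eq_add_neg (GG S t ω), Real.exp_add, mul_assoc]
  refine mul_le_mul_of_nonneg_left ?_ (Real.exp_pos _).le
  have := mul_le_mul_of_nonneg_left bd hρ.le
  nlinarith

lemma grid_kh (g : Grid tg) (hp : Pol S tg pol) {z : ℝ × ℝ} (h1 : 0 < z.1) (h2 : 0 < z.2) (ω : Ω) (j : ℕ) :
    (Zs S tg pol z j ω).1 ≤ kProc S z.1 (ctl S tg pol z) (tg j) ω ∧
    hProc S z.2 (ctl S tg pol z) (tg j) ω ≤ (Zs S tg pol z j ω).2 := by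
  induction j with
  | zero => simp [Zs, kProc_eq, hProc_eq, g.zero, EE_zero, GG_zero]
  | succ j ih =>
    have hr : tg (j + 1) ∈ Set.Icc (tg j) (tg (j + 1)) := ⟨g.mono.monotone (Nat.le_succ j), le_rfl⟩
    have a := block_k g hp h1 h2 j ω ih.1 hr
    have b := block_h g hp h1 h2 j ω ih.2 hr
    constructor
    · refine le_trans (le_of_eq ?_) a
      simp only [Zs, nxt, Qs, dW, EE]
      congr 2; ring
    · refine b.trans (le_of_eq ?_)
      simp only [Zs, nxt, Qs, dW, GG]
      congr 2; ring
end

section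
variable {S : Setting Ω} {tg : ℕ → ℝ} {pol : ℕ → ℝ × ℝ → Ω → ℝ}

lemma ctl_pos (g : Grid tg) (hp : Pol S tg pol) {z : ℝ × ℝ} (h1 : 0 < z.1) (h2 : 0 < z.2) {t : ℝ} (ht : 0 < t) (ω : Ω) :
    0 < ctl S tg pol z t ω := by
  obtain ⟨j, hj⟩ := g.exists_lt t ht
  rw [ctl_eq g z hj]; exact gj_pos g hp h1 h2 j t ω

lemma Grid.exists_Icc (g : Grid tg) {t : ℝ} (ht : 0 ≤ t) : ∃ j, t ∈ Set.Icc (tg j) (tg (j + 1)) := by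
  rcases ht.eq_or_lt with rfl | ht
  · exact ⟨0, by rw [g.zero], by have := g.pos 0; rw [g.zero] at this; linarith⟩
  · obtain ⟨j, hj⟩ := g.exists_lt t ht
    exact ⟨j, hj.1.le, hj.2⟩

lemma hProc_pos_of_nonneg (S : Setting Ω) {h₀ : ℝ} (h2 : 0 < h₀) {c : ℝ → Ω → ℝ} {ω : Ω} {t : ℝ} (ht : 0 ≤ t)
    (hc : ∀ᵐ s ∂(volume.restrict (Set.Ici (0:ℝ))), 0 < c s ω) :
    h₀ * Real.exp (GG S t ω) ≤ hProc S h₀ c t ω := by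
  rw [hProc_eq, mul_comm]
  have : 0 ≤ ∫ s in (0:ℝ)..t, c s ω * Real.exp (-GG S s ω) := by
    refine intervalIntegral.integral_nonneg_of_ae_restrict ht ?_
    have := ae_restrict_of_ae_restrict_of_subset (Set.Icc_subset_Ici_self : Set.Icc 0 t ⊆ Set.Ici 0) hc
    filter_upwards [this] with s hs
    positivity
  have := mul_nonneg S.hρ₀.le this
  gcongr; linarith

lemma ctl_adm (g : Grid tg) (hp : Pol S tg pol) {z : ℝ × ℝ} (h1 : 0 < z.1) (h2 : 0 < z.2) :
    IsAdmissible S z.1 z.2 (ctl S tg pol z) := by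
  have hae : ∀ {p : ℝ → Prop}, (∀ t, 0 < t → p t) → ∀ᵐ t ∂(volume.restrict (Set.Ici (0:ℝ))), p t := by
    intro p hp
    rw [← Measure.restrict_congr_set (Ioi_ae_eq_Ici (a := (0:ℝ)))]
    exact (ae_restrict_iff' measurableSet_Ioi).mpr (Filter.Eventually.of_forall hp)
  have hR := S.hR
  refine ⟨prog_ctl g hp z, ?_, ?_, ?_, ?_, ?_⟩
  · refine Filter.Eventually.of_forall fun ω t ht => ?_
    obtain ⟨j, hj⟩ := g.exists_Icc ht
    simpa using ctl_int (S := S) (pol := pol) g z ω (fun _ => 1) continuous_const j hj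
  · exact Filter.Eventually.of_forall fun ω => hae fun t ht => ctl_pos g hp h1 h2 ht ω
  · refine Filter.Eventually.of_forall fun ω t ht => ?_
    obtain ⟨j, hj⟩ := g.exists_Icc ht
    refine lt_of_lt_of_le ?_ (block_k g hp h1 h2 j ω (grid_kh g hp h1 h2 ω j).1 hj)
    have hk := (Z_pos g hp h1 h2 j ω).1
    have hf := hp.feas j (Zs S tg pol z j ω) ω
    have := hf.mul_lt (g.pos j).le
    have h0 := hf.1
    refine mul_pos (Real.exp_pos _) ?_
    unfold Qs
    have : pol j (Zs S tg pol z j ω) ω * (t - tg j) ≤ pol j (Zs S tg pol z j ω) ω * (tg (j + 1) - tg j) := by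
      have := hj.2
      gcongr
    nlinarith
  · refine Filter.Eventually.of_forall fun ω t ht => ?_
    refine lt_of_lt_of_le ?_ (hProc_pos_of_nonneg S h2 ht (hae fun t ht => ctl_pos g hp h1 h2 ht ω))
    positivity
  · refine Filter.Eventually.of_forall fun ω => hae fun t ht => ?_
    obtain ⟨j, hj⟩ := g.exists_lt t ht
    have hj' : t ∈ Set.Icc (tg j) (tg (j + 1)) := ⟨hj.1.le, hj.2⟩
    refine le_trans ?_ (mul_le_mul_of_nonneg_left (block_k g hp h1 h2 j ω (grid_kh g hp h1 h2 ω j).1 hj') hR.le)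
    rw [ctl_eq g z hj]
    have hk := (Z_pos g hp h1 h2 j ω).1
    have hf := hp.feas j (Zs S tg pol z j ω) ω
    change feas S _ (Qs S tg pol z j ω) at hf
    have h0 := hf.1
    have h3 := hf.2
    unfold gj
    set q := Qs S tg pol z j ω
    set k := (Zs S tg pol z j ω).1
    have e1 : Real.exp (-(kap S * TTn S (tg j) t ω)) ≤ Real.exp (EE S t ω - EE S (tg j) ω) :=
      Real.exp_le_exp.mpr (abs_le.mp (abs_EE_sub S hj'.1 ω)).1
    have e2 : q * k ≤ S.R * (k - q * k * (t - tg j)) := by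
      have : q * (t - tg j) ≤ q * (tg (j + 1) - tg j) := by have := hj.2; gcongr
      have : q ≤ S.R * (1 - q * (t - tg j)) := by nlinarith
      nlinarith
    calc _ ≤ S.R * (k - q * k * (t - tg j)) * Real.exp (EE S t ω - EE S (tg j) ω) := by
          gcongr
          exact le_trans (by positivity) e2
      _ = _ := by ring

lemma measurable_TTn_joint (S : Setting Ω) (u : ℝ) : Measurable (fun p : ℝ × Ω => TTn S u p.1 p.2) := by
  have m1 := measurable_uncurry_of_continuous_of_measurable (u := S.W1) S.bm1.cont (measurable_W1 S)
  have m2 := measurable_uncurry_of_continuous_of_measurable (u := S.W2) S.bm2.cont (measurable_W2 S)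
  have v1 := (measurable_W1 S u).comp (measurable_snd : Measurable (Prod.snd : ℝ × Ω → Ω))
  have v2 := (measurable_W2 S u).comp (measurable_snd : Measurable (Prod.snd : ℝ × Ω → Ω))
  unfold TTn tt dW
  exact ((measurable_fst.sub_const u).add (measurable_norm.comp (m1.sub v1))).add (measurable_norm.comp (m2.sub v2))

lemma cost_block (g : Grid tg) (hp : Pol S tg pol) {z : ℝ × ℝ} (h1 : 0 < z.1) (h2 : 0 < z.2) (j : ℕ) :
    ∃ Y : Ω → ℝ≥0∞, Measurable Y ∧ (∀ ω, (∫⁻ t in Set.Ioc (tg j) (tg (j + 1)), ENNReal.ofReal ((S.σ - 1)⁻¹ *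
      ((hProc S z.2 (ctl S tg pol z) t ω) ^ S.γ / ctl S tg pol z t ω) ^ (S.σ - 1) * Real.exp (-S.θ * t))) ≤ Y ω) ∧
    ∫⁻ ω, Y ω ∂S.P ≤ ENNReal.ofReal (Real.exp (-S.θ * tg j)) *
      ∫⁻ ω, ENNReal.ofReal (Lc S (tg (j + 1) - tg j) (Qs S tg pol z j ω) (Zs S tg pol z j ω)) ∂S.P := by
  haveI := S.isProb
  have hs := sg_pos S
  have hb := bb_nonneg S
  have hρ := S.hρ₀
  set d := tg (j + 1) - tg j with hd
  have hd0 : 0 < d := g.pos j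
  set X : Ω → ℝ := fun ω => (sg S)⁻¹ * ((Zs S tg pol z j ω).2 + S.ρ * (Qs S tg pol z j ω * (Zs S tg pol z j ω).1) * d) ^ (bb S)
    * (Qs S tg pol z j ω * (Zs S tg pol z j ω).1) ^ (-sg S) with hX
  have hXm : Measurable[S.F (tg j)] X := by
    have a := Q_meas g hp z j
    have b := Z_meas g hp z j
    have : Measurable (fun p : ℝ × (ℝ × ℝ) => (sg S)⁻¹ * (p.2.2 + S.ρ * (p.1 * p.2.1) * d) ^ (bb S) * (p.1 * p.2.1) ^ (-sg S)) := by
      fun_prop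
    exact this.comp (a.prodMk b)
  have hXm' := hXm.mono (S.F.le _) le_rfl
  have hX0 : ∀ ω, 0 ≤ X ω := by
    intro ω
    have := Z_pos g hp h1 h2 j ω
    have h3 := this.1
    have h4 := this.2
    have hq : 0 < Qs S tg pol z j ω := (hp.feas j (Zs S tg pol z j ω) ω).1
    simp only [hX]; positivity
  have pt : ∀ ω, ∀ t ∈ Set.Ioc (tg j) (tg (j + 1)), ENNReal.ofReal ((S.σ - 1)⁻¹ *
      ((hProc S z.2 (ctl S tg pol z) t ω) ^ S.γ / ctl S tg pol z t ω) ^ (S.σ - 1) * Real.exp (-S.θ * t)) ≤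
      ENNReal.ofReal (Real.exp (-S.θ * tg j)) * (ENNReal.ofReal (X ω) * ENNReal.ofReal (Real.exp (KK S * TTn S (tg j) t ω))) := by
    intro ω t ht
    have ht' : t ∈ Set.Icc (tg j) (tg (j + 1)) := ⟨ht.1.le, ht.2⟩
    have hz := Z_pos g hp h1 h2 j ω
    have h3 := hz.1
    have h4 := hz.2
    have hq : 0 < Qs S tg pol z j ω := (hp.feas j (Zs S tg pol z j ω) ω).1
    rw [← ENNReal.ofReal_mul (hX0 ω), ← ENNReal.ofReal_mul (Real.exp_pos _).le]
    refine ENNReal.ofReal_le_ofReal ?_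
    have hpos : 0 < hProc S z.2 (ctl S tg pol z) t ω := by
      have ht0 : 0 ≤ t := (g.nonneg j).trans ht.1.le
      refine lt_of_lt_of_le (by positivity) (hProc_pos_of_nonneg S h2 ht0 ?_)
      rw [← Measure.restrict_congr_set (Ioi_ae_eq_Ici (a := (0:ℝ)))]
      exact (ae_restrict_iff' measurableSet_Ioi).mpr (Filter.Eventually.of_forall fun t ht => ctl_pos g hp h1 h2 ht ω)
    have hle := block_h g hp h1 h2 j ω (grid_kh g hp h1 h2 ω j).2 ht'
    rw [ctl_eq g z ht]
    have hg := gj_pos g hp h1 h2 j t ω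
    rw [Real.div_rpow (by positivity) hg.le, ← Real.rpow_mul hpos.le, div_eq_mul_inv, ← Real.rpow_neg hg.le]
    change (sg S)⁻¹ * ((hProc S z.2 (ctl S tg pol z) t ω) ^ (bb S) * (gj S tg pol z j t ω) ^ (-sg S)) * _ ≤ _
    have a1 : (hProc S z.2 (ctl S tg pol z) t ω) ^ (bb S) ≤ Real.exp (bb S * (kap S * TTn S (tg j) t ω)) *
        ((Zs S tg pol z j ω).2 + S.ρ * (Qs S tg pol z j ω * (Zs S tg pol z j ω).1) * d) ^ (bb S) := by
      rw [mul_comm (bb S), Real.exp_mul, ← Real.mul_rpow (Real.exp_pos _).le (by positivity)]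
      refine Real.rpow_le_rpow hpos.le (hle.trans ?_) hb
      have := (abs_le.mp (abs_GG_sub S ht'.1 ω)).2
      have : t - tg j ≤ d := by rw [hd]; linarith [ht.2]
      have : 0 ≤ t - tg j := by linarith [ht.1]
      gcongr
    have a2 : (gj S tg pol z j t ω) ^ (-sg S) = Real.exp (sg S * (kap S * TTn S (tg j) t ω)) * (Qs S tg pol z j ω * (Zs S tg pol z j ω).1) ^ (-sg S) := by
      unfold gj
      rw [Real.mul_rpow (by positivity) (Real.exp_pos _).le, ← Real.exp_mul, mul_comm]
      congr 2; ring
    have a3 : Real.exp (-S.θ * t) ≤ Real.exp (-S.θ * tg j) := by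
      have := S.hθ
      refine Real.exp_le_exp.mpr ?_
      nlinarith [ht.1]
    have a4 : Real.exp (KK S * TTn S (tg j) t ω) = Real.exp (bb S * (kap S * TTn S (tg j) t ω)) * Real.exp (sg S * (kap S * TTn S (tg j) t ω)) := by
      rw [← Real.exp_add]; congr 1; unfold KK; ring
    rw [a2, a4]
    set w := Qs S tg pol z j ω * (Zs S tg pol z j ω).1
    have hw : 0 < w := by positivity
    calc _ ≤ (sg S)⁻¹ * ((Real.exp (bb S * (kap S * TTn S (tg j) t ω)) *
        ((Zs S tg pol z j ω).2 + S.ρ * w * d) ^ (bb S)) * (Real.exp (sg S * (kap S * TTn S (tg j) t ω)) * w ^ (-sg S))) * Real.exp (-S.θ * tg j) := by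
          gcongr
      _ = _ := by simp only [hX]; ring
  have m1 : Measurable (fun p : Ω × ℝ => TTn S (tg j) p.2 p.1) := (measurable_TTn_joint S (tg j)).comp measurable_swap
  have m2 : Measurable (fun p : Ω × ℝ => ENNReal.ofReal (X p.1) * ENNReal.ofReal (Real.exp (KK S * TTn S (tg j) p.2 p.1))) :=
    (hXm'.comp measurable_fst).ennreal_ofReal.mul ((Real.measurable_exp.comp (m1.const_mul _)).ennreal_ofReal)
  refine ⟨fun ω => ∫⁻ t in Set.Ioc (tg j) (tg (j + 1)), ENNReal.ofReal (Real.exp (-S.θ * tg j)) *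
        (ENNReal.ofReal (X ω) * ENNReal.ofReal (Real.exp (KK S * TTn S (tg j) t ω))), ?_,
        fun ω => setLIntegral_mono' measurableSet_Ioc (pt ω), ?_⟩
  · exact Measurable.lintegral_prod_right' (m2.const_mul _)
  calc _ = ENNReal.ofReal (Real.exp (-S.θ * tg j)) * ∫⁻ t in Set.Ioc (tg j) (tg (j + 1)), ∫⁻ ω, 
        (ENNReal.ofReal (X ω) * ENNReal.ofReal (Real.exp (KK S * TTn S (tg j) t ω))) ∂S.P := by
        rw [← lintegral_lintegral_swap (f := fun ω t => ENNReal.ofReal (X ω) * ENNReal.ofReal (Real.exp (KK S * TTn S (tg j) t ω)))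
          m2.aemeasurable, ← lintegral_const_mul' _ _ ENNReal.ofReal_ne_top]
        exact lintegral_congr fun ω => lintegral_const_mul' _ _ ENNReal.ofReal_ne_top
    _ ≤ ENNReal.ofReal (Real.exp (-S.θ * tg j)) * ∫⁻ t in Set.Ioc (tg j) (tg (j + 1)), 
        (ENNReal.ofReal (vth (KK S) d) * ∫⁻ ω, ENNReal.ofReal (X ω) ∂S.P) := by
        refine mul_le_mul_right ?_ _
        refine setLIntegral_mono' measurableSet_Ioc fun t ht => ?_
        have := one_step S (g.nonneg j) ht.1.le X hXm (fun p => ENNReal.ofReal p.1 * ENNReal.ofReal (Real.exp (KK S * tt (t - tg j) p.2)))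
          (by unfold tt; fun_prop)
        simp only at this
        change ∫⁻ ω, ENNReal.ofReal (X ω) * ENNReal.ofReal (Real.exp (KK S * tt (t - tg j) (dW S (tg j) t ω))) ∂S.P ≤ _
        rw [this]
        rw [← lintegral_const_mul' _ _ ENNReal.ofReal_ne_top]
        refine lintegral_mono fun ω => ?_
        simp only
        rw [lintegral_const_mul' _ _ ENNReal.ofReal_ne_top, mul_comm]
        gcongr
        exact nu_exp_le (KK S) d (t - tg j) (KK_nonneg S) (by linarith [ht.1]) (by linarith [ht.2]) hd0 (g.le j)
    _ = _ := by
        rw [setLIntegral_const, Real.volume_Ioc, ← hd, mul_comm (ENNReal.ofReal (vth (KK S) d)), mul_assoc,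
          ← ENNReal.ofReal_mul (by linarith [one_le_vth (KK_nonneg S) hd0.le])]
        congr 1
        rw [mul_comm, ← lintegral_const_mul' _ _ ENNReal.ofReal_ne_top]
        refine lintegral_congr fun ω => ?_
        rw [← ENNReal.ofReal_mul (by have := one_le_vth (KK_nonneg S) hd0.le; positivity)]
        congr 1
        simp only [hX]
        unfold Lc
        ring

lemma ub_policy (g : Grid tg) (hp : Pol S tg pol) {z : ℝ × ℝ} (h1 : 0 < z.1) (h2 : 0 < z.2) :
    Vcost S z.1 z.2 ≤ ∑' j, ENNReal.ofReal (Real.exp (-S.θ * tg j)) *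
      ∫⁻ ω, ENNReal.ofReal (Lc S (tg (j + 1) - tg j) (Qs S tg pol z j ω) (Zs S tg pol z j ω)) ∂S.P := by
  refine (iInf_le _ ⟨ctl S tg pol z, ctl_adm g hp h1 h2⟩).trans ?_
  choose Y hY1 hY2 hY3 using fun j => cost_block g hp h1 h2 j
  refine le_trans ?_ (ENNReal.tsum_le_tsum hY3)
  rw [← lintegral_tsum fun j => (hY1 j).aemeasurable]
  unfold Jcost
  refine lintegral_mono fun ω => ?_
  refine le_trans (le_of_eq ?_) (ENNReal.tsum_le_tsum fun j => hY2 j ω)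
  have hU : Set.Ioi (0:ℝ) = ⋃ j, Set.Ioc (tg j) (tg (j + 1)) := by
    ext t
    simp only [Set.mem_Ioi, Set.mem_iUnion]
    constructor
    · intro ht; exact g.exists_lt t ht
    · rintro ⟨j, hj⟩; exact (g.nonneg j).trans_lt hj.1
  rw [hU, lintegral_iUnion (fun j => measurableSet_Ioc)]
  intro i j hij
  exact Set.disjoint_left.mpr fun t h h' => hij (g.uniq h h')

/-- two-scale grid -/
def tgr (Δ δ : ℝ) : ℕ → ℝ
  | 0 => 0
  | j + 1 => Δ + j * δ

lemma grid_tgr {Δ δ : ℝ} (h1 : 0 < Δ) (h2 : Δ ≤ 1) (h3 : 0 < δ) (h4 : δ ≤ 1) : Grid (tgr Δ δ) := by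
  refine ⟨rfl, ?_, ?_, ?_⟩
  · rintro (_ | j)
    · simpa [tgr] using h1
    · simp only [tgr]; push_cast; linarith
  · rintro (_ | j)
    · simpa [tgr] using h2
    · simp only [tgr]; push_cast; linarith
  · rw [← Filter.tendsto_add_atTop_iff_nat 1]
    exact Filter.tendsto_atTop_add_const_left _ _ (Filter.Tendsto.atTop_mul_const h3 tendsto_natCast_atTop_atTop)

theorem upper (S : Setting Ω) {Δ δ q : ℝ} (h1 : 0 < Δ) (h2 : Δ ≤ 1) (h3 : 0 < δ) (h4 : δ ≤ 1) (hq : feas S Δ q)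
    {z : ℝ × ℝ} (hz1 : 0 < z.1) (hz2 : 0 < z.2) : Vcost S z.1 z.2 ≤ TT S Δ q (vv S δ) z := by
  haveI := S.isProb
  set tg := tgr Δ δ with htg
  have g : Grid tg := grid_tgr h1 h2 h3 h4
  set pol : ℕ → ℝ × ℝ → Ω → ℝ := fun j z _ => if j = 0 then q else act S δ (sel S δ z) with hpol
  have d0 : tg (0 + 1) - tg 0 = Δ := by simp [htg, tgr]
  have d1 : ∀ j, tg (j + 1 + 1) - tg (j + 1) = δ := by intro j; simp only [htg, tgr]; push_cast; ring
  have hp : Pol S tg pol := by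
    refine ⟨fun j => ?_, fun j z ω => ?_⟩
    · rcases j with _ | j
      · simp only [hpol, if_true]; exact measurable_const
      · simp only [hpol, Nat.succ_ne_zero, if_false]
        exact (measurable_from_top (f := act S δ)).comp ((measurable_sel S δ).comp (@measurable_fst _ _ _ (S.F _)))
    · rcases j with _ | j
      · rw [d0]; simpa [hpol] using hq
      · rw [d1]; simp only [hpol, Nat.succ_ne_zero, if_false]; exact ⟨act_pos S h3 _, act_le S h3 _⟩
  refine (ub_policy g hp hz1 hz2).trans ?_
  refine ENNReal.tsum_le_of_sum_range_le fun N => ?_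
  have key : ∀ N, ∑ j ∈ Finset.range (N + 1), ENNReal.ofReal (Real.exp (-S.θ * tg j)) *
      ∫⁻ ω, ENNReal.ofReal (Lc S (tg (j + 1) - tg j) (Qs S tg pol z j ω) (Zs S tg pol z j ω)) ∂S.P +
      ENNReal.ofReal (Real.exp (-S.θ * tg (N + 1))) * ∫⁻ ω, vv S δ (Zs S tg pol z (N + 1) ω) ∂S.P ≤ TT S Δ q (vv S δ) z := by
    have hexp : ∀ j, ENNReal.ofReal (Real.exp (-S.θ * tg (j + 1))) =
        ENNReal.ofReal (Real.exp (-S.θ * tg j)) * ENNReal.ofReal (Real.exp (-S.θ * (tg (j + 1) - tg j))) := by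
      intro j
      rw [← ENNReal.ofReal_mul (Real.exp_pos _).le, ← Real.exp_add]; congr 2; ring
    intro N
    induction N with
    | zero =>
      rw [Finset.sum_range_one, hexp, mul_assoc, ← mul_add, TT_step g hp z 0 (measurable_vv S δ), d0]
      simp [htg, tgr, hpol, Qs, Zs]
    | succ N ih =>
      refine le_trans ?_ ih
      rw [Finset.sum_range_succ, add_assoc]
      gcongr ?_ + ?_
      · exact le_rfl
      · rw [hexp (N + 1), mul_assoc, ← mul_add, TT_step g hp z (N + 1) (measurable_vv S δ), d1]
        refine mul_le_mul_right (lintegral_mono fun ω => ?_) _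
        have hz := Z_pos g hp hz1 hz2 (N + 1) ω
        exact sel_spec S h3 _ hz.1 hz.2
  rcases N with _ | N
  · simp
  · exact le_self_add.trans (key N)
end

section
variable {S : Setting Ω} {tg : ℕ → ℝ} {pol : ℕ → ℝ × ℝ → Ω → ℝ}

def tgu (δ : ℝ) (j : ℕ) : ℝ := j * δ

lemma tgu_succ (δ : ℝ) (j : ℕ) : tgu δ (j + 1) = tgu δ j + δ := by unfold tgu; push_cast; ring
lemma tgu_sub (δ : ℝ) (j : ℕ) : tgu δ (j + 1) - tgu δ j = δ := by rw [tgu_succ]; ring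
lemma tgu_zero (δ : ℝ) : tgu δ 0 = 0 := by simp [tgu]

lemma grid_tgu {δ : ℝ} (h3 : 0 < δ) (h4 : δ ≤ 1) : Grid (tgu δ) := by
  refine ⟨tgu_zero δ, fun j => ?_, fun j => ?_, ?_⟩
  · rw [tgu_sub]; exact h3
  · rw [tgu_sub]; exact h4
  · exact Filter.Tendsto.atTop_mul_const h3 tendsto_natCast_atTop_atTop

lemma lower_policy {δ : ℝ} (h3 : 0 < δ) (h4 : δ ≤ 1) (hp : Pol S (tgu δ) pol)
    (hact : ∀ j z ω, ∃ i, pol j z ω = act S δ i) (z : ℝ × ℝ) :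
    vv S δ z ≤ ∑' j, ENNReal.ofReal (Real.exp (-S.θ * tgu δ j)) *
      ∫⁻ ω, ENNReal.ofReal (Lc S δ (Qs S (tgu δ) pol z j ω) (Zs S (tgu δ) pol z j ω)) ∂S.P := by
  haveI := S.isProb
  have g := grid_tgu h3 h4
  refine iSup_le fun N => ?_
  have key : ∀ m N, uu S δ (N + m) z ≤ ∑ j ∈ Finset.range m, ENNReal.ofReal (Real.exp (-S.θ * tgu δ j)) *
      ∫⁻ ω, ENNReal.ofReal (Lc S δ (Qs S (tgu δ) pol z j ω) (Zs S (tgu δ) pol z j ω)) ∂S.P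
      + ENNReal.ofReal (Real.exp (-S.θ * tgu δ m)) * ∫⁻ ω, uu S δ N (Zs S (tgu δ) pol z m ω) ∂S.P := by
    intro m
    induction m with
    | zero => intro N; simp [tgu_zero, Zs]
    | succ m ih =>
      intro N
      refine le_trans (le_of_eq (by congr 1; omega)) ((ih (N + 1)).trans ?_)
      rw [Finset.sum_range_succ, add_assoc]
      gcongr ?_ + ?_
      · exact le_rfl
      · have hexp : ENNReal.ofReal (Real.exp (-S.θ * tgu δ (m + 1))) =
            ENNReal.ofReal (Real.exp (-S.θ * tgu δ m)) * ENNReal.ofReal (Real.exp (-S.θ * δ)) := by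
          rw [← ENNReal.ofReal_mul (Real.exp_pos _).le, ← Real.exp_add, tgu_succ]; congr 2; ring
        have h := TT_step g hp z m (measurable_uu S δ N)
        rw [tgu_sub] at h
        rw [hexp, mul_assoc, ← mul_add, h]
        refine mul_le_mul_right (lintegral_mono fun ω => ?_) _
        obtain ⟨i, hi⟩ := hact m (Zs S (tgu δ) pol z m ω) ω
        change (⨅ i, TT S δ (act S δ i) (uu S δ N) _) ≤ TT S δ (pol m (Zs S (tgu δ) pol z m ω) ω) _ _
        rw [hi]
        exact iInf_le _ i
  have h := key N 0
  rw [Nat.zero_add] at h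
  refine h.trans ?_
  have : ∀ x, uu S δ 0 x = 0 := fun _ => rfl
  simp only [this, lintegral_zero, mul_zero, add_zero]
  exact ENNReal.sum_le_tsum _
end

section
lemma tangent_le {s m f : ℝ} (hs : 0 < s) (hm : 0 < m) (hf : 0 < f) :
    m ^ (-s) - s * m ^ (-s - 1) * (f - m) ≤ f ^ (-s) := by
  have h2 : 1 + (-s) * (f / m - 1) ≤ (1 + (f / m - 1)) ^ (-s) := by
    have h0 : 0 < f / m := div_pos hf hm
    rw [add_sub_cancel, Real.rpow_def_of_pos h0]
    have h1 := Real.log_le_sub_one_of_pos h0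
    have h3 := Real.add_one_le_exp (Real.log (f / m) * -s)
    nlinarith
  have e : (1 + (f / m - 1)) = f / m := by ring
  rw [e, Real.div_rpow hf.le hm.le, le_div_iff₀ (Real.rpow_pos_of_pos hm _)] at h2
  refine le_trans (le_of_eq ?_) h2
  rw [Real.rpow_sub_one hm.ne']
  field_simp
  ring

lemma jensen_neg {s m t0 t1 : ℝ} (hs : 0 < s) (hm : 0 < m) (ht : t0 < t1) {f : ℝ → ℝ}
    (hf : IntegrableOn f (Set.Ioc t0 t1)) (hpos : ∀ᵐ u ∂(volume.restrict (Set.Ioc t0 t1)), 0 < f u)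
    (hI : ∫ u in Set.Ioc t0 t1, f u ≤ (t1 - t0) * m) :
    ENNReal.ofReal ((t1 - t0) * m ^ (-s)) ≤ ∫⁻ u in Set.Ioc t0 t1, ENNReal.ofReal (f u ^ (-s)) := by
  have h1 : Integrable (fun u => m ^ (-s) - s * m ^ (-s - 1) * (f u - m)) (volume.restrict (Set.Ioc t0 t1)) := by
    refine Integrable.sub (by simp) ((Integrable.sub hf (by simp)).const_mul _)
  have e : ∫ u in Set.Ioc t0 t1, (m ^ (-s) - s * m ^ (-s - 1) * (f u - m))
      = (t1 - t0) * m ^ (-s) - s * m ^ (-s - 1) * ((∫ u in Set.Ioc t0 t1, f u) - (t1 - t0) * m) := by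
    have c1 : ∀ x : ℝ, Integrable (fun _ : ℝ => x) (volume.restrict (Set.Ioc t0 t1)) := fun x => by simp
    have c2 : Integrable (fun u => f u - m) (volume.restrict (Set.Ioc t0 t1)) := Integrable.sub hf (c1 m)
    rw [integral_sub (c1 _) (c2.const_mul _), integral_const_mul, integral_sub hf (c1 m)]
    simp [ht.le]
  calc ENNReal.ofReal ((t1 - t0) * m ^ (-s)) ≤ ENNReal.ofReal (∫ u in Set.Ioc t0 t1, (m ^ (-s) - s * m ^ (-s - 1) * (f u - m))) := by
        apply ENNReal.ofReal_le_ofReal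
        rw [e]
        have : 0 ≤ s * m ^ (-s - 1) * ((t1 - t0) * m - ∫ u in Set.Ioc t0 t1, f u) := by
          apply mul_nonneg (by positivity); linarith
        nlinarith
    _ ≤ ∫⁻ u in Set.Ioc t0 t1, ENNReal.ofReal (m ^ (-s) - s * m ^ (-s - 1) * (f u - m)) := by
        refine (ENNReal.ofReal_le_ofReal (integral_mono h1 h1.pos_part fun u => le_max_left _ 0)).trans (le_of_eq ?_)
        rw [ofReal_integral_eq_lintegral_ofReal h1.pos_part (Filter.Eventually.of_forall fun u => le_max_right _ 0)]
        exact lintegral_congr fun u => by rw [← max_comm, ENNReal.ofReal_max]; simp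
    _ ≤ _ := by
        refine lintegral_mono_ae ?_
        filter_upwards [hpos] with u hu
        exact ENNReal.ofReal_le_ofReal (tangent_le hs hm hu)

lemma int_pow_le {γ ρ a t0 t1 : ℝ} (hγ0 : 0 ≤ γ) (hγ : γ < 1) (hρ : 0 < ρ) (ha : 0 < a) (ht : t0 < t1) {x : ℝ → ℝ}
    (hx : IntervalIntegrable x volume t0 t1) (hpos : ∀ᵐ u ∂(volume.restrict (Set.Ioc t0 t1)), 0 < x u) :
    IntegrableOn (fun u => (a + ρ * ∫ v in t0..u, x v) ^ (-γ) * x u) (Set.Ioc t0 t1) ∧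
    ∫ u in Set.Ioc t0 t1, (a + ρ * ∫ v in t0..u, x v) ^ (-γ) * x u ≤
      (1 - γ)⁻¹ * (a + ρ * ∫ v in t0..t1, x v) ^ (-γ) * ∫ v in t0..t1, x v := by
  set A : ℝ → ℝ := fun u => a + ρ * ∫ v in t0..u, x v with hA
  have hxs : ∀ u ∈ Set.Icc t0 t1, ∀ w ∈ Set.Icc t0 t1, IntervalIntegrable x volume u w := fun u hu w hw =>
    hx.mono_set (by rw [Set.uIcc_of_le ht.le]; exact Set.uIcc_subset_Icc hu hw)
  have hmono : MonotoneOn A (Set.Icc t0 t1) := by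
    intro u hu w hw huw
    have e : ∫ v in t0..w, x v = (∫ v in t0..u, x v) + ∫ v in u..w, x v :=
      (intervalIntegral.integral_add_adjacent_intervals (hxs _ ⟨le_rfl, ht.le⟩ _ hu) (hxs _ hu _ hw)).symm
    have : 0 ≤ ∫ v in u..w, x v := by
      rw [intervalIntegral.integral_of_le huw]
      refine integral_nonneg_of_ae ?_
      have := ae_restrict_of_ae_restrict_of_subset (Set.Ioc_subset_Ioc hu.1 hw.2) hpos
      filter_upwards [this] with v hv using hv.le
    simp only [hA, e]
    nlinarith
  have hA0 : A t0 = a := by simp [hA]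
  have hAa : ∀ u ∈ Set.Icc t0 t1, a ≤ A u := fun u hu => hA0 ▸ hmono ⟨le_rfl, ht.le⟩ hu hu.1
  have hAc : ContinuousOn A (Set.Icc t0 t1) := by
    have := intervalIntegral.continuousOn_primitive_interval' hx Set.left_mem_uIcc
    rw [Set.uIcc_of_le ht.le] at this
    fun_prop
  have hxi : IntegrableOn x (Set.Ioc t0 t1) := (intervalIntegrable_iff_integrableOn_Ioc_of_le ht.le).mp hx
  have hint : IntegrableOn (fun u => A u ^ (-γ) * x u) (Set.Ioc t0 t1) := by
    rw [← integrableOn_Icc_iff_integrableOn_Ioc] at hxi ⊢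
    refine hxi.continuousOn_mul (hAc.rpow_const fun u hu => Or.inl ?_) isCompact_Icc
    have := hAa u hu; linarith
  refine ⟨hint, ?_⟩
  have hfm : MonotoneOn (fun u => A u ^ (1 - γ)) (Set.uIcc t0 t1) := by
    rw [Set.uIcc_of_le ht.le]
    intro u hu w hw huw
    exact Real.rpow_le_rpow (by have := hAa u hu; linarith) (hmono hu hw huw) (by linarith)
  have h1 := hfm.intervalIntegral_deriv_mem_uIcc
  have hend := hAa t1 ⟨ht.le, le_rfl⟩
  have hle : A t0 ^ (1 - γ) ≤ A t1 ^ (1 - γ) := hfm (by simp) (by simp) ht.le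
  rw [Set.uIcc_of_le (by simp only [sub_nonneg]; exact hle)] at h1
  have h2 : ∫ u in t0..t1, deriv (fun u => A u ^ (1 - γ)) u = ∫ u in t0..t1, (ρ * (1 - γ)) * (A u ^ (-γ) * x u) := by
    apply intervalIntegral.integral_congr_ae
    filter_upwards [hx.ae_hasDerivAt_integral] with u hu huI
    rw [Set.uIoc_of_le ht.le] at huI
    have huI' := Set.Ioc_subset_Icc_self huI
    have := hu (by rw [Set.uIcc_of_le ht.le]; exact huI') t0 Set.left_mem_uIcc
    have hd : HasDerivAt A (ρ * x u) u := (this.const_mul ρ).const_add a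
    have h3 := hd.rpow_const (p := 1 - γ) (Or.inl (by have := hAa u huI'; linarith))
    rw [h3.deriv, show 1 - γ - 1 = -γ by ring]; ring
  rw [h2, intervalIntegral.integral_const_mul, intervalIntegral.integral_of_le ht.le] at h1
  have h3 := h1.2
  simp only [hA0] at h3
  have hg : 0 < 1 - γ := by linarith
  have h4 : a ^ (1 - γ) ≥ A t1 ^ (-γ) * a := by
    have : A t1 ^ (-γ) ≤ a ^ (-γ) := Real.rpow_le_rpow_of_nonpos ha hend (by linarith)
    have e : a ^ (1 - γ) = a ^ (-γ) * a := by rw [show 1 - γ = -γ + 1 by ring, Real.rpow_add_one ha.ne']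
    rw [e]; gcongr
  have h5 : A t1 ^ (1 - γ) = A t1 ^ (-γ) * A t1 := by
    rw [show 1 - γ = -γ + 1 by ring, Real.rpow_add_one (by linarith)]
  have h6 : A t1 = a + ρ * ∫ v in t0..t1, x v := rfl
  change _ ≤ (1 - γ)⁻¹ * A t1 ^ (-γ) * ∫ v in t0..t1, x v
  have h7 : ρ * (1 - γ) * ∫ u in Set.Ioc t0 t1, A u ^ (-γ) * x u ≤ A t1 ^ (-γ) * (ρ * ∫ v in t0..t1, x v) := by
    have h8 : A t1 ^ (-γ) * A t1 = A t1 ^ (-γ) * a + A t1 ^ (-γ) * (ρ * ∫ v in t0..t1, x v) := by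
      conv_lhs => rw [h6, mul_add]
    linarith
  rw [mul_assoc, inv_mul_eq_div, le_div_iff₀ hg]
  refine le_of_mul_le_mul_left ?_ hρ
  linarith

lemma block_lemma {γ ρ a s b t0 t1 : ℝ} (hγ0 : 0 ≤ γ) (hγ : γ < 1) (hρ : 0 < ρ) (ha : 0 < a) (hs : 0 < s) (hb : b = γ * s)
    (ht : t0 < t1) {x : ℝ → ℝ}
    (hx : IntervalIntegrable x volume t0 t1) (hpos : ∀ᵐ u ∂(volume.restrict (Set.Ioc t0 t1)), 0 < x u) :
    ENNReal.ofReal ((t1 - t0) * (a + ρ * ∫ v in t0..t1, x v) ^ b * ((t1 - t0)⁻¹ * ∫ v in t0..t1, x v) ^ (-s)) ≤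
      ENNReal.ofReal (min ((1 - γ)⁻¹ ^ s) (((a + ρ * ∫ v in t0..t1, x v) / a) ^ b)) *
      ∫⁻ u in Set.Ioc t0 t1, ENNReal.ofReal ((a + ρ * ∫ v in t0..u, x v) ^ b * x u ^ (-s)) := by
  have hb0 : 0 ≤ b := hb ▸ mul_nonneg hγ0 hs.le
  have hd : 0 < t1 - t0 := by linarith
  have hxi : IntegrableOn x (Set.Ioc t0 t1) := (intervalIntegrable_iff_integrableOn_Ioc_of_le ht.le).mp hx
  have hI : 0 < ∫ v in t0..t1, x v := by
    rw [intervalIntegral.integral_of_le ht.le]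
    rw [integral_pos_iff_support_of_nonneg_ae (by filter_upwards [hpos] with v hv using hv.le) hxi]
    have : volume.restrict (Set.Ioc t0 t1) (Function.support x) = volume.restrict (Set.Ioc t0 t1) Set.univ := by
      apply measure_congr
      filter_upwards [hpos] with v hv
      exact propext ⟨fun _ => trivial, fun _ => hv.ne'⟩
    rw [this]; simp; linarith
  set I := ∫ v in t0..t1, x v with hIdef
  set E := a + ρ * I with hE
  have hE0 : 0 < E := by positivity
  have hAa : ∀ u ∈ Set.Ioc t0 t1, a ≤ a + ρ * ∫ v in t0..u, x v := by
    intro u hu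
    have : 0 ≤ ∫ v in t0..u, x v := by
      rw [intervalIntegral.integral_of_le hu.1.le]
      refine integral_nonneg_of_ae ?_
      have := ae_restrict_of_ae_restrict_of_subset (Set.Ioc_subset_Ioc le_rfl hu.2) hpos
      filter_upwards [this] with v hv using hv.le
    nlinarith
  have hg : 0 < 1 - γ := by linarith
  rcases min_choice ((1 - γ)⁻¹ ^ s) ((E / a) ^ b) with h | h
  · rw [h]
    obtain ⟨i1, i2⟩ := int_pow_le hγ0 hγ hρ ha ht hx hpos
    have hm : 0 < (1 - γ)⁻¹ * E ^ (-γ) * ((t1 - t0)⁻¹ * I) := by positivity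
    have hj := jensen_neg hs hm ht i1 (by
      filter_upwards [hpos, ae_restrict_mem measurableSet_Ioc] with u hu huI
      have := hAa u huI
      have : 0 < a + ρ * ∫ v in t0..u, x v := by linarith
      positivity) (i2.trans (le_of_eq (by rw [← hIdef, ← hE]; field_simp)))
    have e1 : ∀ᵐ u ∂(volume.restrict (Set.Ioc t0 t1)), ENNReal.ofReal (((a + ρ * ∫ v in t0..u, x v) ^ (-γ) * x u) ^ (-s))
        = ENNReal.ofReal ((a + ρ * ∫ v in t0..u, x v) ^ b * x u ^ (-s)) := by
      filter_upwards [hpos, ae_restrict_mem measurableSet_Ioc] with u hu huI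
      have := hAa u huI
      have h0 : 0 < a + ρ * ∫ v in t0..u, x v := by linarith
      rw [Real.mul_rpow (by positivity) hu.le, ← Real.rpow_mul h0.le, hb, neg_mul_neg]
    rw [lintegral_congr_ae e1] at hj
    refine le_trans (le_of_eq ?_) (mul_le_mul_right hj _)
    rw [← ENNReal.ofReal_mul (by positivity)]
    congr 1
    rw [Real.mul_rpow (x := (1 - γ)⁻¹ * E ^ (-γ)) (by positivity) (by positivity), Real.mul_rpow (x := (1 - γ)⁻¹) (by positivity) (by positivity), ← Real.rpow_mul hE0.le,
      neg_mul_neg, ← hb, Real.rpow_neg (x := (1 - γ)⁻¹) (by positivity)]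
    have : 0 < (1 - γ)⁻¹ ^ s := by positivity
    field_simp
  · rw [h]
    have hj := jensen_neg hs (m := (t1 - t0)⁻¹ * I) (by positivity) ht hxi hpos (by
      rw [hIdef, intervalIntegral.integral_of_le ht.le]; exact le_of_eq (by field_simp))
    have h3 : ENNReal.ofReal (a ^ b) * ∫⁻ u in Set.Ioc t0 t1, ENNReal.ofReal (x u ^ (-s)) ≤
        ∫⁻ u in Set.Ioc t0 t1, ENNReal.ofReal ((a + ρ * ∫ v in t0..u, x v) ^ b * x u ^ (-s)) := by
      rw [← lintegral_const_mul' _ _ ENNReal.ofReal_ne_top]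
      refine lintegral_mono_ae ?_
      filter_upwards [hpos, ae_restrict_mem measurableSet_Ioc] with u hu huI
      have := hAa u huI
      rw [← ENNReal.ofReal_mul (by positivity)]
      apply ENNReal.ofReal_le_ofReal
      gcongr
    refine le_trans ?_ (mul_le_mul_right h3 _)
    refine le_trans (le_of_eq ?_) (mul_le_mul_right (mul_le_mul_right hj _) _)
    rw [← ENNReal.ofReal_mul (by positivity), ← ENNReal.ofReal_mul (by positivity)]
    congr 1
    rw [Real.div_rpow hE0.le ha.le]
    field_simp
end

section
def ktl (S : Setting Ω) (k₀ : ℝ) (c : ℝ → Ω → ℝ) (t : ℝ) (ω : Ω) : ℝ := k₀ - ∫ s in (0:ℝ)..t, c s ω * Real.exp (-EE S s ω)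
def htl (S : Setting Ω) (h₀ : ℝ) (c : ℝ → Ω → ℝ) (t : ℝ) (ω : Ω) : ℝ := h₀ + S.ρ * ∫ s in (0:ℝ)..t, c s ω * Real.exp (-GG S s ω)
def mm (S : Setting Ω) (t u : ℝ) (ω : Ω) : ℝ := Real.exp (-(kap S * TTn S u t ω))

def Yv (S : Setting Ω) (δ η : ℝ) (c : ℝ → Ω → ℝ) : ℕ → Ω → ℝ
  | 0 => fun _ => 0
  | j + 1 => fun ω => (1 - η) * (δ⁻¹ * ∫ u in tgu δ j..tgu δ (j + 1), c u ω * mm S (tgu δ (j + 1)) u ω)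

open Classical in
def idx (S : Setting Ω) (δ k y : ℝ) : ℕ := if h : ∃ i, act S δ i * k ≤ y then Nat.find h else 0

def tpol (S : Setting Ω) (δ η : ℝ) (c : ℝ → Ω → ℝ) (j : ℕ) (z : ℝ × ℝ) (ω : Ω) : ℝ := act S δ (idx S δ z.1 (Yv S δ η c j ω))

lemma idx_spec (S : Setting Ω) {δ k y : ℝ} (hδ : 0 < δ) (hk : 0 < k) (hy : 0 < y) (hyk : y ≤ S.R * k) :
    act S δ (idx S δ k y) * k ≤ y ∧ (1 + S.R * δ)⁻¹ * y ≤ act S δ (idx S δ k y) * k := by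
  classical
  have hR := S.hR
  have hr : 0 < (1 + S.R * δ)⁻¹ := by positivity
  have hex : ∃ i, act S δ i * k ≤ y := by
    have h := (act_tendsto S hδ).mul_const k
    rw [zero_mul] at h
    exact ((h.eventually_lt_const hy).exists).imp fun i hi => hi.le
  unfold idx
  rw [dif_pos hex]
  refine ⟨Nat.find_spec hex, ?_⟩
  rcases hi : Nat.find hex with _ | i
  · unfold act
    calc _ ≤ (1 + S.R * δ)⁻¹ * (S.R * k) := by gcongr
      _ = _ := by ring
  · have := Nat.find_min hex (m := i) (by omega)
    push Not at this
    calc _ ≤ (1 + S.R * δ)⁻¹ * (act S δ i * k) := by gcongr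
      _ = _ := by unfold act; ring

lemma measurable_idx (S : Setting Ω) (δ : ℝ) : Measurable (fun p : ℝ × ℝ => idx S δ p.1 p.2) := by
  classical
  refine measurable_find_nat (fun p i => act S δ i * p.1 ≤ p.2) (fun i => ?_) _ ?_ ?_
  · exact measurableSet_le (by fun_prop) (by fun_prop)
  · intro x h
    unfold idx; rw [dif_pos h]
    exact ⟨Nat.find_spec h, fun j hj => Nat.find_min h hj⟩
  · intro x h
    unfold idx; rw [dif_neg h]

/-- good paths -/
structure Good (S : Setting Ω) (k₀ h₀ : ℝ) (c : ℝ → Ω → ℝ) (ω : Ω) : Prop where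
  int : ∀ t : ℝ, 0 ≤ t → IntervalIntegrable (fun s => c s ω) volume 0 t
  pos : ∀ᵐ t ∂(volume.restrict (Set.Ici (0:ℝ))), 0 < c t ω
  kpos : ∀ t : ℝ, 0 ≤ t → 0 < kProc S k₀ c t ω
  bdd : ∀ᵐ t ∂(volume.restrict (Set.Ici (0:ℝ))), c t ω ≤ S.R * kProc S k₀ c t ω

lemma IsAdmissible.good {S : Setting Ω} {k₀ h₀ : ℝ} {c : ℝ → Ω → ℝ} (h : IsAdmissible S k₀ h₀ c) :
    ∀ᵐ ω ∂S.P, Good S k₀ h₀ c ω := by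
  filter_upwards [h.locInt, h.cpos, h.kpos, h.cbdd] with ω a1 a2 a3 a4 using ⟨a1, a2, a3, a4⟩

variable {S : Setting Ω} {k₀ h₀ : ℝ} {c : ℝ → Ω → ℝ} {ω : Ω}

lemma Good.int' (g : Good S k₀ h₀ c ω) {f : ℝ → ℝ} (hf : Continuous f) {a b : ℝ} (ha : 0 ≤ a) (hb : 0 ≤ b) :
    IntervalIntegrable (fun u => c u ω * f u) volume a b :=
  IntervalIntegrable.mul_continuousOn ((g.int a ha).symm.trans (g.int b hb)) hf.continuousOn

lemma Good.pos' (g : Good S k₀ h₀ c ω) {a b : ℝ} (ha : 0 ≤ a) : ∀ᵐ t ∂(volume.restrict (Set.Ioc a b)), 0 < c t ω :=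
  ae_restrict_of_ae_restrict_of_subset (fun _ hx => ha.trans hx.1.le) g.pos

lemma Good.bdd' (g : Good S k₀ h₀ c ω) {a b : ℝ} (ha : 0 ≤ a) :
    ∀ᵐ t ∂(volume.restrict (Set.Ioc a b)), c t ω ≤ S.R * kProc S k₀ c t ω :=
  ae_restrict_of_ae_restrict_of_subset (fun _ hx => ha.trans hx.1.le) g.bdd

lemma Good.mono_int (g : Good S k₀ h₀ c ω) {f f' : ℝ → ℝ} (hf : Continuous f) (hf' : Continuous f') {a b : ℝ} (ha : 0 ≤ a) (hab : a ≤ b)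
    (h : ∀ u ∈ Set.Icc a b, f u ≤ f' u) : ∫ u in a..b, c u ω * f u ≤ ∫ u in a..b, c u ω * f' u := by
  refine intervalIntegral.integral_mono_ae_restrict hab (g.int' hf ha (ha.trans hab)) (g.int' hf' ha (ha.trans hab)) ?_
  have hp : ∀ᵐ t ∂(volume.restrict (Set.Icc a b)), 0 < c t ω :=
    ae_restrict_of_ae_restrict_of_subset (fun _ hx => ha.trans hx.1) g.pos
  filter_upwards [hp, ae_restrict_mem measurableSet_Icc] with u hu hI
  exact mul_le_mul_of_nonneg_left (h u hI) hu.le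

lemma Good.int_nonneg (g : Good S k₀ h₀ c ω) {f : ℝ → ℝ} (hf : Continuous f) {a b : ℝ} (ha : 0 ≤ a) (hab : a ≤ b)
    (h : ∀ u, 0 ≤ f u) : 0 ≤ ∫ u in a..b, c u ω * f u := by
  have := g.mono_int continuous_const hf ha hab (fun u _ => h u)
  simpa using this

lemma cont_mm (S : Setting Ω) (t : ℝ) (ω : Ω) : Continuous fun u => mm S t u ω := by
  have := cont_TTn' S t ω; unfold mm; fun_prop

lemma ktl_sub (g : Good S k₀ h₀ c ω) {a b : ℝ} (ha : 0 ≤ a) (hb : 0 ≤ b) :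
    ktl S k₀ c a ω - ktl S k₀ c b ω = ∫ u in a..b, c u ω * Real.exp (-EE S u ω) := by
  have hE : Continuous fun u => Real.exp (-EE S u ω) := by have := cont_EE S ω; fun_prop
  have := intervalIntegral.integral_add_adjacent_intervals (g.int' hE le_rfl ha) (g.int' hE ha hb)
  unfold ktl; linarith

lemma htl_sub (g : Good S k₀ h₀ c ω) {a b : ℝ} (ha : 0 ≤ a) (hb : 0 ≤ b) :
    htl S h₀ c b ω - htl S h₀ c a ω = S.ρ * ∫ u in a..b, c u ω * Real.exp (-GG S u ω) := by
  have hE : Continuous fun u => Real.exp (-GG S u ω) := by have := cont_GG S ω; fun_prop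
  have := intervalIntegral.integral_add_adjacent_intervals (g.int' hE le_rfl ha) (g.int' hE ha hb)
  unfold htl; rw [← this]; ring

lemma ktl_anti (g : Good S k₀ h₀ c ω) {a b : ℝ} (ha : 0 ≤ a) (hab : a ≤ b) : ktl S k₀ c b ω ≤ ktl S k₀ c a ω := by
  have hE : Continuous fun u => Real.exp (-EE S u ω) := by have := cont_EE S ω; fun_prop
  have := ktl_sub g ha (ha.trans hab)
  have := g.int_nonneg hE ha hab (fun u => (Real.exp_pos _).le)
  linarith

lemma htl_mono (g : Good S k₀ h₀ c ω) {a b : ℝ} (ha : 0 ≤ a) (hab : a ≤ b) : htl S h₀ c a ω ≤ htl S h₀ c b ω := by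
  have hE : Continuous fun u => Real.exp (-GG S u ω) := by have := cont_GG S ω; fun_prop
  have := htl_sub g ha (ha.trans hab)
  have := mul_nonneg S.hρ₀.le (g.int_nonneg hE ha hab (fun u => (Real.exp_pos _).le))
  linarith

lemma htl_pos (g : Good S k₀ h₀ c ω) (h : 0 < h₀) {a : ℝ} (ha : 0 ≤ a) : 0 < htl S h₀ c a ω := by
  have := htl_mono g le_rfl ha
  simp only [htl, intervalIntegral.integral_same, mul_zero, add_zero] at this ⊢
  linarith

lemma mm_le_EE (S : Setting Ω) {u t : ℝ} (h : u ≤ t) (ω : Ω) : mm S t u ω ≤ Real.exp (EE S t ω) * Real.exp (-EE S u ω) := by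
  unfold mm; rw [← Real.exp_add]; apply Real.exp_le_exp.mpr
  have := abs_le.mp (abs_EE_sub S h ω); linarith [this.1]
lemma mm_le_EE' (S : Setting Ω) {u t : ℝ} (h : u ≤ t) (ω : Ω) : mm S t u ω * Real.exp (EE S u ω) ≤ Real.exp (EE S t ω) := by
  unfold mm; rw [← Real.exp_add]; apply Real.exp_le_exp.mpr
  have := abs_le.mp (abs_EE_sub S h ω); linarith [this.1]
lemma mm_le_GG (S : Setting Ω) {u t : ℝ} (h : u ≤ t) (ω : Ω) : mm S t u ω ≤ Real.exp (GG S t ω) * Real.exp (-GG S u ω) := by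
  unfold mm; rw [← Real.exp_add]; apply Real.exp_le_exp.mpr
  have := abs_le.mp (abs_GG_sub S h ω); linarith [this.1]

lemma int_mm_pos (g : Good S k₀ h₀ c ω) {a b : ℝ} (ha : 0 ≤ a) (hab : a < b) : 0 < ∫ u in a..b, c u ω * mm S b u ω := by
  have hi := g.int' (cont_mm S b ω) ha (ha.trans hab.le)
  have hxi : IntegrableOn (fun u => c u ω * mm S b u ω) (Set.Ioc a b) := (intervalIntegrable_iff_integrableOn_Ioc_of_le hab.le).mp hi
  have hpos : ∀ᵐ u ∂(volume.restrict (Set.Ioc a b)), 0 < c u ω * mm S b u ω := by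
    filter_upwards [g.pos' ha] with u hu
    exact mul_pos hu (Real.exp_pos _)
  rw [intervalIntegral.integral_of_le hab.le]
  rw [integral_pos_iff_support_of_nonneg_ae (by filter_upwards [hpos] with v hv using hv.le) hxi]
  have : volume.restrict (Set.Ioc a b) (Function.support (fun u => c u ω * mm S b u ω)) = volume.restrict (Set.Ioc a b) Set.univ := by
    apply measure_congr
    filter_upwards [hpos] with v hv
    exact propext ⟨fun _ => trivial, fun _ => hv.ne'⟩
  rw [this]; simp; linarith

lemma int_mm_le_k (g : Good S k₀ h₀ c ω) {a b : ℝ} (ha : 0 ≤ a) (hab : a < b) :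
    ∫ u in a..b, c u ω * mm S b u ω ≤ Real.exp (EE S b ω) * (ktl S k₀ c a ω - ktl S k₀ c b ω) := by
  have hE : Continuous fun u => Real.exp (-EE S u ω) := by have := cont_EE S ω; fun_prop
  rw [ktl_sub g ha (ha.trans hab.le), ← intervalIntegral.integral_const_mul]
  refine (g.mono_int (cont_mm S b ω) ((continuous_const (y := Real.exp (EE S b ω))).mul hE) ha hab.le fun u hu => mm_le_EE S hu.2 ω).trans (le_of_eq ?_)
  congr 1; ext u; simp only [Pi.mul_apply]; ring

lemma int_mm_le_h (g : Good S k₀ h₀ c ω) {a b t : ℝ} (ha : 0 ≤ a) (hab : a ≤ b) (hbt : b ≤ t) :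
    S.ρ * ∫ u in a..b, c u ω * mm S t u ω ≤ Real.exp (GG S t ω) * (htl S h₀ c b ω - htl S h₀ c a ω) := by
  have hE : Continuous fun u => Real.exp (-GG S u ω) := by have := cont_GG S ω; fun_prop
  rw [htl_sub g ha (ha.trans hab)]
  have h1 := g.mono_int (cont_mm S t ω) ((continuous_const (y := Real.exp (GG S t ω))).mul hE) ha hab fun u hu => mm_le_GG S (hu.2.trans hbt) ω
  have h2 : ∫ u in a..b, c u ω * (Real.exp (GG S t ω) * Real.exp (-GG S u ω)) = Real.exp (GG S t ω) * ∫ u in a..b, c u ω * Real.exp (-GG S u ω) := by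
    rw [← intervalIntegral.integral_const_mul]; congr 1; ext u; ring
  have h3 := mul_le_mul_of_nonneg_left (h1.trans_eq h2) S.hρ₀.le
  linarith

lemma int_mm_le_R (g : Good S k₀ h₀ c ω) {a b : ℝ} (ha : 0 ≤ a) (hab : a < b) :
    ∫ u in a..b, c u ω * mm S b u ω ≤ (b - a) * (S.R * (Real.exp (EE S b ω) * ktl S k₀ c a ω)) := by
  rw [← smul_eq_mul, ← intervalIntegral.integral_const, intervalIntegral.integral_of_le hab.le, intervalIntegral.integral_of_le hab.le]
  refine integral_mono_ae ((intervalIntegrable_iff_integrableOn_Ioc_of_le hab.le).mp (g.int' (cont_mm S b ω) ha (ha.trans hab.le))) (integrableOn_const (by simp)) ?_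
  filter_upwards [g.bdd' ha, ae_restrict_mem measurableSet_Ioc] with u hu hI
  have hm : 0 ≤ mm S b u ω := (Real.exp_pos _).le
  have hk : 0 ≤ ktl S k₀ c u ω := by
    have := g.kpos u (ha.trans hI.1.le)
    rw [kProc_eq] at this
    exact (pos_of_mul_pos_right this (Real.exp_pos _).le).le
  have h1 : kProc S k₀ c u ω = Real.exp (EE S u ω) * ktl S k₀ c u ω := kProc_eq _ _ _ _ _
  rw [h1] at hu
  have hR := S.hR
  calc c u ω * mm S b u ω ≤ S.R * (Real.exp (EE S u ω) * ktl S k₀ c u ω) * mm S b u ω := by gcongr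
    _ = S.R * ((mm S b u ω * Real.exp (EE S u ω)) * ktl S k₀ c u ω) := by ring
    _ ≤ _ := by
      gcongr
      · exact mm_le_EE' S hI.2 ω
      · exact ktl_anti g ha hI.1.le
end

section
variable {S : Setting Ω} {k₀ h₀ : ℝ} {c : ℝ → Ω → ℝ} {ω : Ω}

lemma tgu_nonneg {δ : ℝ} (hδ : 0 < δ) (j : ℕ) : 0 ≤ tgu δ j := by unfold tgu; positivity

lemma Zs_succ_k (S : Setting Ω) (δ : ℝ) (pol : ℕ → ℝ × ℝ → Ω → ℝ) (z : ℝ × ℝ) (j : ℕ) (ω : Ω) :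
    (Zs S (tgu δ) pol z (j + 1) ω).1 = Real.exp (EE S (tgu δ (j + 1)) ω - EE S (tgu δ j) ω) *
      ((Zs S (tgu δ) pol z j ω).1 - Qs S (tgu δ) pol z j ω * (Zs S (tgu δ) pol z j ω).1 * δ) := by
  simp only [Zs, nxt, dW, Qs, EE, tgu_sub]
  congr 2
  rw [tgu_succ]; ring

lemma Zs_succ_h (S : Setting Ω) (δ : ℝ) (pol : ℕ → ℝ × ℝ → Ω → ℝ) (z : ℝ × ℝ) (j : ℕ) (ω : Ω) :
    (Zs S (tgu δ) pol z (j + 1) ω).2 = Real.exp (GG S (tgu δ (j + 1)) ω - GG S (tgu δ j) ω) *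
      ((Zs S (tgu δ) pol z j ω).2 + S.ρ * (Qs S (tgu δ) pol z j ω * (Zs S (tgu δ) pol z j ω).1) * δ) := by
  simp only [Zs, nxt, dW, Qs, GG, tgu_sub]
  congr 2
  rw [tgu_succ]; ring

lemma track_Y (g : Good S k₀ h₀ c ω) {δ η : ℝ} (hδ : 0 < δ) (hη1 : η < 1) (j : ℕ) {z : ℝ × ℝ} (hz : 0 < z.1)
    (hK : (1 - η) * (Real.exp (EE S (tgu δ (j + 1)) ω) * ktl S k₀ c (tgu δ j) ω) ≤ z.1) :
    tpol S δ η c (j + 1) z ω * z.1 * δ ≤ (1 - η) * ∫ u in tgu δ j..tgu δ (j + 1), c u ω * mm S (tgu δ (j + 1)) u ω ∧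
    (1 + S.R * δ)⁻¹ * ((1 - η) * (δ⁻¹ * ∫ u in tgu δ j..tgu δ (j + 1), c u ω * mm S (tgu δ (j + 1)) u ω)) ≤
      tpol S δ η c (j + 1) z ω * z.1 := by
  have hlt : tgu δ j < tgu δ (j + 1) := by rw [tgu_succ]; linarith
  have hI := int_mm_pos g (tgu_nonneg hδ j) hlt
  have hR := int_mm_le_R g (tgu_nonneg hδ j) hlt
  rw [tgu_sub] at hR
  set I := ∫ u in tgu δ j..tgu δ (j + 1), c u ω * mm S (tgu δ (j + 1)) u ω with hIdef
  have h1 : 0 < 1 - η := by linarith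
  have hY : Yv S δ η c (j + 1) ω = (1 - η) * (δ⁻¹ * I) := rfl
  have hY0 : 0 < Yv S δ η c (j + 1) ω := by rw [hY]; positivity
  have hYR : Yv S δ η c (j + 1) ω ≤ S.R * z.1 := by
    rw [hY]
    have : δ⁻¹ * I ≤ S.R * (Real.exp (EE S (tgu δ (j + 1)) ω) * ktl S k₀ c (tgu δ j) ω) := by
      rw [inv_mul_le_iff₀ hδ]; exact hR
    have h2 := mul_le_mul_of_nonneg_left this h1.le
    have h3 := mul_le_mul_of_nonneg_left hK S.hR.le
    linarith
  obtain ⟨h2, h3⟩ := idx_spec S hδ hz hY0 hYR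
  rw [hY] at h2 h3
  unfold tpol
  rw [hY]
  refine ⟨?_, h3⟩
  calc _ ≤ (1 - η) * (δ⁻¹ * I) * δ := by gcongr
    _ = _ := by field_simp

lemma track (hk : 0 < k₀) (hh : 0 < h₀) (g : Good S k₀ h₀ c ω) {δ η : ℝ} (hδ : 0 < δ) (hδ1 : δ ≤ 1) (hη0 : 0 < η) (hη1 : η < 1)
    (he1 : S.R * δ ≤ η) (he2 : S.ρ * (S.R * k₀) * δ ≤ η * h₀) (hp : Pol S (tgu δ) (tpol S δ η c)) (j : ℕ) :
    (1 - η) * (Real.exp (EE S (tgu δ (j + 1)) ω) * ktl S k₀ c (tgu δ j) ω) ≤ (Zs S (tgu δ) (tpol S δ η c) (k₀, h₀) (j + 1) ω).1 ∧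
    (Zs S (tgu δ) (tpol S δ η c) (k₀, h₀) (j + 1) ω).2 ≤ (1 + η) * (Real.exp (GG S (tgu δ (j + 1)) ω) * htl S h₀ c (tgu δ j) ω) := by
  have gr := grid_tgu hδ hδ1
  have hR := S.hR
  have hρ := S.hρ₀
  induction j with
  | zero =>
    have hf := hp.feas 0 (k₀, h₀) ω
    rw [tgu_sub] at hf
    have hq : tpol S δ η c 0 (k₀, h₀) ω ≤ S.R := by
      have := hf.2; have := hf.1; nlinarith [mul_pos (mul_pos hf.1 hR) hδ]
    rw [Zs_succ_k, Zs_succ_h]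
    simp only [Zs, Qs, tgu_zero, EE_zero, GG_zero, sub_zero, ktl, htl, intervalIntegral.integral_same, mul_zero, add_zero]
    constructor
    · have : (1 - η) * k₀ ≤ k₀ - tpol S δ η c 0 (k₀, h₀) ω * k₀ * δ := by
        have : tpol S δ η c 0 (k₀, h₀) ω * k₀ * δ ≤ S.R * k₀ * δ := by gcongr
        nlinarith
      calc _ = Real.exp (EE S (tgu δ (0 + 1)) ω) * ((1 - η) * k₀) := by ring
        _ ≤ _ := by gcongr
    · have : h₀ + S.ρ * (tpol S δ η c 0 (k₀, h₀) ω * k₀) * δ ≤ (1 + η) * h₀ := by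
        have : S.ρ * (tpol S δ η c 0 (k₀, h₀) ω * k₀) * δ ≤ S.ρ * (S.R * k₀) * δ := by gcongr
        nlinarith
      calc _ ≤ Real.exp (GG S (tgu δ (0 + 1)) ω) * ((1 + η) * h₀) := by gcongr
        _ = _ := by ring
  | succ j ih =>
    have hZ := Z_pos gr hp (z := (k₀, h₀)) hk hh (j + 1) ω
    obtain ⟨a1, a2⟩ := track_Y g hδ hη1 j hZ.1 ih.1
    have hlt : tgu δ j < tgu δ (j + 1) := by rw [tgu_succ]; linarith
    have b1 := int_mm_le_k g (tgu_nonneg hδ j) hlt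
    have b2 := int_mm_le_h g (tgu_nonneg hδ j) hlt.le le_rfl
    have b3 := int_mm_pos g (tgu_nonneg hδ j) hlt
    set I := ∫ u in tgu δ j..tgu δ (j + 1), c u ω * mm S (tgu δ (j + 1)) u ω with hIdef
    rw [Zs_succ_k S δ _ _ (j + 1), Zs_succ_h S δ _ _ (j + 1)]
    change _ ≤ _ * (_ - tpol S δ η c (j + 1) _ ω * _ * δ) ∧ _ * (_ + S.ρ * (tpol S δ η c (j + 1) _ ω * _) * δ) ≤ _
    set w := tpol S δ η c (j + 1) (Zs S (tgu δ) (tpol S δ η c) (k₀, h₀) (j + 1) ω) ω * (Zs S (tgu δ) (tpol S δ η c) (k₀, h₀) (j + 1) ω).1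
    constructor
    · have h1 : (1 - η) * (Real.exp (EE S (tgu δ (j + 1)) ω) * ktl S k₀ c (tgu δ (j + 1)) ω) ≤
          (Zs S (tgu δ) (tpol S δ η c) (k₀, h₀) (j + 1) ω).1 - w * δ := by
        have := mul_le_mul_of_nonneg_left b1 (show 0 ≤ 1 - η by linarith)
        have := ih.1
        nlinarith
      rw [Real.exp_sub]
      calc _ = Real.exp (EE S (tgu δ (j + 1 + 1)) ω) / Real.exp (EE S (tgu δ (j + 1)) ω) * ((1 - η) * (Real.exp (EE S (tgu δ (j + 1)) ω) * ktl S k₀ c (tgu δ (j + 1)) ω)) := by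
            field_simp
        _ ≤ _ := by gcongr
    · have h1 : (Zs S (tgu δ) (tpol S δ η c) (k₀, h₀) (j + 1) ω).2 + S.ρ * w * δ ≤
          (1 + η) * (Real.exp (GG S (tgu δ (j + 1)) ω) * htl S h₀ c (tgu δ (j + 1)) ω) := by
        have c1 : S.ρ * w * δ ≤ S.ρ * I := by
          rw [mul_assoc]
          refine mul_le_mul_of_nonneg_left ?_ hρ.le
          nlinarith
        have c2 : S.ρ * I ≤ (1 + η) * (S.ρ * I) := by nlinarith [mul_pos hρ b3]
        have c3 := mul_le_mul_of_nonneg_left b2 (show 0 ≤ 1 + η by linarith)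
        have := ih.2
        nlinarith
      rw [Real.exp_sub]
      calc _ ≤ Real.exp (GG S (tgu δ (j + 1 + 1)) ω) / Real.exp (GG S (tgu δ (j + 1)) ω) * ((1 + η) * (Real.exp (GG S (tgu δ (j + 1)) ω) * htl S h₀ c (tgu δ (j + 1)) ω)) := by gcongr
        _ = _ := by field_simp

def Xc (S : Setting Ω) (h₀ : ℝ) (c : ℝ → Ω → ℝ) (t : ℝ) (ω : Ω) : ℝ≥0∞ :=
  ENNReal.ofReal ((S.σ - 1)⁻¹ * ((hProc S h₀ c t ω) ^ S.γ / c t ω) ^ (S.σ - 1) * Real.exp (-S.θ * t))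

/-- oscillation factor -/
def osc (S : Setting Ω) (h₀ : ℝ) (c : ℝ → Ω → ℝ) (t t' : ℝ) (ω : Ω) : ℝ :=
  min ((1 - S.γ)⁻¹ ^ sg S) ((htl S h₀ c t' ω / htl S h₀ c t ω) ^ bb S)

set_option maxHeartbeats 1000000 in
lemma track_cost (hk : 0 < k₀) (hh : 0 < h₀) (g : Good S k₀ h₀ c ω) {δ η : ℝ} (hδ : 0 < δ) (hδ1 : δ ≤ 1) (hη0 : 0 < η) (hη1 : η < 1)
    (he1 : S.R * δ ≤ η) (he2 : S.ρ * (S.R * k₀) * δ ≤ η * h₀) (hp : Pol S (tgu δ) (tpol S δ η c)) (j : ℕ) :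
    ENNReal.ofReal (Real.exp (-S.θ * tgu δ (j + 1))) *
     ENNReal.ofReal (Lc S δ (Qs S (tgu δ) (tpol S δ η c) (k₀, h₀) (j + 1) ω) (Zs S (tgu δ) (tpol S δ η c) (k₀, h₀) (j + 1) ω)) ≤
    ENNReal.ofReal (vth (KK S) δ * (1 + η) ^ bb S * ((1 + S.R * δ)⁻¹ * (1 - η)) ^ (-sg S)) *
      ∫⁻ u in Set.Ioc (tgu δ j) (tgu δ (j + 1)), ENNReal.ofReal (osc S h₀ c (tgu δ j) (tgu δ (j + 1)) ω *
        Real.exp (KK S * TTn S u (tgu δ (j + 1)) ω)) * Xc S h₀ c u ω := by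
  have gr := grid_tgu hδ hδ1
  have hR := S.hR
  have hρ := S.hρ₀
  have hs := sg_pos S
  have hb := bb_nonneg S
  have hv : 0 < vth (KK S) δ := lt_of_lt_of_le one_pos (one_le_vth (KK_nonneg S) hδ.le)
  have hlt : tgu δ j < tgu δ (j + 1) := by rw [tgu_succ]; linarith
  have ht0 := tgu_nonneg hδ j
  obtain ⟨hK, hH⟩ := track hk hh g hδ hδ1 hη0 hη1 he1 he2 hp j
  have hZ := Z_pos gr hp (z := (k₀, h₀)) hk hh (j + 1) ω
  obtain ⟨a1, a2⟩ := track_Y g hδ hη1 j hZ.1 hK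
  have b3 := int_mm_pos g ht0 hlt
  have hhl := htl_pos g hh ht0
  set I := ∫ u in tgu δ j..tgu δ (j + 1), c u ω * mm S (tgu δ (j + 1)) u ω with hIdef
  set T := tgu δ (j + 1) with hT
  set a := Real.exp (GG S T ω) * htl S h₀ c (tgu δ j) ω with ha
  have ha0 : 0 < a := by positivity
  set Z := Zs S (tgu δ) (tpol S δ η c) (k₀, h₀) (j + 1) ω with hZdef
  have hQ : Qs S (tgu δ) (tpol S δ η c) (k₀, h₀) (j + 1) ω = tpol S δ η c (j + 1) Z ω := rfl
  rw [hQ]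
  set w := tpol S δ η c (j + 1) Z ω * Z.1 with hw
  have hη2 : 0 < 1 - η := by linarith
  have hr : 0 < (1 + S.R * δ)⁻¹ * (1 - η) := by positivity
  have hy : 0 < δ⁻¹ * I := by positivity
  have hw0 : 0 < w := lt_of_lt_of_le (by positivity) a2
  have c1 : Z.2 + S.ρ * w * δ ≤ (1 + η) * (a + S.ρ * I) := by
    have c1 : S.ρ * w * δ ≤ S.ρ * I := by
      rw [mul_assoc]
      refine mul_le_mul_of_nonneg_left ?_ hρ.le
      nlinarith
    have c2 : S.ρ * I ≤ (1 + η) * (S.ρ * I) := by nlinarith [mul_pos hρ b3]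
    linarith
  have hL : Lc S δ (tpol S δ η c (j + 1) Z ω) Z ≤ (vth (KK S) δ * (1 + η) ^ bb S * ((1 + S.R * δ)⁻¹ * (1 - η)) ^ (-sg S)) *
      ((sg S)⁻¹ * (δ * (a + S.ρ * I) ^ bb S * (δ⁻¹ * I) ^ (-sg S))) := by
    unfold Lc
    rw [← hw]
    have e1 : (Z.2 + S.ρ * w * δ) ^ bb S ≤ (1 + η) ^ bb S * (a + S.ρ * I) ^ bb S := by
      rw [← Real.mul_rpow (by linarith) (by positivity)]
      have := hZ.2
      exact Real.rpow_le_rpow (by positivity) c1 hb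
    have e2 : w ^ (-sg S) ≤ ((1 + S.R * δ)⁻¹ * (1 - η)) ^ (-sg S) * (δ⁻¹ * I) ^ (-sg S) := by
      rw [← Real.mul_rpow hr.le hy.le]
      exact Real.rpow_le_rpow_of_nonpos (by positivity) (by linarith) (by linarith)
    calc _ ≤ (sg S)⁻¹ * δ * vth (KK S) δ * ((1 + η) ^ bb S * (a + S.ρ * I) ^ bb S) * (((1 + S.R * δ)⁻¹ * (1 - η)) ^ (-sg S) * (δ⁻¹ * I) ^ (-sg S)) := by
          gcongr
      _ = _ := by ring
  have hB := block_lemma S.hγ₀ S.hγ₁ hρ ha0 hs (rfl : bb S = S.γ * sg S) hlt (g.int' (cont_mm S T ω) ht0 (ht0.trans hlt.le))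
    (by filter_upwards [g.pos' ht0] with u hu
        exact mul_pos hu (Real.exp_pos _))
  rw [← hIdef, hT, tgu_sub, ← hT] at hB
  have hosc : min ((1 - S.γ)⁻¹ ^ sg S) (((a + S.ρ * I) / a) ^ bb S) ≤ osc S h₀ c (tgu δ j) T ω := by
    unfold osc
    refine min_le_min le_rfl (Real.rpow_le_rpow (by positivity) ?_ hb)
    rw [div_le_div_iff₀ ha0 hhl]
    have := int_mm_le_h g ht0 hlt.le le_rfl
    have h2 : a + S.ρ * I ≤ Real.exp (GG S T ω) * htl S h₀ c T ω := by rw [ha]; linarith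
    calc _ ≤ Real.exp (GG S T ω) * htl S h₀ c T ω * htl S h₀ c (tgu δ j) ω := by gcongr
      _ = _ := by rw [ha]; ring
  have hosc0 : 0 ≤ osc S h₀ c (tgu δ j) T ω := by
    have := htl_pos g hh (ht0.trans hlt.le)
    have : 0 < 1 - S.γ := by have := S.hγ₁; linarith
    unfold osc; positivity
  have hX : ENNReal.ofReal (Real.exp (-S.θ * T)) * (ENNReal.ofReal (sg S)⁻¹ *
     ∫⁻ u in Set.Ioc (tgu δ j) T, ENNReal.ofReal ((a + S.ρ * ∫ v in tgu δ j..u, c v ω * mm S T v ω) ^ bb S * (c u ω * mm S T u ω) ^ (-sg S))) ≤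
     ∫⁻ u in Set.Ioc (tgu δ j) T, ENNReal.ofReal (Real.exp (KK S * TTn S u T ω)) * Xc S h₀ c u ω := by
    rw [← lintegral_const_mul' _ _ ENNReal.ofReal_ne_top, ← lintegral_const_mul' _ _ ENNReal.ofReal_ne_top]
    refine lintegral_mono_ae ?_
    filter_upwards [g.pos' ht0, ae_restrict_mem measurableSet_Ioc] with u hu hI
    have hu0 : 0 ≤ u := ht0.trans hI.1.le
    have hhu := htl_pos g hh hu0
    have hhe : hProc S h₀ c u ω = Real.exp (GG S u ω) * htl S h₀ c u ω := hProc_eq _ _ _ _ _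
    have hh0 : 0 < hProc S h₀ c u ω := by rw [hhe]; positivity
    unfold Xc
    rw [← ENNReal.ofReal_mul (by positivity), ← ENNReal.ofReal_mul (by positivity), ← ENNReal.ofReal_mul (by positivity)]
    apply ENNReal.ofReal_le_ofReal
    have d1 : a + S.ρ * ∫ v in tgu δ j..u, c v ω * mm S T v ω ≤ Real.exp (kap S * TTn S u T ω) * hProc S h₀ c u ω := by
      have := int_mm_le_h g ht0 hI.1.le hI.2
      have d2 : Real.exp (GG S T ω) ≤ Real.exp (kap S * TTn S u T ω) * Real.exp (GG S u ω) := by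
        rw [← Real.exp_add]; apply Real.exp_le_exp.mpr
        have := abs_le.mp (abs_GG_sub S hI.2 ω); linarith [this.2]
      have d3 := mul_le_mul_of_nonneg_right d2 hhu.le
      rw [hhe, ha]; linarith
    have d0 : 0 ≤ a + S.ρ * ∫ v in tgu δ j..u, c v ω * mm S T v ω := by
      have := g.int_nonneg (cont_mm S T ω) ht0 hI.1.le (fun u => (Real.exp_pos _).le)
      positivity
    have d4 : (a + S.ρ * ∫ v in tgu δ j..u, c v ω * mm S T v ω) ^ bb S * (c u ω * mm S T u ω) ^ (-sg S) ≤
        Real.exp (KK S * TTn S u T ω) * ((hProc S h₀ c u ω) ^ S.γ / c u ω) ^ (S.σ - 1) := by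
      have e1 := Real.rpow_le_rpow d0 d1 hb
      rw [Real.mul_rpow (Real.exp_pos _).le hh0.le, ← Real.exp_mul] at e1
      have e2 : (c u ω * mm S T u ω) ^ (-sg S) = c u ω ^ (-sg S) * Real.exp (sg S * (kap S * TTn S u T ω)) := by
        unfold mm
        rw [Real.mul_rpow hu.le (Real.exp_pos _).le, ← Real.exp_mul]; congr 2; ring
      have e3 : ((hProc S h₀ c u ω) ^ S.γ / c u ω) ^ (S.σ - 1) = hProc S h₀ c u ω ^ bb S * c u ω ^ (-sg S) := by
        rw [Real.div_rpow (by positivity) hu.le, ← Real.rpow_mul hh0.le, Real.rpow_neg hu.le]; rfl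
      have e4 : Real.exp (KK S * TTn S u T ω) = Real.exp (kap S * TTn S u T ω * bb S) * Real.exp (sg S * (kap S * TTn S u T ω)) := by
        rw [← Real.exp_add]; congr 1; unfold KK; ring
      rw [e2, e3, e4]
      calc _ ≤ (Real.exp (kap S * TTn S u T ω * bb S) * hProc S h₀ c u ω ^ bb S) * (c u ω ^ (-sg S) * Real.exp (sg S * (kap S * TTn S u T ω))) := by gcongr
        _ = _ := by ring
    have d5 : Real.exp (-S.θ * T) ≤ Real.exp (-S.θ * u) := by
      apply Real.exp_le_exp.mpr; nlinarith [S.hθ, hI.2]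
    have d6 : 0 ≤ (sg S)⁻¹ * ((a + S.ρ * ∫ v in tgu δ j..u, c v ω * mm S T v ω) ^ bb S * (c u ω * mm S T u ω) ^ (-sg S)) :=
      mul_nonneg (by positivity) (mul_nonneg (Real.rpow_nonneg d0 _) (Real.rpow_nonneg (mul_pos hu (Real.exp_pos _)).le _))
    calc _ ≤ Real.exp (-S.θ * u) * ((sg S)⁻¹ * (Real.exp (KK S * TTn S u T ω) * ((hProc S h₀ c u ω) ^ S.γ / c u ω) ^ (S.σ - 1))) := by gcongr
      _ = _ := by unfold sg; ring
  have hfin : ∫⁻ u in Set.Ioc (tgu δ j) T, ENNReal.ofReal (osc S h₀ c (tgu δ j) T ω * Real.exp (KK S * TTn S u T ω)) * Xc S h₀ c u ω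
      = ENNReal.ofReal (osc S h₀ c (tgu δ j) T ω) * ∫⁻ u in Set.Ioc (tgu δ j) T, ENNReal.ofReal (Real.exp (KK S * TTn S u T ω)) * Xc S h₀ c u ω := by
    rw [← lintegral_const_mul' _ _ ENNReal.ofReal_ne_top]
    refine lintegral_congr fun u => ?_
    rw [ENNReal.ofReal_mul hosc0, mul_assoc]
  rw [hfin]
  set M := vth (KK S) δ * (1 + η) ^ bb S * ((1 + S.R * δ)⁻¹ * (1 - η)) ^ (-sg S) with hM
  have hM0 : 0 ≤ M := by positivity
  calc _ ≤ ENNReal.ofReal (Real.exp (-S.θ * T)) * (ENNReal.ofReal M * (ENNReal.ofReal (sg S)⁻¹ * ENNReal.ofReal (δ * (a + S.ρ * I) ^ bb S * (δ⁻¹ * I) ^ (-sg S)))) := by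
        rw [← ENNReal.ofReal_mul (p := (sg S)⁻¹) (by positivity), ← ENNReal.ofReal_mul hM0]
        gcongr
    _ ≤ ENNReal.ofReal (Real.exp (-S.θ * T)) * (ENNReal.ofReal M * (ENNReal.ofReal (sg S)⁻¹ * (ENNReal.ofReal (osc S h₀ c (tgu δ j) T ω) *
        ∫⁻ u in Set.Ioc (tgu δ j) T, ENNReal.ofReal ((a + S.ρ * ∫ v in tgu δ j..u, c v ω * mm S T v ω) ^ bb S * (c u ω * mm S T u ω) ^ (-sg S))))) := by
        gcongr
        refine hB.trans ?_
        gcongr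
    _ = ENNReal.ofReal M * (ENNReal.ofReal (osc S h₀ c (tgu δ j) T ω) * (ENNReal.ofReal (Real.exp (-S.θ * T)) * (ENNReal.ofReal (sg S)⁻¹ *
     ∫⁻ u in Set.Ioc (tgu δ j) T, ENNReal.ofReal ((a + S.ρ * ∫ v in tgu δ j..u, c v ω * mm S T v ω) ^ bb S * (c u ω * mm S T u ω) ^ (-sg S))))) := by ring
    _ ≤ _ := by gcongr
end

section
lemma meas_intvl {Ω : Type*} {m : MeasurableSpace Ω} {f : ℝ → Ω → ℝ} (hf : Measurable (fun p : ℝ × Ω => f p.1 p.2)) (a : ℝ) :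
    Measurable (fun p : ℝ × Ω => ∫ s in a..p.1, f s p.2) := by
  unfold intervalIntegral
  have key : ∀ A : Set ((ℝ × Ω) × ℝ), MeasurableSet A →
      Measurable (fun p : ℝ × Ω => ∫ s, A.indicator (fun q => f q.2 q.1.2) (p, s)) := by
    intro A hA
    have h1 : Measurable (fun q : (ℝ × Ω) × ℝ => f q.2 q.1.2) :=
      hf.comp (measurable_snd.prodMk (measurable_snd.comp measurable_fst))
    exact ((h1.indicator hA).stronglyMeasurable.integral_prod_right').measurable
  refine Measurable.sub ?_ ?_
  · have := key {q | a < q.2 ∧ q.2 ≤ q.1.1} ((measurableSet_lt measurable_const measurable_snd).inter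
      (measurableSet_le measurable_snd (measurable_fst.comp measurable_fst)))
    convert this using 2 with p
    rw [← integral_indicator measurableSet_Ioc]
    rfl
  · have := key {q | q.1.1 < q.2 ∧ q.2 ≤ a} ((measurableSet_lt (measurable_fst.comp measurable_fst) measurable_snd).inter
      (measurableSet_le measurable_snd measurable_const))
    convert this using 2 with p
    rw [← integral_indicator measurableSet_Ioc]
    rfl

lemma gen_min {Ω : Type*} {m : MeasurableSpace Ω} (i : ℝ) : Measurable (fun p : ℝ × Ω => ((⟨min p.1 i, Set.mem_Iic.mpr (min_le_right _ _)⟩ : Set.Iic i), p.2)) :=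
  (Measurable.subtype_mk (measurable_fst.min measurable_const)).prodMk measurable_snd

lemma gen_W {Ω : Type*} {m : MeasurableSpace Ω} {U V : ℝ → Ω → ℝ} (h1 : ∀ ω, Continuous fun t => U t ω) (h2 : ∀ ω, Continuous fun t => V t ω)
    (a1 : ∀ u, Measurable (U u)) (a2 : ∀ u, Measurable (V u)) : Measurable (fun p : ℝ × Ω => (U p.1 p.2, V p.1 p.2)) :=
  (measurable_uncurry_of_continuous_of_measurable (u := U) h1 a1).prodMk
    (measurable_uncurry_of_continuous_of_measurable (u := V) h2 a2)

lemma gen_Y {Ω : Type*} {m : MeasurableSpace Ω} {c : ℝ × Ω → ℝ} {w : ℝ × Ω → ℝ × ℝ} {w' : Ω → ℝ × ℝ} (hc : Measurable c) (hw : Measurable w)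
    (hw' : Measurable w') (T κ a x y : ℝ) : Measurable (fun ω => x * (y * ∫ u in a..T, c (u, ω) *
      Real.exp (-(κ * (T - min u T + |(w' ω).1 - (w (u, ω)).1| + |(w' ω).2 - (w (u, ω)).2|))))) := by
  have hm : Measurable (fun p : ℝ × Ω => c (p.1, p.2) * Real.exp (-(κ * (T - min p.1 T + |(w' p.2).1 - (w (p.1, p.2)).1| + |(w' p.2).2 - (w (p.1, p.2)).2|)))) := by
    have : Measurable (fun p : ℝ × Ω => p.1) := measurable_fst
    refine Measurable.mul (by fun_prop) (Real.measurable_exp.comp (Measurable.neg (Measurable.const_mul ?_ _)))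
    exact ((measurable_const.sub (this.min measurable_const)).add ((hw'.comp measurable_snd).fst.sub hw.fst).abs).add ((hw'.comp measurable_snd).snd.sub hw.snd).abs
  exact (((meas_intvl (f := fun u ω => c (u, ω) *
      Real.exp (-(κ * (T - min u T + |(w' ω).1 - (w (u, ω)).1| + |(w' ω).2 - (w (u, ω)).2|)))) hm a).comp (measurable_const.prodMk measurable_id)).const_mul _).const_mul _

lemma gen_X {Ω : Type*} {m : MeasurableSpace Ω} {c : ℝ × Ω → ℝ} {w : ℝ × Ω → ℝ} {w' : Ω → ℝ} (hc : Measurable c) (hw : Measurable w) (hw' : Measurable w')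
    (u A b h ρ γ s θ : ℝ) : Measurable (fun ω => ENNReal.ofReal (s⁻¹ * ((Real.exp (A * u + b * w' ω) *
      (h + ρ * ∫ v in (0:ℝ)..u, c (v, ω) * Real.exp (-(A * min v u + b * w (v, ω))))) ^ γ / c (u, ω)) ^ s * Real.exp (-θ * u))) := by
  have hm : Measurable (fun p : ℝ × Ω => c (p.1, p.2) * Real.exp (-(A * min p.1 u + b * w (p.1, p.2)))) := by
    have : Measurable (fun p : ℝ × Ω => p.1) := measurable_fst
    fun_prop
  have h7 : Measurable (fun ω => ∫ v in (0:ℝ)..u, c (v, ω) * Real.exp (-(A * min v u + b * w (v, ω)))) :=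
    (meas_intvl (f := fun v ω => c (v, ω) * Real.exp (-(A * min v u + b * w (v, ω)))) hm 0).comp (measurable_const.prodMk measurable_id)
  have h8 : Measurable (fun ω => c (u, ω)) := hc.comp (measurable_const.prodMk measurable_id)
  fun_prop

lemma prog_min {S : Setting Ω} {c : ℝ → Ω → ℝ} (hc : ProgMeasurable S.F c) (i : ℝ) :
    Measurable[MeasurableSpace.prod inferInstance (S.F i)] (fun p : ℝ × Ω => c (min p.1 i) p.2) := by
  exact (hc i).measurable.comp (@gen_min Ω (S.F i) i)

lemma prog_joint {S : Setting Ω} {c : ℝ → Ω → ℝ} (hc : ProgMeasurable S.F c) : Measurable (fun p : ℝ × Ω => c p.1 p.2) := by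
  refine measurable_of_tendsto_metrizable (f := fun (n : ℕ) (p : ℝ × Ω) => c (min p.1 n) p.2) (fun n => ?_) ?_
  · exact (prog_min hc n).mono (sup_le_sup le_rfl (MeasurableSpace.comap_mono (S.F.le _))) le_rfl
  · rw [tendsto_pi_nhds]
    intro p
    refine tendsto_const_nhds.congr' ?_
    obtain ⟨n, hn⟩ := exists_nat_ge p.1
    filter_upwards [Filter.eventually_ge_atTop n] with k hk
    rw [min_eq_left (hn.trans (by exact_mod_cast hk))]

lemma meas_W_min {S : Setting Ω} (i : ℝ) :
    Measurable[MeasurableSpace.prod inferInstance (S.F i)] (fun p : ℝ × Ω => (S.W1 (min p.1 i) p.2, S.W2 (min p.1 i) p.2)) := by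
  have a1 : ∀ u, Measurable[S.F i] (S.W1 (min u i)) := fun u => (S.bm1.adapted _).mono (S.F.mono (min_le_right _ _)) le_rfl
  have a2 : ∀ u, Measurable[S.F i] (S.W2 (min u i)) := fun u => (S.bm2.adapted _).mono (S.F.mono (min_le_right _ _)) le_rfl
  exact @gen_W Ω (S.F i) _ _ (fun ω => (S.bm1.cont ω).comp (continuous_id.min continuous_const)) (fun ω => (S.bm2.cont ω).comp (continuous_id.min continuous_const)) a1 a2

lemma meas_W {S : Setting Ω} : Measurable (fun p : ℝ × Ω => (S.W1 p.1 p.2, S.W2 p.1 p.2)) := by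
  have a1 : ∀ u, Measurable (S.W1 u) := fun u => (S.bm1.adapted _).mono (S.F.le _) le_rfl
  have a2 : ∀ u, Measurable (S.W2 u) := fun u => (S.bm2.adapted _).mono (S.F.le _) le_rfl
  exact (measurable_uncurry_of_continuous_of_measurable (u := S.W1) S.bm1.cont a1).prodMk
    (measurable_uncurry_of_continuous_of_measurable (u := S.W2) S.bm2.cont a2)

lemma meas_Yv {S : Setting Ω} {c : ℝ → Ω → ℝ} (hc : ProgMeasurable S.F c) {δ : ℝ} (hδ : 0 < δ) (η : ℝ) (j : ℕ) :
    Measurable[S.F (tgu δ j)] (Yv S δ η c j) := by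
  rcases j with _ | j
  · exact measurable_const
  · set T := tgu δ (j + 1) with hT
    have h1 := prog_min hc T
    have h2 := meas_W_min (S := S) T
    have h3 : Measurable[S.F T] (fun ω => (S.W1 T ω, S.W2 T ω)) := (S.bm1.adapted T).prodMk (S.bm2.adapted T)
    have hlt : tgu δ j ≤ T := by rw [hT, tgu_succ]; linarith
    have e : ∀ ω, ∫ u in tgu δ j..T, c u ω * mm S T u ω = ∫ u in tgu δ j..T, c (min u T) ω * mm S T (min u T) ω := by
      intro ω
      refine intervalIntegral.integral_congr fun u hu => ?_
      rw [Set.uIcc_of_le hlt] at hu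
      simp only [min_eq_left hu.2]
    have e2 : Yv S δ η c (j + 1) = fun ω => (1 - η) * (δ⁻¹ * ∫ u in tgu δ j..T, c (min u T) ω * mm S T (min u T) ω) := by
      ext ω; rw [← e]; rfl
    rw [e2]
    exact @gen_Y Ω (S.F T) (fun p => c (min p.1 T) p.2) _ _ h1 h2 h3 T (kap S) (tgu δ j) (1 - η) δ⁻¹

lemma gen_pair {Ω : Type*} {m : MeasurableSpace Ω} {y : Ω → ℝ} (h : Measurable y) : Measurable (fun p : (ℝ × ℝ) × Ω => (p.1.1, y p.2)) :=
  (measurable_fst.comp measurable_fst).prodMk (h.comp measurable_snd)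

lemma pol_tpol {S : Setting Ω} {c : ℝ → Ω → ℝ} (hc : ProgMeasurable S.F c) {δ : ℝ} (hδ : 0 < δ) (η : ℝ) :
    Pol S (tgu δ) (tpol S δ η c) := by
  refine ⟨fun j => ?_, fun j z ω => ?_⟩
  · have h := meas_Yv hc hδ η j
    exact (measurable_from_top (f := act S δ)).comp ((measurable_idx S δ).comp (@gen_pair Ω (S.F (tgu δ j)) _ h))
  · rw [tgu_sub]; exact ⟨act_pos S hδ _, act_le S hδ _⟩

lemma meas_htl {S : Setting Ω} {c : ℝ → Ω → ℝ} (hc : ProgMeasurable S.F c) (h₀ : ℝ) : Measurable (fun p : ℝ × Ω => htl S h₀ c p.1 p.2) := by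
  unfold htl
  have h0 := prog_joint hc
  have := measurable_snd.comp (meas_W (S := S))
  simp only [Function.comp_def] at this
  have hm : Measurable (fun p : ℝ × Ω => c p.1 p.2 * Real.exp (-GG S p.1 p.2)) := by
    unfold GG; fun_prop
  exact ((meas_intvl (f := fun s ω => c s ω * Real.exp (-GG S s ω)) hm 0).const_mul _).const_add _

lemma meas_Xc {S : Setting Ω} {c : ℝ → Ω → ℝ} (hc : ProgMeasurable S.F c) (h₀ : ℝ) : Measurable (fun p : ℝ × Ω => Xc S h₀ c p.1 p.2) := by
  unfold Xc
  have h1 := prog_joint hc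
  have h2 := meas_htl hc h₀
  have h3 := measurable_snd.comp (meas_W (S := S))
  simp only [Function.comp_def] at h3
  have h4 : Measurable (fun p : ℝ × Ω => hProc S h₀ c p.1 p.2) := by
    have : (fun p : ℝ × Ω => hProc S h₀ c p.1 p.2) = fun p => Real.exp (GG S p.1 p.2) * htl S h₀ c p.1 p.2 := by
      ext p; exact hProc_eq _ _ _ _ _
    rw [this]
    unfold GG
    fun_prop
  fun_prop

lemma meas_Xc_F {S : Setting Ω} {c : ℝ → Ω → ℝ} (hc : ProgMeasurable S.F c) (h₀ : ℝ) {u : ℝ} (hu : 0 ≤ u) :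
    Measurable[S.F u] (Xc S h₀ c u) := by
  have h1 := prog_min hc u
  have h2 := meas_W_min (S := S) u
  have h3 : Measurable[S.F u] (S.W2 u) := S.bm2.adapted u
  have e : Xc S h₀ c u = fun ω => ENNReal.ofReal ((S.σ - 1)⁻¹ * ((Real.exp (GG S u ω) *
      (h₀ + S.ρ * ∫ s in (0:ℝ)..u, c (min s u) ω * Real.exp (-GG S (min s u) ω))) ^ S.γ / c (min u u) ω) ^ (S.σ - 1) * Real.exp (-S.θ * u)) := by
    ext ω
    unfold Xc
    rw [hProc_eq, min_self]
    have : ∫ s in (0:ℝ)..u, c s ω * Real.exp (-GG S s ω) = ∫ s in (0:ℝ)..u, c (min s u) ω * Real.exp (-GG S (min s u) ω) := by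
      refine intervalIntegral.integral_congr fun v hv => ?_
      rw [Set.uIcc_of_le hu] at hv
      simp only [min_eq_left hv.2]
    rw [this]
  rw [e]
  exact @gen_X Ω (S.F u) (fun p => c (min p.1 u) p.2) _ _ h1 (@measurable_snd ℝ ℝ _ _ |>.comp h2) h3 u (-S.ρ - S.β₂ ^ 2 / 2) S.β₂ h₀ S.ρ S.γ (S.σ - 1) S.θ
end

section
variable {S : Setting Ω} {k₀ h₀ : ℝ} {c : ℝ → Ω → ℝ} {ω : Ω}

lemma excess (S : Setting Ω) {u t δ : ℝ} (hu : 0 ≤ u) (hut : u ≤ t) (htd : t - u ≤ δ) (hδ : 0 < δ) (hδ1 : δ ≤ 1) {X : Ω → ℝ≥0∞}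
    (hX : Measurable[S.F u] X) :
    ∫⁻ ω, ENNReal.ofReal (Real.exp (KK S * TTn S u t ω) - 1) * X ω ∂S.P ≤ ENNReal.ofReal (vth (KK S) δ - 1) * ∫⁻ ω, X ω ∂S.P := by
  have hmt : Measurable (fun y : ℝ × ℝ => tt (t - u) y) := measurable_tt.comp (measurable_const.prodMk measurable_id)
  have h := one_step S hu hut X hX (fun p : ℝ≥0∞ × (ℝ × ℝ) => ENNReal.ofReal (Real.exp (KK S * tt (t - u) p.2) - 1) * p.1) (by
    have : Measurable (fun p : ℝ≥0∞ × (ℝ × ℝ) => tt (t - u) p.2) := hmt.comp measurable_snd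
    fun_prop)
  simp only at h
  have h' : ∫⁻ ω, ENNReal.ofReal (Real.exp (KK S * TTn S u t ω) - 1) * X ω ∂S.P = _ := h
  rw [h', ← lintegral_const_mul' _ _ ENNReal.ofReal_ne_top]
  refine lintegral_mono fun ω => ?_
  rw [lintegral_mul_const _ (by fun_prop)]
  refine mul_le_mul_left ?_ _
  have e1 : ∫⁻ y, ENNReal.ofReal (Real.exp (KK S * tt (t - u) y) - 1) ∂nu (t - u) + 1 ≤ ENNReal.ofReal (vth (KK S) δ) := by
    refine le_trans (le_of_eq ?_) (nu_exp_le (KK S) δ (t - u) (KK_nonneg S) (by linarith) htd hδ hδ1)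
    have e2 : (1:ℝ≥0∞) = ∫⁻ y, 1 ∂nu (t - u) := by unfold nu; simp
    rw [e2, ← lintegral_add_right _ measurable_const]
    refine lintegral_congr fun y => ?_
    rw [← ENNReal.ofReal_one, ← ENNReal.ofReal_add _ zero_le_one]
    · ring_nf
    · have := Real.one_le_exp (mul_nonneg (KK_nonneg S) (tt_nonneg (d := t - u) (by linarith) y)); linarith
  rw [ENNReal.ofReal_sub _ zero_le_one, ENNReal.ofReal_one]
  exact ENNReal.le_sub_of_add_le_right ENNReal.one_ne_top e1

lemma meas_TTn' (S : Setting Ω) (t : ℝ) : Measurable (fun p : Ω × ℝ => TTn S p.2 t p.1) := by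
  have h1 := (meas_W (S := S)).comp (measurable_swap (α := Ω) (β := ℝ))
  have h2 := measurable_W1 S t
  have h3 := measurable_W2 S t
  have h11 := measurable_fst.comp h1
  have h12 := measurable_snd.comp h1
  simp only [Function.comp_def, Prod.fst_swap, Prod.snd_swap] at h11 h12
  unfold TTn tt dW
  have q1 := ((h2.comp (measurable_fst (β := ℝ))).sub h11).abs
  have q2 := ((h3.comp (measurable_fst (β := ℝ))).sub h12).abs
  have q3 : Measurable (fun p : Ω × ℝ => t - p.2) := measurable_snd.const_sub t
  exact (q3.add q1).add q2

lemma KKm (S : Setting Ω) (t : ℝ) : Measurable (fun p : Ω × ℝ => ENNReal.ofReal (Real.exp (KK S * TTn S p.2 t p.1) - 1)) := by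
  have := meas_TTn' S t
  fun_prop

lemma blockB (hc : ProgMeasurable S.F c) {φ : Ω → ℝ} (hφ : Measurable φ) {M : ℝ} (hφM : ∀ ω, φ ω ≤ M)
    {a b δ : ℝ} (ha : 0 ≤ a) (hab : b - a ≤ δ) (hδ : 0 < δ) (hδ1 : δ ≤ 1) :
    ∫⁻ ω, (∫⁻ u in Set.Ioc a b, ENNReal.ofReal (φ ω * Real.exp (KK S * TTn S u b ω)) * Xc S h₀ c u ω) ∂S.P ≤
    (∫⁻ ω, (∫⁻ u in Set.Ioc a b, ENNReal.ofReal (φ ω) * Xc S h₀ c u ω) ∂S.P) +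
      ENNReal.ofReal M * (ENNReal.ofReal (vth (KK S) δ - 1) * ∫⁻ ω, (∫⁻ u in Set.Ioc a b, Xc S h₀ c u ω) ∂S.P) := by
  haveI := S.isProb
  have hX : Measurable (fun p : Ω × ℝ => Xc S h₀ c p.2 p.1) := by
    have hX := (meas_Xc hc h₀).comp (measurable_swap (α := Ω) (β := ℝ))
    simpa only [Function.comp_def, Prod.fst_swap, Prod.snd_swap] using hX
  have hN := (KKm S b).mul hX
  have m1 : Measurable (fun p : Ω × ℝ => ENNReal.ofReal (φ p.1) * Xc S h₀ c p.2 p.1) :=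
    ((hφ.comp measurable_fst).ennreal_ofReal).mul hX
  have swap : ∀ {g : Ω → ℝ → ℝ≥0∞}, Measurable (fun p : Ω × ℝ => g p.1 p.2) →
      ∫⁻ ω, (∫⁻ u in Set.Ioc a b, g ω u) ∂S.P = ∫⁻ u in Set.Ioc a b, ∫⁻ ω, g ω u ∂S.P := by
    intro g hg; exact lintegral_lintegral_swap hg.aemeasurable
  have step : ∫⁻ ω, (∫⁻ u in Set.Ioc a b, ENNReal.ofReal (Real.exp (KK S * TTn S u b ω) - 1) * Xc S h₀ c u ω) ∂S.P ≤
      ENNReal.ofReal (vth (KK S) δ - 1) * ∫⁻ ω, (∫⁻ u in Set.Ioc a b, Xc S h₀ c u ω) ∂S.P := by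
    rw [swap hN, swap hX, ← lintegral_const_mul' _ _ ENNReal.ofReal_ne_top]
    refine setLIntegral_mono' measurableSet_Ioc fun u hu => ?_
    have hu0 : 0 ≤ u := ha.trans hu.1.le
    exact excess S hu0 hu.2 (by linarith [hu.1]) hδ hδ1 (meas_Xc_F hc h₀ hu0)
  refine le_trans ?_ (add_le_add_right (mul_le_mul_right step _) _)
  rw [← lintegral_const_mul' _ _ ENNReal.ofReal_ne_top, ← lintegral_add_left m1.lintegral_prod_right']
  refine lintegral_mono fun ω => ?_
  have m2 : Measurable (fun u : ℝ => ENNReal.ofReal (φ ω) * Xc S h₀ c u ω) := by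
    have := m1.comp (measurable_prodMk_left (x := ω))
    simpa only [Function.comp_def] using this
  simp only
  rw [← lintegral_const_mul' _ _ ENNReal.ofReal_ne_top, ← lintegral_add_left m2]
  refine setLIntegral_mono' measurableSet_Ioc fun u hu => ?_
  rw [← mul_assoc, ← add_mul]
  refine mul_le_mul_left ?_ _
  have h1 : 1 ≤ Real.exp (KK S * TTn S u b ω) := Real.one_le_exp (mul_nonneg (KK_nonneg S) (TTn_nonneg S hu.2 ω))
  rcases le_or_gt (φ ω) 0 with h0 | h0
  · rw [ENNReal.ofReal_of_nonpos (mul_nonpos_of_nonpos_of_nonneg h0 (by linarith))]; exact zero_le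
  · have hM := hφM ω
    rw [← ENNReal.ofReal_mul (by linarith), ← ENNReal.ofReal_add h0.le (mul_nonneg (by linarith) (by linarith))]
    refine ENNReal.ofReal_le_ofReal ?_
    nlinarith [mul_nonneg (sub_nonneg.2 hM) (sub_nonneg.2 h1)]
end

section
variable {S : Setting Ω} {k₀ h₀ : ℝ} {c : ℝ → Ω → ℝ} {ω : Ω}

def fl (δ u : ℝ) : ℝ := ((⌈u / δ⌉ : ℝ) - 1) * δ

lemma fl_eq {δ u : ℝ} (hδ : 0 < δ) {j : ℕ} (hu : u ∈ Set.Ioc (tgu δ j) (tgu δ (j + 1))) : fl δ u = tgu δ j := by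
  have : ⌈u / δ⌉ = (j : ℤ) + 1 := by
    rw [Int.ceil_eq_iff]
    unfold tgu at hu
    have h1 := hu.1
    have h2 := hu.2
    push_cast at h1 h2 ⊢
    rw [lt_div_iff₀ hδ, div_le_iff₀ hδ]
    exact ⟨by linarith, h2⟩
  unfold fl tgu
  rw [this]; push_cast; ring

lemma fl_bd {δ u : ℝ} (hδ : 0 < δ) (hu : 0 < u) : 0 ≤ fl δ u ∧ fl δ u ≤ u ∧ u ≤ fl δ u + δ := by
  have h1 := Int.ceil_lt_add_one (u / δ)
  have h2 := Int.le_ceil (u / δ)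
  have h3 : (1:ℤ) ≤ ⌈u / δ⌉ := Int.one_le_ceil_iff.mpr (by positivity)
  have h3' : (1:ℝ) ≤ ⌈u / δ⌉ := by exact_mod_cast h3
  rw [div_le_iff₀ hδ] at h2
  have h4 : ((⌈u / δ⌉ : ℝ) - 1) * δ < u := by rw [← lt_div_iff₀ hδ]; linarith
  unfold fl
  exact ⟨mul_nonneg (by linarith) hδ.le, h4.le, by linarith⟩

lemma meas_osc (hc : ProgMeasurable S.F c) (δ : ℝ) :
    Measurable (fun p : Ω × ℝ => osc S h₀ c (fl δ p.2) (fl δ p.2 + δ) p.1) := by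
  have hf : Measurable (fun p : Ω × ℝ => fl δ p.2) := by
    unfold fl
    have : Measurable (fun p : Ω × ℝ => (⌈p.2 / δ⌉ : ℝ)) :=
      (measurable_from_top (f := fun n : ℤ => (n : ℝ))).comp (Int.measurable_ceil.comp (measurable_snd.div_const δ))
    fun_prop
  have h1 := (meas_htl hc h₀).comp (hf.prodMk measurable_fst)
  have h2 := (meas_htl hc h₀).comp ((hf.add_const δ).prodMk measurable_fst)
  simp only [Function.comp_def] at h1 h2
  unfold osc
  exact measurable_const.min ((h2.div h1).pow_const _)

lemma sum_blocks {δ : ℝ} (hδ : 0 < δ) (hδ1 : δ ≤ 1) {g : Ω → ℝ → ℝ≥0∞} (hg : Measurable (fun p : Ω × ℝ => g p.1 p.2)) :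
    ∑' j, ∫⁻ ω, (∫⁻ u in Set.Ioc (tgu δ j) (tgu δ (j + 1)), g ω u) ∂S.P = ∫⁻ ω, (∫⁻ u in Set.Ioi (0:ℝ), g ω u) ∂S.P := by
  rw [← lintegral_tsum fun j => (hg.lintegral_prod_right' (ν := volume.restrict (Set.Ioc (tgu δ j) (tgu δ (j + 1))))).aemeasurable]
  refine lintegral_congr fun ω => ?_
  have G := grid_tgu hδ hδ1
  have hU : Set.Ioi (0:ℝ) = ⋃ j, Set.Ioc (tgu δ j) (tgu δ (j + 1)) := by
    ext t
    simp only [Set.mem_Ioi, Set.mem_iUnion]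
    exact ⟨fun ht => G.exists_lt t ht, fun ⟨j, hj⟩ => (G.nonneg j).trans_lt hj.1⟩
  rw [hU, lintegral_iUnion (fun j => measurableSet_Ioc)]
  intro i j hij
  exact Set.disjoint_left.mpr fun t h h' => hij (G.uniq h h')

lemma swapm {α : Type*} [MeasurableSpace α] {f : ℝ → Ω → α} (h : Measurable (fun p : ℝ × Ω => f p.1 p.2)) : Measurable (fun p : Ω × ℝ => f p.2 p.1) := by
  have hX := h.comp (measurable_swap (α := Ω) (β := ℝ))
  simpa only [Function.comp_def, Prod.fst_swap, Prod.snd_swap] using hX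

lemma Jcost_eq : Jcost S k₀ h₀ c = ∫⁻ ω, (∫⁻ u in Set.Ioi (0:ℝ), Xc S h₀ c u ω) ∂S.P := rfl

set_option maxHeartbeats 1000000 in
lemma vbound (hk : 0 < k₀) (hh : 0 < h₀) (ha : IsAdmissible S k₀ h₀ c) {δ η : ℝ} (hδ : 0 < δ) (hδ1 : δ ≤ 1) (hη0 : 0 < η) (hη1 : η < 1)
    (he1 : S.R * δ ≤ η) (he2 : S.ρ * (S.R * k₀) * δ ≤ η * h₀) :
    vv S δ (k₀, h₀) ≤ ENNReal.ofReal (Lc S δ (act S δ 0) (k₀, h₀)) +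
      ENNReal.ofReal (vth (KK S) δ * (1 + η) ^ bb S * ((1 + S.R * δ)⁻¹ * (1 - η)) ^ (-sg S)) *
      ((∫⁻ ω, (∫⁻ u in Set.Ioi (0:ℝ), ENNReal.ofReal (osc S h₀ c (fl δ u) (fl δ u + δ) ω) * Xc S h₀ c u ω) ∂S.P) +
        ENNReal.ofReal ((1 - S.γ)⁻¹ ^ sg S) * (ENNReal.ofReal (vth (KK S) δ - 1) * Jcost S k₀ h₀ c)) := by
  haveI := S.isProb
  have hp := pol_tpol ha.prog hδ η
  refine (lower_policy hδ hδ1 hp (fun j z ω => ⟨_, rfl⟩) (k₀, h₀)).trans ?_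
  rw [tsum_eq_zero_add' ENNReal.summable]
  have hX : Measurable (fun p : Ω × ℝ => Xc S h₀ c p.2 p.1) := swapm (meas_Xc ha.prog h₀)
  have ho := (meas_osc (h₀ := h₀) ha.prog δ)
  refine add_le_add ?_ ?_
  · have h0 : ∀ ω, Qs S (tgu δ) (tpol S δ η c) (k₀, h₀) 0 ω = act S δ 0 := by
      intro ω
      unfold Qs tpol Zs Yv idx
      have : ¬ ∃ i, act S δ i * k₀ ≤ 0 := by
        rintro ⟨i, hi⟩
        have := mul_pos (act_pos S hδ i) hk
        linarith
      simp only [this, dite_false]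
    simp only [h0, tgu_zero, mul_zero, Real.exp_zero, ENNReal.ofReal_one, one_mul, Zs]
    simp
  · have step : ∀ j, ENNReal.ofReal (Real.exp (-S.θ * tgu δ (j + 1))) *
      ∫⁻ ω, ENNReal.ofReal (Lc S δ (Qs S (tgu δ) (tpol S δ η c) (k₀, h₀) (j + 1) ω) (Zs S (tgu δ) (tpol S δ η c) (k₀, h₀) (j + 1) ω)) ∂S.P ≤
      ENNReal.ofReal (vth (KK S) δ * (1 + η) ^ bb S * ((1 + S.R * δ)⁻¹ * (1 - η)) ^ (-sg S)) *
      ((∫⁻ ω, (∫⁻ u in Set.Ioc (tgu δ j) (tgu δ (j + 1)), ENNReal.ofReal (osc S h₀ c (fl δ u) (fl δ u + δ) ω) * Xc S h₀ c u ω) ∂S.P) +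
        ENNReal.ofReal ((1 - S.γ)⁻¹ ^ sg S) * (ENNReal.ofReal (vth (KK S) δ - 1) *
          ∫⁻ ω, (∫⁻ u in Set.Ioc (tgu δ j) (tgu δ (j + 1)), Xc S h₀ c u ω) ∂S.P)) := by
      intro j
      rw [← lintegral_const_mul' _ _ ENNReal.ofReal_ne_top]
      refine (lintegral_mono_ae (ha.good.mono fun ω g => track_cost hk hh g hδ hδ1 hη0 hη1 he1 he2 hp j)).trans ?_
      rw [lintegral_const_mul' _ _ ENNReal.ofReal_ne_top]
      refine mul_le_mul_right ?_ _
      have hφ : Measurable (osc S h₀ c (tgu δ j) (tgu δ (j + 1))) := by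
        have h1 := (meas_htl ha.prog h₀).comp (measurable_prodMk_left (x := tgu δ j))
        have h2 := (meas_htl ha.prog h₀).comp (measurable_prodMk_left (x := tgu δ (j + 1)))
        exact measurable_const.min ((h2.div h1).pow_const _)
      refine (blockB ha.prog hφ (fun ω => min_le_left _ _) (tgu_nonneg hδ j) (tgu_sub δ j).le hδ hδ1).trans (le_of_eq ?_)
      congr 1
      refine lintegral_congr fun ω => ?_
      refine setLIntegral_congr_fun measurableSet_Ioc fun u hu => ?_
      show _ = ENNReal.ofReal (osc S h₀ c (fl δ u) (fl δ u + δ) ω) * Xc S h₀ c u ω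
      rw [fl_eq hδ hu, tgu_succ]
    refine (ENNReal.tsum_le_tsum step).trans (le_of_eq ?_)
    rw [ENNReal.tsum_mul_left, ENNReal.tsum_add, ENNReal.tsum_mul_left, ENNReal.tsum_mul_left,
      sum_blocks hδ hδ1 (ho.ennreal_ofReal.mul hX), sum_blocks hδ hδ1 hX, Jcost_eq]
end

section
variable {S : Setting Ω} {k₀ h₀ : ℝ} {c : ℝ → Ω → ℝ} {ω : Ω}
open Filter Topology

def dn (n : ℕ) : ℝ := 1 / ((n : ℝ) + 1)
lemma dn_pos (n : ℕ) : 0 < dn n := Nat.one_div_pos_of_nat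
lemma dn_le (n : ℕ) : dn n ≤ 1 := by
  unfold dn; rw [div_le_one (by positivity)]; have : (0:ℝ) ≤ n := n.cast_nonneg
  linarith
lemma dn_tendsto : Tendsto dn atTop (𝓝 0) := tendsto_one_div_add_atTop_nhds_zero_nat

lemma osc_tendsto (hh : 0 < h₀) (g : Good S k₀ h₀ c ω) {u : ℝ} (hu : 0 < u) :
    Tendsto (fun n => osc S h₀ c (fl (dn n) u) (fl (dn n) u + dn n) ω) atTop (𝓝 1) := by
  have hE : Continuous fun u => Real.exp (-GG S u ω) := by have := cont_GG S ω; fun_prop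
  have hu2 : (0:ℝ) ≤ u + 2 := by linarith
  have hc : ContinuousOn (fun t => htl S h₀ c t ω) (Set.Icc 0 (u + 2)) := by
    have := intervalIntegral.continuousOn_primitive_interval' (g.int' hE le_rfl hu2) Set.left_mem_uIcc
    rw [Set.uIcc_of_le hu2] at this
    unfold htl; fun_prop
  have hcu : Tendsto (fun t => htl S h₀ c t ω) (𝓝 u) (𝓝 (htl S h₀ c u ω)) :=
    (hc.continuousAt (Icc_mem_nhds hu (by linarith)))
  have t1 : Tendsto (fun n => fl (dn n) u) atTop (𝓝 u) := by
    refine tendsto_of_tendsto_of_tendsto_of_le_of_le (by simpa using dn_tendsto.const_sub u) tendsto_const_nhds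
      (fun n => ?_) (fun n => ?_)
    · have := (fl_bd (dn_pos n) hu).2.2; simp only; linarith
    · exact (fl_bd (dn_pos n) hu).2.1
  have t2 : Tendsto (fun n => fl (dn n) u + dn n) atTop (𝓝 u) := by simpa using t1.add dn_tendsto
  have hp := htl_pos g hh hu.le
  have t3 := ((hcu.comp t2).div (hcu.comp t1) hp.ne')
  rw [div_self hp.ne'] at t3
  have t4 := (t3.rpow_const (p := bb S) (Or.inl one_ne_zero))
  rw [Real.one_rpow] at t4
  have t5 := (tendsto_const_nhds (x := (1 - S.γ)⁻¹ ^ sg S)).min t4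
  have : (1:ℝ) ≤ (1 - S.γ)⁻¹ ^ sg S := by
    refine Real.one_le_rpow ?_ (sg_pos S).le
    have := S.hγ₁; have := S.hγ₀
    exact (one_le_inv₀ (by linarith)).mpr (by linarith)
  rwa [min_eq_right this] at t5

set_option maxHeartbeats 1000000 in
lemma phi_tendsto (hh : 0 < h₀) (ha : IsAdmissible S k₀ h₀ c) (hJ : Jcost S k₀ h₀ c ≠ ∞) :
    Tendsto (fun n => ∫⁻ ω, (∫⁻ u in Set.Ioi (0:ℝ), ENNReal.ofReal (osc S h₀ c (fl (dn n) u) (fl (dn n) u + dn n) ω) * Xc S h₀ c u ω) ∂S.P)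
      atTop (𝓝 (Jcost S k₀ h₀ c)) := by
  haveI := S.isProb
  have hX : Measurable (fun p : Ω × ℝ => Xc S h₀ c p.2 p.1) := swapm (meas_Xc ha.prog h₀)
  have ho := fun n => (meas_osc (h₀ := h₀) ha.prog (dn n)).ennreal_ofReal.mul hX
  rw [Jcost_eq]
  set ν := S.P.prod (volume.restrict (Set.Ioi (0:ℝ))) with hν
  have e1 : ∀ n, ∫⁻ ω, (∫⁻ u in Set.Ioi (0:ℝ), ENNReal.ofReal (osc S h₀ c (fl (dn n) u) (fl (dn n) u + dn n) ω) * Xc S h₀ c u ω) ∂S.P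
    = ∫⁻ p, ENNReal.ofReal (osc S h₀ c (fl (dn n) p.2) (fl (dn n) p.2 + dn n) p.1) * Xc S h₀ c p.2 p.1 ∂ν :=
    fun n => (lintegral_prod _ (ho n).aemeasurable).symm
  have e2 : ∫⁻ ω, (∫⁻ u in Set.Ioi (0:ℝ), Xc S h₀ c u ω) ∂S.P = ∫⁻ p, Xc S h₀ c p.2 p.1 ∂ν := (lintegral_prod _ hX.aemeasurable).symm
  rw [Jcost_eq, e2] at hJ
  simp only [e1, e2]
  refine tendsto_lintegral_of_dominated_convergence (fun p => ENNReal.ofReal ((1 - S.γ)⁻¹ ^ sg S) * Xc S h₀ c p.2 p.1) ho ?_ ?_ ?_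
  · exact fun n => ae_of_all _ fun p => mul_le_mul_left (ENNReal.ofReal_le_ofReal (min_le_left _ _)) _
  · rw [lintegral_const_mul' _ _ ENNReal.ofReal_ne_top]
    exact ENNReal.mul_ne_top ENNReal.ofReal_ne_top hJ
  · have a1 : ∀ᵐ p ∂ν, Good S k₀ h₀ c p.1 := Measure.quasiMeasurePreserving_fst.ae ha.good
    have a2 : ∀ᵐ p ∂ν, p.2 ∈ Set.Ioi (0:ℝ) := Measure.quasiMeasurePreserving_snd.ae (ae_restrict_mem measurableSet_Ioi)
    filter_upwards [a1, a2] with p g hu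
    have := ENNReal.Tendsto.mul_const (b := Xc S h₀ c p.2 p.1) (ENNReal.tendsto_ofReal (osc_tendsto hh g hu)) (Or.inl (by simp))
    simpa using this

set_option maxHeartbeats 1000000 in
theorem limsup_vv (S : Setting Ω) (hk : 0 < k₀) (hh : 0 < h₀) : limsup (fun n => vv S (dn n) (k₀, h₀)) atTop ≤ Vcost S k₀ h₀ := by
  refine le_iInf fun ⟨c, ha⟩ => ?_
  by_cases hJ : Jcost S k₀ h₀ c = ∞
  · rw [hJ]; exact le_top
  have hR := S.hR; have hρ := S.hρ₀
  set A := S.R + S.ρ * S.R * k₀ / h₀ with hA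
  have hA0 : 0 < A := by positivity
  have hη : Tendsto (fun n => A * dn n) atTop (𝓝 0) := by simpa using dn_tendsto.const_mul A
  have hev : ∀ᶠ n in atTop, A * dn n < 1 := hη.eventually_lt_const one_pos
  refine (limsup_le_limsup (v := fun n => ENNReal.ofReal (Lc S (dn n) (act S (dn n) 0) (k₀, h₀)) +
      ENNReal.ofReal (vth (KK S) (dn n) * (1 + A * dn n) ^ bb S * ((1 + S.R * dn n)⁻¹ * (1 - A * dn n)) ^ (-sg S)) *
      ((∫⁻ ω, (∫⁻ u in Set.Ioi (0:ℝ), ENNReal.ofReal (osc S h₀ c (fl (dn n) u) (fl (dn n) u + dn n) ω) * Xc S h₀ c u ω) ∂S.P) +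
        ENNReal.ofReal ((1 - S.γ)⁻¹ ^ sg S) * (ENNReal.ofReal (vth (KK S) (dn n) - 1) * Jcost S k₀ h₀ c))) ?_).trans ?_
  · filter_upwards [hev] with n hn
    have hd := dn_pos n
    refine vbound hk hh ha hd (dn_le n) (by positivity) hn ?_ ?_
    · have : 0 < S.ρ * S.R * k₀ / h₀ := by positivity
      rw [hA]; nlinarith
    · have : A * dn n * h₀ = S.R * dn n * h₀ + S.ρ * (S.R * k₀) * dn n := by rw [hA]; field_simp
      have : 0 < S.R * dn n * h₀ := by positivity
      linarith
  · refine le_of_eq (Tendsto.limsup_eq ?_)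
    have hv : Tendsto (fun n => vth (KK S) (dn n)) atTop (𝓝 1) := by
      have := ((vth_cont (KK S)).tendsto 0).comp dn_tendsto
      rwa [vth_zero] at this
    have hr : Tendsto (fun n => 1 + S.R * dn n) atTop (𝓝 1) := by simpa using (dn_tendsto.const_mul S.R).const_add 1
    have hq : Tendsto (fun n => act S (dn n) 0) atTop (𝓝 S.R) := by
      have := ((hr.inv₀ one_ne_zero).pow 1).const_mul S.R
      simpa [act] using this
    have l1 : Tendsto (fun n => Lc S (dn n) (act S (dn n) 0) (k₀, h₀)) atTop (𝓝 0) := by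
      unfold Lc
      have a1 : Tendsto (fun n => (sg S)⁻¹ * dn n * vth (KK S) (dn n)) atTop (𝓝 0) := by
        simpa using (dn_tendsto.const_mul (sg S)⁻¹).mul hv
      have a2 : Tendsto (fun n => h₀ + S.ρ * (act S (dn n) 0 * k₀) * dn n) atTop (𝓝 h₀) := by
        simpa using (((hq.mul_const k₀).const_mul S.ρ).mul dn_tendsto).const_add h₀
      have a3 := a2.rpow_const (p := bb S) (Or.inl hh.ne')
      have a4 := (hq.mul_const k₀).rpow_const (p := -sg S) (Or.inl (by positivity))
      simpa using (a1.mul a3).mul a4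
    have l2 : Tendsto (fun n => vth (KK S) (dn n) * (1 + A * dn n) ^ bb S * ((1 + S.R * dn n)⁻¹ * (1 - A * dn n)) ^ (-sg S)) atTop (𝓝 1) := by
      have a1 : Tendsto (fun n => 1 + A * dn n) atTop (𝓝 1) := by simpa using hη.const_add 1
      have a2 : Tendsto (fun n => (1 + S.R * dn n)⁻¹ * (1 - A * dn n)) atTop (𝓝 1) := by
        simpa using (hr.inv₀ one_ne_zero).mul (hη.const_sub 1)
      simpa using (hv.mul (a1.rpow_const (p := bb S) (Or.inl one_ne_zero))).mul (a2.rpow_const (p := -sg S) (Or.inl one_ne_zero))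
    have l3 : Tendsto (fun n => ENNReal.ofReal (vth (KK S) (dn n) - 1)) atTop (𝓝 0) := by
      simpa using ENNReal.tendsto_ofReal (hv.sub_const 1)
    have l4 := ENNReal.Tendsto.const_mul (a := ENNReal.ofReal ((1 - S.γ)⁻¹ ^ sg S))
      (ENNReal.Tendsto.mul_const (b := Jcost S k₀ h₀ c) l3 (Or.inr hJ)) (Or.inr ENNReal.ofReal_ne_top)
    have l5 := (phi_tendsto hh ha hJ).add l4
    have l6 := (ENNReal.tendsto_ofReal l1).add (ENNReal.Tendsto.mul (ENNReal.tendsto_ofReal l2) (Or.inl (by simp)) l5 (Or.inr (by simp)))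
    simpa using l6
end

section
variable {S : Setting Ω}
open Filter Topology

lemma vv_exp (S : Setting Ω) {δ : ℝ} (hδ : 0 < δ) {k h a b t : ℝ} (hk : 0 < k) (hh : 0 < h) (ha : |a| ≤ t) (hb : |b| ≤ t) :
    vv S δ (k * Real.exp a, h * Real.exp b) ≤ ENNReal.ofReal (Real.exp ((sg S + bb S) * t)) * vv S δ (k, h) := by
  have ha' := abs_le.mp ha
  have hb' := abs_le.mp hb
  have := vv_scale S hδ k h (h * Real.exp b) (Real.exp (-a)) (Real.exp t) hk hh (by positivity) (by positivity) (by positivity)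
    (by rw [mul_comm]; gcongr; exact hb'.2) (by rw [← Real.exp_add]; exact Real.one_le_exp (by linarith [ha'.2]))
  rw [Real.exp_neg, div_inv_eq_mul] at this
  refine this.trans (mul_le_mul_left (ENNReal.ofReal_le_ofReal ?_) _)
  rw [← Real.exp_neg, ← Real.exp_mul, ← Real.exp_mul, ← Real.exp_add, Real.exp_le_exp]
  have := mul_le_mul_of_nonneg_right ha'.1 (sg_pos S).le
  nlinarith

lemma C_le_vv (S : Setting Ω) {δ : ℝ} (hδ : 0 < δ) (hδ1 : δ ≤ 1) {z : ℝ × ℝ} (h1 : 0 < z.1) (h2 : 0 < z.2) : Vcost S z.1 z.2 ≤ vv S δ z :=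
  (upper S hδ hδ1 hδ hδ1 ⟨act_pos S hδ _, act_le S hδ _⟩ h1 h2).trans (sel_spec S hδ z h1 h2)

lemma C_exp (S : Setting Ω) {k h a b t : ℝ} (hk : 0 < k) (hh : 0 < h) (ha : |a| ≤ t) (hb : |b| ≤ t) :
    Vcost S (k * Real.exp a) (h * Real.exp b) ≤ ENNReal.ofReal (Real.exp ((sg S + bb S) * t)) * Vcost S k h := by
  refine le_trans ?_ (mul_le_mul_right (limsup_vv S hk hh) _)
  rw [← ENNReal.limsup_const_mul_of_ne_top ENNReal.ofReal_ne_top]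
  refine le_limsup_of_frequently_le (Frequently.of_forall fun n => ?_)
  exact (C_le_vv S (dn_pos n) (dn_le n) (z := (k * Real.exp a, h * Real.exp b)) (by positivity) (by positivity)).trans (vv_exp S (dn_pos n) hk hh ha hb)

def Cr (S : Setting Ω) (w : ℝ × ℝ) : ℝ := (Vcost S w.1 w.2).toReal
lemma Cr_nonneg (w : ℝ × ℝ) : 0 ≤ Cr S w := ENNReal.toReal_nonneg

lemma Cr_exp (S : Setting Ω) {k h a b t : ℝ} (hk : 0 < k) (hh : 0 < h) (ha : |a| ≤ t) (hb : |b| ≤ t) :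
    Cr S (k * Real.exp a, h * Real.exp b) ≤ Real.exp ((sg S + bb S) * t) * Cr S (k, h) := by
  unfold Cr
  by_cases hC : Vcost S k h = ∞
  · have := C_exp S (k := k * Real.exp a) (h := h * Real.exp b) (a := -a) (b := -b) (t := t) (by positivity) (by positivity)
      (by rwa [abs_neg]) (by rwa [abs_neg])
    simp only [mul_assoc, ← Real.exp_add, add_neg_cancel, Real.exp_zero, mul_one, hC, top_le_iff] at this
    have h2 : Vcost S (k * Real.exp a) (h * Real.exp b) = ∞ := by
      by_contra h3
      exact ENNReal.mul_ne_top ENNReal.ofReal_ne_top h3 this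
    rw [hC, h2]; simp
  · have := ENNReal.toReal_mono (ENNReal.mul_ne_top ENNReal.ofReal_ne_top hC) (C_exp S hk hh ha hb)
    rwa [ENNReal.toReal_mul, ENNReal.toReal_ofReal (Real.exp_pos _).le] at this

lemma nxt_exp (S : Setting Ω) {d q k h : ℝ} (hd : 0 ≤ d) (hq : 0 < q) (hqd : q * d ≤ 1 / 2) (hk : 0 < k) (hh : 0 < h) (y : ℝ × ℝ) :
    ∃ a b, nxt S d q (k, h) y = (k * Real.exp a, h * Real.exp b) ∧ |a| ≤ (kap S + 2 * q + S.ρ * q * k / h) * tt d y ∧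
      |b| ≤ (kap S + 2 * q + S.ρ * q * k / h) * tt d y := by
  have hρ := S.hρ₀; have hβ1 := S.hβ₁; have hβ2 := S.hβ₂
  have hx : 0 ≤ q * d := by positivity
  have hx2 : 0 ≤ S.ρ * q * k / h * d := by positivity
  have hl1 : |Real.log (1 - q * d)| ≤ 2 * q * d := by
    have h1 := Real.one_sub_inv_le_log_of_pos (x := 1 - q * d) (by linarith)
    have h2 := Real.log_nonpos (x := 1 - q * d) (by linarith) (by linarith)
    have h3 : (1 - q * d)⁻¹ ≤ 1 + 2 * (q * d) := by
      rw [inv_le_iff_one_le_mul₀ (by linarith)]; nlinarith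
    rw [abs_of_nonpos h2]; linarith
  have hl2 : |Real.log (1 + S.ρ * q * k / h * d)| ≤ S.ρ * q * k / h * d := by
    have h2 := Real.log_nonneg (x := 1 + S.ρ * q * k / h * d) (by linarith)
    have h3 := Real.log_le_sub_one_of_pos (x := 1 + S.ρ * q * k / h * d) (by linarith)
    rw [abs_of_nonneg h2]; linarith
  have hp0 : 0 ≤ S.ρ * q * k / h := by positivity
  have ka := abs_nonneg (S.B - S.β₁ ^ 2 / 2)
  have y1 := abs_nonneg y.1
  have y2 := abs_nonneg y.2
  have hB2 : 0 ≤ S.ρ + S.β₂ ^ 2 / 2 := by positivity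
  refine ⟨(S.B - S.β₁ ^ 2 / 2) * d + S.β₁ * y.1 + Real.log (1 - q * d),
    (-S.ρ - S.β₂ ^ 2 / 2) * d + S.β₂ * y.2 + Real.log (1 + S.ρ * q * k / h * d), ?_, ?_, ?_⟩
  · rw [Real.exp_add, Real.exp_add (_ + _), Real.exp_log (by linarith), Real.exp_log (by linarith)]
    unfold nxt
    ext
    · simp only; ring
    · simp only; field_simp
  · refine (abs_add_three _ _ _).trans ?_
    rw [abs_mul, abs_mul, abs_of_nonneg hd, abs_of_pos hβ1]
    unfold kap tt
    generalize |S.B - S.β₁ ^ 2 / 2| = A at *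
    generalize S.ρ + S.β₂ ^ 2 / 2 = A2 at *
    generalize S.ρ * q * k / h = A3 at *
    generalize |y.1| = Y1 at *
    generalize |y.2| = Y2 at *
    have e : (A + S.β₁ + A2 + S.β₂ + 2 * q + A3) * (d + Y1 + Y2) = A * d + S.β₁ * Y1 + 2 * q * d +
      (A * (Y1 + Y2) + S.β₁ * (d + Y2) + A2 * (d + Y1 + Y2) + S.β₂ * (d + Y1 + Y2) + 2 * q * (Y1 + Y2) + A3 * (d + Y1 + Y2)) := by ring
    rw [e]
    have : 0 ≤ A * (Y1 + Y2) + S.β₁ * (d + Y2) + A2 * (d + Y1 + Y2) + S.β₂ * (d + Y1 + Y2) + 2 * q * (Y1 + Y2) + A3 * (d + Y1 + Y2) := by positivity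
    linarith
  · refine (abs_add_three _ _ _).trans ?_
    have e0 : |-S.ρ - S.β₂ ^ 2 / 2| = S.ρ + S.β₂ ^ 2 / 2 := by rw [← abs_neg, abs_of_nonneg] <;> linarith
    rw [abs_mul, abs_mul, abs_of_nonneg hd, abs_of_pos hβ2, e0]
    unfold kap tt
    generalize |S.B - S.β₁ ^ 2 / 2| = A at *
    generalize S.ρ + S.β₂ ^ 2 / 2 = A2 at *
    generalize S.ρ * q * k / h = A3 at *
    generalize |y.1| = Y1 at *
    generalize |y.2| = Y2 at *
    have e : (A + S.β₁ + A2 + S.β₂ + 2 * q + A3) * (d + Y1 + Y2) = A2 * d + S.β₂ * Y2 + A3 * d +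
      (A2 * (Y1 + Y2) + S.β₂ * (d + Y1) + A * (d + Y1 + Y2) + S.β₁ * (d + Y1 + Y2) + 2 * q * (d + Y1 + Y2) + A3 * (Y1 + Y2)) := by ring
    rw [e]
    have : 0 ≤ A2 * (Y1 + Y2) + S.β₂ * (d + Y1) + A * (d + Y1 + Y2) + S.β₁ * (d + Y1 + Y2) + 2 * q * (d + Y1 + Y2) + A3 * (Y1 + Y2) := by positivity
    linarith

set_option maxHeartbeats 1000000 in
lemma dppE (S : Setting Ω) {d q k h : ℝ} (hd : 0 < d) (hd1 : d ≤ 1) (hq : feas S d q) (hqd : q * d ≤ 1 / 2) (hk : 0 < k) (hh : 0 < h)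
    (hC : Vcost S k h ≠ ∞) : Vcost S k h ≤ TT S d q (fun w => Vcost S w.1 w.2) (k, h) := by
  set K' := (sg S + bb S) * (kap S + 2 * q + S.ρ * q * k / h) with hK'
  have hK0 : 0 ≤ K' := by
    have := sg_pos S; have := bb_nonneg S; have := kap_pos S; have := S.hρ₀; have := hq.1
    positivity
  have hev : ∀ᶠ n in atTop, vv S (dn n) (k, h) < Vcost S k h + 1 :=
    eventually_lt_of_limsup_lt ((limsup_vv S hk hh).trans_lt (ENNReal.lt_add_right hC one_ne_zero))
  obtain ⟨N, hN⟩ := eventually_atTop.mp hev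
  have hmt : Measurable (fun y : ℝ × ℝ => tt d y) := measurable_tt.comp (measurable_const.prodMk measurable_id)
  have hnx : Measurable (fun y => nxt S d q (k, h) y) := (measurable_nxt' S d q).comp (measurable_const.prodMk measurable_id)
  have key : limsup (fun n => ∫⁻ y, vv S (dn (n + N)) (nxt S d q (k, h) y) ∂nu d) atTop ≤
      ∫⁻ y, limsup (fun n => vv S (dn (n + N)) (nxt S d q (k, h) y)) atTop ∂nu d := by
    refine limsup_lintegral_le (fun y => (Vcost S k h + 1) * ENNReal.ofReal (Real.exp (K' * tt d y)))
      (fun n => (measurable_vv S _).comp hnx) (fun n => ae_of_all _ fun y => ?_) ?_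
    · obtain ⟨a, b, e, ha, hb⟩ := nxt_exp S hd.le hq.1 hqd hk hh y
      simp only [e]
      refine (vv_exp S (dn_pos _) hk hh ha hb).trans ?_
      rw [mul_comm, ← mul_assoc]
      exact mul_le_mul_left (hN (n + N) (by omega)).le _
    · rw [lintegral_const_mul' _ _ (ENNReal.add_ne_top.mpr ⟨hC, ENNReal.one_ne_top⟩)]
      exact ENNReal.mul_ne_top (ENNReal.add_ne_top.mpr ⟨hC, ENNReal.one_ne_top⟩)
        ((nu_exp_le K' d d hK0 hd.le le_rfl hd hd1).trans_lt ENNReal.ofReal_lt_top).ne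
  have key2 : limsup (fun n => ∫⁻ y, vv S (dn (n + N)) (nxt S d q (k, h) y) ∂nu d) atTop ≤
      ∫⁻ y, Vcost S (nxt S d q (k, h) y).1 (nxt S d q (k, h) y).2 ∂nu d := by
    refine key.trans (lintegral_mono fun y => ?_)
    have hp := nxt_pos S hd.le hq (z := (k, h)) hk hh y
    rw [limsup_nat_add (fun n => vv S (dn n) (nxt S d q (k, h) y)) N]
    exact limsup_vv S hp.1 hp.2
  unfold TT
  refine le_trans ?_ (add_le_add_right (mul_le_mul_right key2 _) _)
  rw [← ENNReal.limsup_const_mul_of_ne_top ENNReal.ofReal_ne_top]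
  refine ENNReal.le_of_forall_pos_le_add fun ε hε _ => ?_
  rw [add_assoc]
  have hε' : (0:ℝ≥0∞) < ε := by exact_mod_cast hε
  set L := limsup (fun n => ENNReal.ofReal (Real.exp (-S.θ * d)) * ∫⁻ y, vv S (dn (n + N)) (nxt S d q (k, h) y) ∂nu d) atTop with hL
  by_cases hLt : L = ∞
  · rw [hLt]; simp
  have : ∀ᶠ n in atTop, ENNReal.ofReal (Real.exp (-S.θ * d)) * ∫⁻ y, vv S (dn (n + N)) (nxt S d q (k, h) y) ∂nu d < L + ε :=
    eventually_lt_of_limsup_lt (ENNReal.lt_add_right hLt hε'.ne')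
  obtain ⟨n, hn⟩ := this.exists
  refine (upper S hd hd1 (dn_pos (n + N)) (dn_le _) hq (z := (k, h)) hk hh).trans ?_
  exact add_le_add_right hn.le _

lemma dppR (S : Setting Ω) {d q k h : ℝ} (hd : 0 < d) (hd1 : d ≤ 1) (hq : feas S d q) (hqd : q * d ≤ 1 / 2) (hk : 0 < k) (hh : 0 < h)
    {ub : ℝ × ℝ → ℝ} (hub : Integrable ub (nu d)) (hle : ∀ y, Cr S (nxt S d q (k, h) y) ≤ ub y) :
    Cr S (k, h) ≤ Lc S d q (k, h) + Real.exp (-S.θ * d) * ∫ y, ub y ∂nu d := by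
  have h0 : ∀ y, 0 ≤ ub y := fun y => (Cr_nonneg _).trans (hle y)
  have hL := Lc_nonneg S hd.le hq.1 (z := (k, h)) hk hh
  have hI : 0 ≤ ∫ y, ub y ∂nu d := integral_nonneg h0
  have hR : 0 ≤ Lc S d q (k, h) + Real.exp (-S.θ * d) * ∫ y, ub y ∂nu d := by positivity
  by_cases hC : Vcost S k h = ∞
  · unfold Cr; simp only [hC]; simpa using hR
  refine ENNReal.toReal_le_of_le_ofReal hR ?_
  refine (dppE S hd hd1 hq hqd hk hh hC).trans ?_
  unfold TT
  rw [ENNReal.ofReal_add hL (by positivity), ENNReal.ofReal_mul (Real.exp_pos _).le, ofReal_integral_eq_lintegral_ofReal hub (ae_of_all _ h0)]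
  refine add_le_add_right (mul_le_mul_right (lintegral_mono fun y => ?_) _) _
  have hfin : Vcost S (nxt S d q (k, h) y).1 (nxt S d q (k, h) y).2 ≠ ∞ := by
    obtain ⟨a, b, e, ha, hb⟩ := nxt_exp S hd.le hq.1 hqd hk hh y
    rw [e]
    exact ne_top_of_le_ne_top (ENNReal.mul_ne_top ENNReal.ofReal_ne_top hC) (C_exp S hk hh ha hb)
  simp only
  rw [← ENNReal.ofReal_toReal hfin]
  exact ENNReal.ofReal_le_ofReal (hle y)
end

section
open Filter Topology

lemma taylor_aux {ψ : ℝ × ℝ → ℝ} {z : ℝ × ℝ} (hψ : ContDiffAt ℝ 2 ψ z) {ε : ℝ} (hε : 0 < ε) :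
    ∃ r > 0, ∀ w, ‖w - z‖ < r →
      |ψ w - ψ z - fderiv ℝ ψ z (w - z) - (1 / 2) * fderiv ℝ (fderiv ℝ ψ) z (w - z) (w - z)| ≤ ε * ‖w - z‖ ^ 2 := by
  have hsym : IsSymmSndFDerivAt ℝ ψ z := hψ.isSymmSndFDerivAt (by simp)
  set A := fderiv ℝ (fderiv ℝ ψ) z with hA
  have hd2 : DifferentiableAt ℝ (fderiv ℝ ψ) z :=
    (hψ.fderiv_right (m := 1) (by norm_num)).differentiableAt (by norm_num)
  have hlo := hd2.hasFDerivAt.isLittleO.def hε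
  have hev : ∀ᶠ w in 𝓝 z, DifferentiableAt ℝ ψ w := by
    have := hψ.eventually (by simp)
    filter_upwards [this] with w hw using hw.differentiableAt (by norm_num)
  obtain ⟨r, hr, hball⟩ := Metric.eventually_nhds_iff_ball.mp (hlo.and hev)
  refine ⟨r, hr, fun w hw => ?_⟩
  let f : ℝ × ℝ → ℝ := fun w => ψ w - fderiv ℝ ψ z (w - z) - (1 / 2) * A (w - z) (w - z)
  have hconv : Convex ℝ (Metric.closedBall z ‖w - z‖) := convex_closedBall _ _
  have hder : ∀ x ∈ Metric.closedBall z ‖w - z‖,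
      HasFDerivWithinAt f (fderiv ℝ ψ x - fderiv ℝ ψ z - A (x - z)) (Metric.closedBall z ‖w - z‖) x := by
    intro x hx
    have hx' : x ∈ Metric.ball z r := Metric.mem_ball.mpr (lt_of_le_of_lt (Metric.mem_closedBall.mp hx) hw)
    have h1 := (hball x hx').2.hasFDerivAt
    have h0 : HasFDerivAt (fun x => x - z) (ContinuousLinearMap.id ℝ (ℝ × ℝ)) x := (hasFDerivAt_id x).sub_const z
    have h2 : HasFDerivAt (fun x => fderiv ℝ ψ z (x - z)) ((fderiv ℝ ψ z).comp (ContinuousLinearMap.id ℝ (ℝ × ℝ))) x :=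
      (fderiv ℝ ψ z).hasFDerivAt.comp x h0
    have h3 : HasFDerivAt (fun x => A (x - z)) (A.comp (ContinuousLinearMap.id ℝ (ℝ × ℝ))) x :=
      A.hasFDerivAt.comp x h0
    have h4 := (h3.clm_apply h0).const_mul (1 / 2 : ℝ)
    have h5 := ((h1.sub h2).sub h4).hasFDerivWithinAt (s := Metric.closedBall z ‖w - z‖)
    refine h5.congr_fderiv ?_
    ext v
    · have e := hsym (1, 0) (x - z)
      rw [← hA] at e
      simp at e ⊢; linarith
    · have e := hsym (0, 1) (x - z)
      rw [← hA] at e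
      simp at e ⊢; linarith
  have hb : ∀ x ∈ Metric.closedBall z ‖w - z‖, ‖fderiv ℝ ψ x - fderiv ℝ ψ z - A (x - z)‖ ≤ ε * ‖w - z‖ := by
    intro x hx
    have hx' : x ∈ Metric.ball z r := Metric.mem_ball.mpr (lt_of_le_of_lt (Metric.mem_closedBall.mp hx) hw)
    refine (hball x hx').1.trans ?_
    gcongr
    rw [← dist_eq_norm]; exact Metric.mem_closedBall.mp hx
  have := hconv.norm_image_sub_le_of_norm_hasFDerivWithin_le hder hb
    (Metric.mem_closedBall_self (norm_nonneg _)) (Metric.mem_closedBall.mpr (dist_eq_norm w z).le)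
  simp only [f, sub_self, map_zero, Real.norm_eq_abs] at this
  rw [sq, ← mul_assoc]
  convert this using 2
  simp; ring

lemma taylor2 {ψ : ℝ × ℝ → ℝ} {z : ℝ × ℝ} (hψ : ContDiffAt ℝ 2 ψ z) {ε : ℝ} (hε : 0 < ε) :
    ∃ r > 0, ∀ w : ℝ × ℝ, |w.1 - z.1| < r → |w.2 - z.2| < r →
      - (ψ w - ψ z) ≤ -pd1 ψ z * (w.1 - z.1) + -pd2 ψ z * (w.2 - z.2)
        + (-(1 / 2) * pd1 (pd1 ψ) z + ε) * (w.1 - z.1) ^ 2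
        + (-pd2 (pd1 ψ) z) * ((w.1 - z.1) * (w.2 - z.2))
        + (-(1 / 2) * pd2 (pd2 ψ) z + ε) * (w.2 - z.2) ^ 2 := by
  obtain ⟨r, hr, hb⟩ := taylor_aux hψ hε
  refine ⟨r, hr, fun w h1 h2 => ?_⟩
  have hn : ‖w - z‖ = max |w.1 - z.1| |w.2 - z.2| := by simp [Prod.norm_def]
  have hw := hb w (by rw [hn]; exact max_lt h1 h2)
  have hn2 : ‖w - z‖ ^ 2 ≤ (w.1 - z.1) ^ 2 + (w.2 - z.2) ^ 2 := by
    rw [hn]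
    rcases max_cases |w.1 - z.1| |w.2 - z.2| with h | h <;> rw [h.1, sq_abs] <;>
      nlinarith [sq_nonneg (w.1 - z.1), sq_nonneg (w.2 - z.2)]
  have hsym : IsSymmSndFDerivAt ℝ ψ z := hψ.isSymmSndFDerivAt (by simp)
  have hd2 : DifferentiableAt ℝ (fderiv ℝ ψ) z :=
    (hψ.fderiv_right (m := 1) (by norm_num)).differentiableAt (by norm_num)
  have hpd : ∀ u v : ℝ × ℝ, fderiv ℝ (fun w => fderiv ℝ ψ w u) z v = fderiv ℝ (fderiv ℝ ψ) z v u := by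
    intro u v
    have h := hd2.hasFDerivAt.clm_apply (hasFDerivAt_const u z)
    rw [h.fderiv]; simp
  have e11 : pd1 (pd1 ψ) z = fderiv ℝ (fderiv ℝ ψ) z (1, 0) (1, 0) := hpd _ _
  have e12 : pd2 (pd1 ψ) z = fderiv ℝ (fderiv ℝ ψ) z (0, 1) (1, 0) := hpd _ _
  have e22 : pd2 (pd2 ψ) z = fderiv ℝ (fderiv ℝ ψ) z (0, 1) (0, 1) := hpd _ _
  have es := hsym (1, 0) (0, 1)
  have ew : w - z = (w.1 - z.1) • ((1, 0) : ℝ × ℝ) + (w.2 - z.2) • ((0, 1) : ℝ × ℝ) := by ext <;> simp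
  have f1 : fderiv ℝ ψ z (w - z) = pd1 ψ z * (w.1 - z.1) + pd2 ψ z * (w.2 - z.2) := by
    rw [ew]; simp only [map_add, map_smul, smul_eq_mul, pd1, pd2]; ring
  have f2 : fderiv ℝ (fderiv ℝ ψ) z (w - z) (w - z) = pd1 (pd1 ψ) z * (w.1 - z.1) ^ 2
      + 2 * pd2 (pd1 ψ) z * ((w.1 - z.1) * (w.2 - z.2)) + pd2 (pd2 ψ) z * (w.2 - z.2) ^ 2 := by
    rw [ew, e11, e12, e22]
    simp only [map_add, map_smul, smul_eq_mul, _root_.add_apply, _root_.smul_apply, es]; ring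
  rw [f1, f2] at hw
  have := (abs_le.mp hw).1
  nlinarith [mul_le_mul_of_nonneg_left hn2 hε.le]
end

section
open Filter Topology

/-- Quadratic polynomial centred at `(k,h)`. -/
def qp (a0 p1 p2 q11 q12 q22 k h : ℝ) (w : ℝ × ℝ) : ℝ :=
  a0 + p1 * (w.1 - k) + p2 * (w.2 - h) + q11 * (w.1 - k) ^ 2 + q12 * ((w.1 - k) * (w.2 - h)) + q22 * (w.2 - h) ^ 2

lemma abs_exp_sub_one {a t : ℝ} (ha : |a| ≤ t) : |Real.exp a - 1| ≤ t * Real.exp t := by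
  have h := abs_le.mp ha
  have ht : 0 ≤ t := (abs_nonneg a).trans ha
  have e1 : Real.exp a ≤ Real.exp t := Real.exp_le_exp.mpr h.2
  have e2 := Real.add_one_le_exp a
  have e3 := Real.add_one_le_exp (-t)
  have e4 : Real.exp t * Real.exp (-t) = 1 := by rw [← Real.exp_add]; simp
  have e5 : 1 ≤ Real.exp t := Real.one_le_exp ht
  rw [abs_le]; constructor
  · nlinarith
  · nlinarith [Real.exp_pos t]

lemma lin_aux (c c0 e x1 x2 x3 x4 x5 P1 P2 Q1 Q2 Q3 X Y : ℝ) (A B : ℝ) (h0 : c ≤ e * c0) (h1 : -x1 ≤ P1 * X) (h2 : -x2 ≤ P2 * X)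
    (h3 : -x3 ≤ Q1 * Y) (h4 : -x4 ≤ Q2 * Y) (h5 : -x5 ≤ Q3 * Y) (h6 : (P1 + P2) * X ≤ A) (h7 : (Q1 + Q2 + Q3) * Y ≤ B) (h8 : 0 ≤ c0) :
    c ≤ c0 + x1 + x2 + x3 + x4 + x5 + (e * c0 + A + B) := by
  linear_combination h0 + h1 + h2 + h3 + h4 + h5 + h6 + h7 + h8

set_option maxHeartbeats 1000000 in
lemma ubound (S : Setting Ω) {q k h : ℝ} (hq : 0 < q) (hk : 0 < k) (hh : 0 < h) (p1 p2 q11 q12 q22 : ℝ) {r : ℝ} (hr : 0 < r)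
    (hnear : ∀ w : ℝ × ℝ, 0 < w.1 → 0 < w.2 → |w.1 - k| < r → |w.2 - h| < r → Cr S w ≤ qp (Cr S (k, h)) p1 p2 q11 q12 q22 k h w) :
    ∃ Λ K : ℝ, 0 ≤ Λ ∧ 0 ≤ K ∧ ∀ d, 0 ≤ d → q * d ≤ 1 / 2 → ∀ y,
      Cr S (nxt S d q (k, h) y) ≤ qp (Cr S (k, h)) p1 p2 q11 q12 q22 k h (nxt S d q (k, h) y)
        + Λ * ((tt d y) ^ 4 * Real.exp (K * tt d y)) := by
  obtain ⟨κ, hκ⟩ : ∃ x, x = kap S + 2 * q + S.ρ * q * k / h := ⟨_, rfl⟩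
  have hκ0 : 0 ≤ κ := by have := kap_pos S; have := S.hρ₀; rw [hκ]; positivity
  obtain ⟨m, hm⟩ : ∃ x, x = k + h := ⟨_, rfl⟩
  have hm0 : 0 < m := by rw [hm]; positivity
  obtain ⟨M, hM⟩ : ∃ x, x = Cr S (k, h) + (|p1| + |p2|) * m + (|q11| + |q12| + |q22|) * m ^ 2 := ⟨_, rfl⟩
  have hC0 := Cr_nonneg (S := S) (k, h)
  have hM0 : 0 ≤ M := by rw [hM]; positivity
  obtain ⟨K0, hK0⟩ : ∃ x, x = sg S + bb S + 4 := ⟨_, rfl⟩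
  have hs := sg_pos S
  have hb := bb_nonneg S
  refine ⟨M * (m / r) ^ 4 * κ ^ 4, (K0 + 4) * κ, by positivity, by rw [hK0]; positivity, fun d hd hqd y => ?_⟩
  obtain ⟨a, b, e, ha, hb'⟩ := nxt_exp S hd hq hqd hk hh y
  rw [← hκ] at ha hb'
  have hT := tt_nonneg hd y
  rw [e]
  obtain ⟨t, ht⟩ : ∃ x, x = κ * tt d y := ⟨_, rfl⟩
  rw [← ht] at ha hb'
  have ht0 : 0 ≤ t := by rw [ht]; positivity
  obtain ⟨w, hw⟩ : ∃ x : ℝ × ℝ, x = (k * Real.exp a, h * Real.exp b) := ⟨_, rfl⟩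
  rw [← hw]
  have hE : 1 ≤ Real.exp t := Real.one_le_exp ht0
  have h1 : |w.1 - k| ≤ m * (t * Real.exp t) := by
    have : w.1 - k = k * (Real.exp a - 1) := by simp only [hw]; ring
    rw [this, abs_mul, abs_of_pos hk]
    exact mul_le_mul (by linarith) (abs_exp_sub_one ha) (abs_nonneg _) hm0.le
  have h2 : |w.2 - h| ≤ m * (t * Real.exp t) := by
    have : w.2 - h = h * (Real.exp b - 1) := by simp only [hw]; ring
    rw [this, abs_mul, abs_of_pos hh]
    exact mul_le_mul (by linarith) (abs_exp_sub_one hb') (abs_nonneg _) hm0.le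
  by_cases hn : |w.1 - k| < r ∧ |w.2 - h| < r
  · have := hnear w (by simp only [hw]; positivity) (by simp only [hw]; positivity) hn.1 hn.2
    have h0 : 0 ≤ M * (m / r) ^ 4 * κ ^ 4 * (tt d y ^ 4 * Real.exp ((K0 + 4) * κ * tt d y)) := by positivity
    linarith
  have hfar : r ≤ m * (t * Real.exp t) := by
    by_contra hc
    push Not at hc
    exact hn ⟨h1.trans_lt hc, h2.trans_lt hc⟩
  have hone : 1 ≤ (m / r * (t * Real.exp t)) ^ 4 := by
    refine one_le_pow₀ ?_
    rw [div_mul_eq_mul_div, le_div_iff₀ hr]; linarith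
  have htE : t ≤ Real.exp t := by have := Real.add_one_le_exp t; linarith
  have hX : m * (t * Real.exp t) ≤ m * Real.exp (2 * t) := by
    have : Real.exp (2 * t) = Real.exp t * Real.exp t := by rw [← Real.exp_add]; ring_nf
    rw [this]; gcongr
  obtain ⟨X, hXd⟩ : ∃ x, x = m * Real.exp (2 * t) := ⟨_, rfl⟩
  rw [← hXd] at hX
  have g1 := h1.trans hX
  have g2 := h2.trans hX
  have hX0 : 0 ≤ X := by rw [hXd]; positivity
  have e4 : Real.exp (2 * t) ≤ Real.exp (K0 * t) := Real.exp_le_exp.mpr (mul_le_mul_of_nonneg_right (by linarith) ht0)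
  have e5 : Real.exp (2 * t) ^ 2 ≤ Real.exp (K0 * t) := by
    rw [← Real.exp_nat_mul]; exact Real.exp_le_exp.mpr (by push_cast; rw [← mul_assoc]; exact mul_le_mul_of_nonneg_right (by linarith) ht0)
  have e6 : Real.exp ((sg S + bb S) * t) ≤ Real.exp (K0 * t) := Real.exp_le_exp.mpr (mul_le_mul_of_nonneg_right (by linarith) ht0)
  have hc : Cr S w ≤ Real.exp ((sg S + bb S) * t) * Cr S (k, h) := hw ▸ Cr_exp S hk hh ha hb'
  have neg : ∀ c x Y : ℝ, |x| ≤ Y → -(c * x) ≤ |c| * Y := fun c x Y hx =>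
    (neg_le_abs _).trans (by rw [abs_mul]; gcongr)
  have n1 := neg p1 _ _ g1
  have n2 := neg p2 _ _ g2
  have n3 := neg q11 ((w.1 - k) ^ 2) (X ^ 2) (by rw [abs_pow]; gcongr)
  have n4 := neg q12 ((w.1 - k) * (w.2 - h)) (X ^ 2) (by rw [abs_mul, sq]; gcongr)
  have n5 := neg q22 ((w.2 - h) ^ 2) (X ^ 2) (by rw [abs_pow]; gcongr)
  have b1 : X ≤ m * Real.exp (K0 * t) := by rw [hXd]; gcongr
  have b2 : X ^ 2 ≤ m ^ 2 * Real.exp (K0 * t) := by rw [hXd, mul_pow]; gcongr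
  have hmain : Cr S w ≤ qp (Cr S (k, h)) p1 p2 q11 q12 q22 k h w + M * Real.exp (K0 * t) := by
    have c1 : (|p1| + |p2|) * X ≤ (|p1| + |p2|) * (m * Real.exp (K0 * t)) := by gcongr
    have c2 : (|q11| + |q12| + |q22|) * X ^ 2 ≤ (|q11| + |q12| + |q22|) * (m ^ 2 * Real.exp (K0 * t)) := by gcongr
    have c3 : Real.exp ((sg S + bb S) * t) * Cr S (k, h) ≤ Real.exp (K0 * t) * Cr S (k, h) := by gcongr
    unfold qp
    have hMe : M * Real.exp (K0 * t) = Real.exp (K0 * t) * Cr S (k, h) + (|p1| + |p2|) * (m * Real.exp (K0 * t))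
        + (|q11| + |q12| + |q22|) * (m ^ 2 * Real.exp (K0 * t)) := by rw [hM]; ring
    have c6 := hc.trans c3
    rw [hMe]
    exact lin_aux _ _ _ _ _ _ _ _ _ _ _ _ _ _ _ _ _ c6 n1 n2 n3 n4 n5 c1 c2 hC0
  refine hmain.trans ?_
  refine add_le_add_right ?_ _
  have : M * Real.exp (K0 * t) * 1 ≤ M * Real.exp (K0 * t) * (m / r * (t * Real.exp t)) ^ 4 := by gcongr
  rw [mul_one] at this
  refine this.trans (le_of_eq ?_)
  have ee : Real.exp ((K0 + 4) * κ * tt d y) = Real.exp (K0 * t) * Real.exp t ^ 4 := by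
    rw [← Real.exp_nat_mul, ← Real.exp_add, ht]; push_cast; ring_nf
  rw [ee, ht]; ring
end

section
open Filter Topology

lemma nu_int_exp (a b : ℝ) {d : ℝ} (hd : 0 ≤ d) :
    Integrable (fun y : ℝ × ℝ => Real.exp (a * y.1 + b * y.2)) (nu d) ∧
      ∫ y, Real.exp (a * y.1 + b * y.2) ∂nu d = Real.exp ((a ^ 2 + b ^ 2) * d / 2) := by
  have g : ∀ c : ℝ, ∫ x, Real.exp (c * x) ∂gaussianReal 0 d.toNNReal = Real.exp (c ^ 2 * d / 2) := by
    intro c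
    have := congrFun (mgf_id_gaussianReal (μ := 0) (v := d.toNNReal)) c
    simp only [mgf, id] at this
    rw [this, Real.coe_toNNReal _ hd]; ring_nf
  have i : ∀ c : ℝ, Integrable (fun x => Real.exp (c * x)) (gaussianReal 0 d.toNNReal) := fun c => integrable_exp_mul_gaussianReal c
  have e : (fun y : ℝ × ℝ => Real.exp (a * y.1 + b * y.2)) = fun y => Real.exp (a * y.1) * Real.exp (b * y.2) := by
    ext y; rw [Real.exp_add]
  rw [e]; unfold nu
  refine ⟨(i a).mul_prod (i b), ?_⟩
  rw [integral_prod_mul (fun x => Real.exp (a * x)) (fun x => Real.exp (b * x)), g, g, ← Real.exp_add]; ring_nf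

/-- Expected quadratic polynomial after one step. -/
def EP (S : Setting Ω) (a0 p1 p2 q11 q12 q22 k h q d : ℝ) : ℝ :=
  (a0 - p1 * k - p2 * h + q11 * k ^ 2 + q12 * (k * h) + q22 * h ^ 2)
    + (p1 - 2 * q11 * k - q12 * h) * ((k - q * k * d) * Real.exp (S.B * d))
    + (p2 - 2 * q22 * h - q12 * k) * ((h + S.ρ * (q * k) * d) * Real.exp (-S.ρ * d))
    + q11 * ((k - q * k * d) ^ 2 * Real.exp ((2 * S.B + S.β₁ ^ 2) * d))
    + q12 * (((k - q * k * d) * (h + S.ρ * (q * k) * d)) * Real.exp ((S.B - S.ρ) * d))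
    + q22 * ((h + S.ρ * (q * k) * d) ^ 2 * Real.exp ((-2 * S.ρ + S.β₂ ^ 2) * d))

lemma EP_int (S : Setting Ω) (a0 p1 p2 q11 q12 q22 k h q : ℝ) {d : ℝ} (hd : 0 ≤ d) :
    Integrable (fun y => qp a0 p1 p2 q11 q12 q22 k h (nxt S d q (k, h) y)) (nu d) ∧
      ∫ y, qp a0 p1 p2 q11 q12 q22 k h (nxt S d q (k, h) y) ∂nu d = EP S a0 p1 p2 q11 q12 q22 k h q d := by
  have hm : ∀ u v A a b c : ℝ, Integrable (fun y : ℝ × ℝ => u * (A * Real.exp c * Real.exp (a * y.1 + b * y.2))) (nu d) ∧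
      ∫ y : ℝ × ℝ, u * (A * Real.exp c * Real.exp (a * y.1 + b * y.2)) ∂nu d = u * (A * Real.exp (c + (a ^ 2 + b ^ 2) * d / 2)) := by
    intro u v A a b c
    refine ⟨((nu_int_exp a b hd).1.const_mul _).const_mul _, ?_⟩
    rw [integral_const_mul, integral_const_mul, (nu_int_exp a b hd).2, Real.exp_add]; ring
  set C := a0 - p1 * k - p2 * h + q11 * k ^ 2 + q12 * (k * h) + q22 * h ^ 2 with hC
  set U := k - q * k * d
  set W := h + S.ρ * (q * k) * d
  set α := (S.B - S.β₁ ^ 2 / 2) * d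
  set δ := (-S.ρ - S.β₂ ^ 2 / 2) * d
  obtain ⟨i1, j1⟩ := hm (p1 - 2 * q11 * k - q12 * h) 0 U S.β₁ 0 α
  obtain ⟨i2, j2⟩ := hm (p2 - 2 * q22 * h - q12 * k) 0 W 0 S.β₂ δ
  obtain ⟨i3, j3⟩ := hm q11 0 (U ^ 2) (2 * S.β₁) 0 (2 * α)
  obtain ⟨i4, j4⟩ := hm q12 0 (U * W) S.β₁ S.β₂ (α + δ)
  obtain ⟨i5, j5⟩ := hm q22 0 (W ^ 2) 0 (2 * S.β₂) (2 * δ)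
  have e : (fun y => qp a0 p1 p2 q11 q12 q22 k h (nxt S d q (k, h) y)) = fun y : ℝ × ℝ =>
      C + (p1 - 2 * q11 * k - q12 * h) * (U * Real.exp α * Real.exp (S.β₁ * y.1 + 0 * y.2))
      + (p2 - 2 * q22 * h - q12 * k) * (W * Real.exp δ * Real.exp (0 * y.1 + S.β₂ * y.2))
      + q11 * (U ^ 2 * Real.exp (2 * α) * Real.exp (2 * S.β₁ * y.1 + 0 * y.2))
      + q12 * (U * W * Real.exp (α + δ) * Real.exp (S.β₁ * y.1 + S.β₂ * y.2))
      + q22 * (W ^ 2 * Real.exp (2 * δ) * Real.exp (0 * y.1 + 2 * S.β₂ * y.2)) := by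
    ext y
    have x1 : Real.exp (2 * S.β₁ * y.1) = Real.exp (S.β₁ * y.1) ^ 2 := by rw [← Real.exp_nat_mul]; push_cast; ring_nf
    have x2 : Real.exp (2 * S.β₂ * y.2) = Real.exp (S.β₂ * y.2) ^ 2 := by rw [← Real.exp_nat_mul]; push_cast; ring_nf
    have x3 : Real.exp (2 * α) = Real.exp α ^ 2 := by rw [← Real.exp_nat_mul]; push_cast; ring_nf
    have x4 : Real.exp (2 * δ) = Real.exp δ ^ 2 := by rw [← Real.exp_nat_mul]; push_cast; ring_nf
    have hn : nxt S d q (k, h) y = (Real.exp (α + S.β₁ * y.1) * U, Real.exp (δ + S.β₂ * y.2) * W) := rfl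
    rw [hn]
    simp only [qp, zero_mul, add_zero, zero_add, Real.exp_add, x1, x2, x3, x4, hC]
    ring
  rw [e]
  have c0 : Integrable (fun _ : ℝ × ℝ => C) (nu d) := integrable_const _
  have I1 := c0.fun_add i1
  have I2 := I1.fun_add i2
  have I3 := I2.fun_add i3
  have I4 := I3.fun_add i4
  refine ⟨I4.fun_add i5, ?_⟩
  rw [integral_add I4 i5, integral_add I3 i4, integral_add I2 i3, integral_add I1 i2, integral_add c0 i1, j1, j2, j3, j4, j5]
  simp only [integral_const, probReal_univ, one_smul]
  have y1 : α + (S.β₁ ^ 2 + 0 ^ 2) * d / 2 = S.B * d := by simp only [α]; ring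
  have y2 : δ + (0 ^ 2 + S.β₂ ^ 2) * d / 2 = -S.ρ * d := by simp only [δ]; ring
  have y3 : 2 * α + ((2 * S.β₁) ^ 2 + 0 ^ 2) * d / 2 = (2 * S.B + S.β₁ ^ 2) * d := by simp only [α]; ring
  have y4 : α + δ + (S.β₁ ^ 2 + S.β₂ ^ 2) * d / 2 = (S.B - S.ρ) * d := by simp only [α, δ]; ring
  have y5 : 2 * δ + (0 ^ 2 + (2 * S.β₂) ^ 2) * d / 2 = (-2 * S.ρ + S.β₂ ^ 2) * d := by simp only [δ]; ring
  rw [y1, y2, y3, y4, y5]; rfl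

lemma EP_zero (S : Setting Ω) (a0 p1 p2 q11 q12 q22 k h q : ℝ) : EP S a0 p1 p2 q11 q12 q22 k h q 0 = a0 := by
  simp [EP]; ring

lemma EP_deriv (S : Setting Ω) (a0 p1 p2 q11 q12 q22 k h q : ℝ) :
    HasDerivAt (EP S a0 p1 p2 q11 q12 q22 k h q)
      (p1 * (S.B * k - q * k) + p2 * (S.ρ * (q * k) - S.ρ * h) + q11 * S.β₁ ^ 2 * k ^ 2 + q22 * S.β₂ ^ 2 * h ^ 2) 0 := by
  have hu : HasDerivAt (fun d : ℝ => k - q * k * d) (-(q * k)) 0 := by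
    simpa using ((hasDerivAt_id (0:ℝ)).const_mul (q * k)).const_sub k
  have hw : HasDerivAt (fun d : ℝ => h + S.ρ * (q * k) * d) (S.ρ * (q * k)) 0 := by
    simpa using ((hasDerivAt_id (0:ℝ)).const_mul (S.ρ * (q * k))).const_add h
  have he : ∀ c : ℝ, HasDerivAt (fun d : ℝ => Real.exp (c * d)) c 0 := by
    intro c
    simpa using ((hasDerivAt_id (0:ℝ)).const_mul c).exp
  have H := ((((((hu.fun_mul (he S.B)).const_mul (p1 - 2 * q11 * k - q12 * h)).const_add
    (a0 - p1 * k - p2 * h + q11 * k ^ 2 + q12 * (k * h) + q22 * h ^ 2)).fun_add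
    ((hw.fun_mul (he (-S.ρ))).const_mul (p2 - 2 * q22 * h - q12 * k))).fun_add
    (((hu.fun_pow 2).fun_mul (he (2 * S.B + S.β₁ ^ 2))).const_mul q11)).fun_add
    (((hu.fun_mul hw).fun_mul (he (S.B - S.ρ))).const_mul q12)).fun_add
    (((hw.fun_pow 2).fun_mul (he (-2 * S.ρ + S.β₂ ^ 2))).const_mul q22)
  refine HasDerivAt.congr_deriv H ?_
  simp; ring
end

section
open Filter Topology

lemma rem_int (K d : ℝ) (hK : 0 ≤ K) (hd : 0 < d) (hd1 : d ≤ 1) :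
    Integrable (fun y => (tt d y) ^ 4 * Real.exp (K * tt d y)) (nu d) ∧
    ∫ y, (tt d y) ^ 4 * Real.exp (K * tt d y) ∂nu d ≤ d ^ 2 * (24 * (Real.exp (K + 1) * (2 * Real.exp ((K + 1) ^ 2 / 2)) ^ 2)) := by
  have hmt : Measurable (fun y : ℝ × ℝ => tt d y) := measurable_tt.comp (measurable_const.prodMk measurable_id)
  have hm : Measurable (fun y : ℝ × ℝ => (tt d y) ^ 4 * Real.exp (K * tt d y)) := by fun_prop
  have h0 : ∀ y : ℝ × ℝ, 0 ≤ (tt d y) ^ 4 * Real.exp (K * tt d y) := fun y => by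
    have := tt_nonneg hd.le y; positivity
  have hl := nu_moment4 K d hK hd hd1
  constructor
  · refine ⟨hm.aestronglyMeasurable, ?_⟩
    rw [hasFiniteIntegral_iff_ofReal (ae_of_all _ h0)]
    exact hl.trans_lt ENNReal.ofReal_lt_top
  · rw [integral_eq_lintegral_of_nonneg_ae (ae_of_all _ h0) hm.aestronglyMeasurable]
    exact ENNReal.toReal_le_of_le_ofReal (by positivity) hl

lemma limq (S : Setting Ω) {q k h : ℝ} (hq : 0 < q) (hqR : q < S.R) (hk : 0 < k) (hh : 0 < h) (p1 p2 q11 q12 q22 : ℝ) {r : ℝ} (hr : 0 < r)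
    (hnear : ∀ w : ℝ × ℝ, 0 < w.1 → 0 < w.2 → |w.1 - k| < r → |w.2 - h| < r → Cr S w ≤ qp (Cr S (k, h)) p1 p2 q11 q12 q22 k h w) :
    S.θ * Cr S (k, h) ≤ (sg S)⁻¹ * h ^ (bb S) * (q * k) ^ (-sg S) +
      (p1 * (S.B * k - q * k) + p2 * (S.ρ * (q * k) - S.ρ * h) + q11 * S.β₁ ^ 2 * k ^ 2 + q22 * S.β₂ ^ 2 * h ^ 2) := by
  obtain ⟨Λ, K, hΛ, hK, hub⟩ := ubound S hq hk hh p1 p2 q11 q12 q22 hr hnear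
  set a0 := Cr S (k, h)
  set D := p1 * (S.B * k - q * k) + p2 * (S.ρ * (q * k) - S.ρ * h) + q11 * S.β₁ ^ 2 * k ^ 2 + q22 * S.β₂ ^ 2 * h ^ 2 with hD
  set c := 24 * (Real.exp (K + 1) * (2 * Real.exp ((K + 1) ^ 2 / 2)) ^ 2) with hc
  let E : ℝ → ℝ := EP S a0 p1 p2 q11 q12 q22 k h q
  let G : ℝ → ℝ := fun d => Real.exp (-S.θ * d) * (E d + Λ * c * d ^ 2)
  let l : ℝ → ℝ := fun d => (sg S)⁻¹ * vth (KK S) d * (h + S.ρ * (q * k) * d) ^ (bb S) * (q * k) ^ (-sg S)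
  have hG0 : G 0 = a0 := by simp [G, E, EP_zero]
  have he : HasDerivAt (fun d : ℝ => Real.exp (-S.θ * d)) (-S.θ) 0 := by
    simpa using ((hasDerivAt_id (0:ℝ)).const_mul (-S.θ)).exp
  have hG : HasDerivAt G (D - S.θ * a0) 0 := by
    have h2 : HasDerivAt (fun d : ℝ => Λ * c * d ^ 2) 0 0 := by
      simpa using ((hasDerivAt_id (0:ℝ)).fun_pow 2).const_mul (Λ * c)
    refine (he.fun_mul ((EP_deriv S a0 p1 p2 q11 q12 q22 k h q).fun_add h2)).congr_deriv ?_
    simp [EP_zero, ← hD]; ring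
  have hlc : ContinuousAt l 0 := by
    have h1 : ContinuousAt (fun d => vth (KK S) d) 0 := (vth_cont (KK S)).continuousAt
    have h2 : ContinuousAt (fun d : ℝ => (h + S.ρ * (q * k) * d) ^ (bb S)) 0 := by
      refine ContinuousAt.rpow_const (by fun_prop) (Or.inl ?_)
      simpa using hh.ne'
    exact ((continuousAt_const.mul h1).mul h2).mul continuousAt_const
  have hl0 : l 0 = (sg S)⁻¹ * h ^ (bb S) * (q * k) ^ (-sg S) := by simp [l, vth_zero]
  have hsl := (hasDerivAt_iff_tendsto_slope.mp hG).mono_left (nhdsGT_le_nhdsNE (0:ℝ))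
  have hlt : Tendsto l (𝓝[>] 0) (𝓝 (l 0)) := hlc.tendsto.mono_left nhdsWithin_le_nhds
  have hsum := hlt.add hsl
  have hev : ∀ᶠ d in 𝓝[>] (0:ℝ), 0 ≤ l d + slope G 0 d := by
    have u1 : ∀ᶠ d in 𝓝 (0:ℝ), d < 1 := gt_mem_nhds one_pos
    have u2 : ∀ᶠ d in 𝓝 (0:ℝ), q * d < 1 / 2 := by
      have : ContinuousAt (fun d : ℝ => q * d) 0 := by fun_prop
      exact this.eventually_lt_const (by norm_num)
    have u3 : ∀ᶠ d in 𝓝 (0:ℝ), q * (1 + S.R * d) < S.R := by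
      have : ContinuousAt (fun d : ℝ => q * (1 + S.R * d)) 0 := by fun_prop
      exact this.eventually_lt_const (by simpa using hqR)
    filter_upwards [self_mem_nhdsWithin, nhdsWithin_le_nhds u1, nhdsWithin_le_nhds u2, nhdsWithin_le_nhds u3] with d hd h1 h2 h3
    have hd : 0 < d := hd
    obtain ⟨iE, jE⟩ := EP_int S a0 p1 p2 q11 q12 q22 k h q hd.le
    obtain ⟨iR, jR⟩ := rem_int K d hK hd h1.le
    have hdp := dppR S hd h1.le (q := q) ⟨hq, h3.le⟩ h2.le hk hh (iE.fun_add (iR.const_mul Λ)) (hub d hd.le h2.le)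
    rw [integral_add iE (iR.const_mul Λ), jE, integral_const_mul] at hdp
    have hL : Lc S d q (k, h) = d * l d := by simp only [Lc, l]; ring
    have hG' : Real.exp (-S.θ * d) * (EP S a0 p1 p2 q11 q12 q22 k h q d + Λ * ∫ y, (tt d y) ^ 4 * Real.exp (K * tt d y) ∂nu d) ≤ G d := by
      simp only [G]
      refine mul_le_mul_of_nonneg_left (add_le_add_right ?_ _) (Real.exp_pos _).le
      rw [mul_assoc, mul_comm c]
      exact mul_le_mul_of_nonneg_left jR hΛ
    have : a0 ≤ d * l d + G d := by rw [← hL]; exact hdp.trans (add_le_add_right hG' _)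
    rw [slope_def_field, hG0, sub_zero]
    have hh2 : l d + (G d - a0) / d = (d * l d + G d - a0) / d := by field_simp; ring
    rw [hh2]
    exact div_nonneg (by linarith) hd.le
  have := ge_of_tendsto hsum hev
  rw [hl0] at this
  linarith
end

section
open Filter Topology

lemma V_toReal (S : Setting Ω) (k h : ℝ) : (V S k h).toReal = -Cr S (k, h) := by
  simp [V, Cr]

lemma near_of_min (S : Setting Ω) {ψ : ℝ × ℝ → ℝ} (hψ : ContDiffOn ℝ 2 ψ (Set.Ioi (0:ℝ) ×ˢ Set.Ioi (0:ℝ)))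
    {z : ℝ × ℝ} (hz : z ∈ Set.Ioi (0:ℝ) ×ˢ Set.Ioi (0:ℝ))
    (hmin : IsLocalMinOn (fun w => (V S w.1 w.2).toReal - ψ w) (Set.Ioi (0:ℝ) ×ˢ Set.Ioi (0:ℝ)) z) {ε : ℝ} (hε : 0 < ε) :
    ∃ r > 0, ∀ w : ℝ × ℝ, 0 < w.1 → 0 < w.2 → |w.1 - z.1| < r → |w.2 - z.2| < r →
      Cr S w ≤ qp (Cr S (z.1, z.2)) (-pd1 ψ z) (-pd2 ψ z) (-(1 / 2) * pd1 (pd1 ψ) z + ε) (-pd2 (pd1 ψ) z)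
        (-(1 / 2) * pd2 (pd2 ψ) z + ε) z.1 z.2 w := by
  have ho : IsOpen (Set.Ioi (0:ℝ) ×ˢ Set.Ioi (0:ℝ)) := isOpen_Ioi.prod isOpen_Ioi
  have hs := ho.mem_nhds hz
  obtain ⟨r, hr, hT⟩ := taylor2 (hψ.contDiffAt hs) hε
  have hm : ∀ᶠ w in 𝓝 z, (V S z.1 z.2).toReal - ψ z ≤ (V S w.1 w.2).toReal - ψ w := by
    have := hmin
    rwa [IsLocalMinOn, IsMinFilter, ho.nhdsWithin_eq hz] at this
  obtain ⟨r', hr', hb⟩ := Metric.eventually_nhds_iff_ball.mp hm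
  refine ⟨min r r', lt_min hr hr', fun w _ _ h1 h2 => ?_⟩
  have t := hT w (h1.trans_le (min_le_left _ _)) (h2.trans_le (min_le_left _ _))
  have b := hb w (by
    rw [Metric.mem_ball, Prod.dist_eq, Real.dist_eq, Real.dist_eq]
    exact max_lt (h1.trans_le (min_le_right _ _)) (h2.trans_le (min_le_right _ _)))
  rw [V_toReal, V_toReal] at b
  have e : Cr S w = Cr S (w.1, w.2) := rfl
  unfold qp
  rw [e]
  linarith

lemma visc (S : Setting Ω) {ψ : ℝ × ℝ → ℝ} (hψ : ContDiffOn ℝ 2 ψ (Set.Ioi (0:ℝ) ×ˢ Set.Ioi (0:ℝ)))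
    {z : ℝ × ℝ} (hz : z ∈ Set.Ioi (0:ℝ) ×ˢ Set.Ioi (0:ℝ))
    (hmin : IsLocalMinOn (fun w => (V S w.1 w.2).toReal - ψ w) (Set.Ioi (0:ℝ) ×ˢ Set.Ioi (0:ℝ)) z) {c : ℝ} (hc : 0 < c) (hcR : c ≤ S.R * z.1) :
    S.θ * Cr S (z.1, z.2) ≤ (sg S)⁻¹ * z.2 ^ (bb S) * c ^ (-sg S) + c * (pd1 ψ z - S.ρ * pd2 ψ z)
      - (S.B * z.1 * pd1 ψ z - S.ρ * z.2 * pd2 ψ z + 1 / 2 * S.β₁ ^ 2 * z.1 ^ 2 * pd1 (pd1 ψ) z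
        + 1 / 2 * S.β₂ ^ 2 * z.2 ^ 2 * pd2 (pd2 ψ) z) := by
  have hk : 0 < z.1 := hz.1
  have hh : 0 < z.2 := hz.2
  let Φ : ℝ → ℝ := fun c => (sg S)⁻¹ * z.2 ^ (bb S) * c ^ (-sg S) + c * (pd1 ψ z - S.ρ * pd2 ψ z)
      - (S.B * z.1 * pd1 ψ z - S.ρ * z.2 * pd2 ψ z + 1 / 2 * S.β₁ ^ 2 * z.1 ^ 2 * pd1 (pd1 ψ) z
        + 1 / 2 * S.β₂ ^ 2 * z.2 ^ 2 * pd2 (pd2 ψ) z)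
  have main : ∀ q, 0 < q → q < S.R → S.θ * Cr S (z.1, z.2) ≤ Φ (q * z.1) := by
    intro q hq hqR
    refine le_of_forall_pos_le_add fun ε hε => ?_
    have hM : 0 < S.β₁ ^ 2 * z.1 ^ 2 + S.β₂ ^ 2 * z.2 ^ 2 := by have := S.hβ₁; positivity
    obtain ⟨r, hr, hn⟩ := near_of_min S hψ hz hmin (div_pos hε hM)
    have := limq S hq hqR hk hh _ _ _ _ _ hr hn
    have e : ε / (S.β₁ ^ 2 * z.1 ^ 2 + S.β₂ ^ 2 * z.2 ^ 2) * (S.β₁ ^ 2 * z.1 ^ 2 + S.β₂ ^ 2 * z.2 ^ 2) = ε :=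
      div_mul_cancel₀ _ hM.ne'
    simp only [Φ]
    linear_combination this + e
  have hΦ : ContinuousAt (fun t : ℝ => Φ (t * c)) 1 := by
    have h1 : ContinuousAt (fun t : ℝ => (t * c) ^ (-sg S)) 1 :=
      ContinuousAt.rpow_const (by fun_prop) (Or.inl (by simpa using hc.ne'))
    have h2 : ContinuousAt (fun t : ℝ => t * c) 1 := by fun_prop
    exact ((continuousAt_const.mul h1).add (h2.mul continuousAt_const)).sub continuousAt_const
  have ht : Tendsto (fun t : ℝ => Φ (t * c)) (𝓝[<] 1) (𝓝 (Φ (1 * c))) := hΦ.tendsto.mono_left nhdsWithin_le_nhds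
  rw [one_mul] at ht
  refine ge_of_tendsto ht ?_
  filter_upwards [self_mem_nhdsWithin, nhdsWithin_le_nhds (lt_mem_nhds (zero_lt_one' ℝ))] with t ht1 ht0
  have ht1 : t < 1 := ht1
  have := main (t * c / z.1) (by positivity) (by
    rw [div_lt_iff₀ hk]
    exact lt_of_lt_of_le (by nlinarith) hcR)
  rwa [div_mul_cancel₀ _ hk.ne'] at this

lemma final_aux (S : Setting Ω) {ψ : ℝ × ℝ → ℝ} (hψ : ContDiffOn ℝ 2 ψ (Set.Ioi (0:ℝ) ×ˢ Set.Ioi (0:ℝ)))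
    {z : ℝ × ℝ} (hz : z ∈ Set.Ioi (0:ℝ) ×ˢ Set.Ioi (0:ℝ))
    (hmin : IsLocalMinOn (fun w => (V S w.1 w.2).toReal - ψ w) (Set.Ioi (0:ℝ) ×ˢ Set.Ioi (0:ℝ)) z) :
    0 ≤ S.θ * (V S z.1 z.2).toReal -
      Hmax S.B S.β₁ S.β₂ S.ρ S.σ S.γ S.R z.1 z.2 (gradVec ψ z) (hessMat ψ z) := by
  have hk : 0 < z.1 := hz.1
  have hh : 0 < z.2 := hz.2
  have hs := sg_pos S
  have hσ : 0 < S.σ := by linarith [S.hσ]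
  have hRk : 0 < S.R * z.1 := mul_pos S.hR hk
  suffices hG : ∃ c, 0 < c ∧ c ≤ S.R * z.1 ∧ (sg S)⁻¹ * z.2 ^ (bb S) * c ^ (-sg S) + c * (pd1 ψ z - S.ρ * pd2 ψ z) =
      -GFun S.ρ S.σ S.γ S.R z.1 z.2 (pd1 ψ z) (pd2 ψ z) by
    obtain ⟨c, hc, hcR, e⟩ := hG
    have := visc S hψ hz hmin hc hcR
    rw [V_toReal]
    simp only [Hmax, gradVec, hessMat, Matrix.of_apply, Matrix.cons_val_zero, Matrix.cons_val_one]
    linarith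
  unfold GFun
  generalize pd1 ψ z - S.ρ * pd2 ψ z = p
  have hb : ∀ c : ℝ, 0 < c → (z.2 ^ S.γ / c) ^ (S.σ - 1) = z.2 ^ (bb S) * c ^ (-sg S) := by
    intro c hc
    rw [Real.div_rpow (by positivity) hc.le, ← Real.rpow_mul hh.le, Real.rpow_neg hc.le, div_eq_mul_inv]; rfl
  split_ifs with hp
  · refine ⟨S.R * z.1, hRk, le_rfl, ?_⟩
    rw [hb _ hRk]; unfold sg; ring
  · push Not at hp
    have hhb : 0 < z.2 ^ (bb S) := Real.rpow_pos_of_pos hh _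
    have hp0 : 0 < p := lt_trans (by positivity) hp
    have hx : 0 < z.2 ^ (bb S) / p := div_pos hhb hp0
    have hc : 0 < (z.2 ^ (bb S) / p) ^ (1 / S.σ) := Real.rpow_pos_of_pos hx _
    have hcσ : ((z.2 ^ (bb S) / p) ^ (1 / S.σ)) ^ S.σ = z.2 ^ (bb S) / p := by
      rw [← Real.rpow_mul hx.le, one_div, inv_mul_cancel₀ hσ.ne', Real.rpow_one]
    have hcp : (z.2 ^ (bb S) / p) ^ (1 / S.σ) * p = (z.2 ^ S.γ * p) ^ (1 - 1 / S.σ) := by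
      rw [Real.div_rpow hhb.le hp0.le, Real.mul_rpow (by positivity) hp0.le, ← Real.rpow_mul hh.le, ← Real.rpow_mul hh.le,
        Real.rpow_sub hp0, Real.rpow_one]
      have : bb S * (1 / S.σ) = S.γ * (1 - 1 / S.σ) := by unfold bb; field_simp
      rw [this]; ring
    refine ⟨_, hc, ?_, ?_⟩
    · refine (Real.rpow_le_rpow_iff hc.le hRk.le hσ).mp ?_
      rw [hcσ, div_le_iff₀ hp0]
      have h1 : (S.R * z.1) ^ S.σ * (z.2 ^ (bb S) * (S.R * z.1) ^ (-S.σ)) = z.2 ^ (bb S) := by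
        rw [Real.rpow_neg hRk.le]
        have := (Real.rpow_pos_of_pos hRk S.σ).ne'
        field_simp
      rw [← h1]
      exact mul_le_mul_of_nonneg_left hp.le (by positivity)
    · generalize (z.2 ^ (bb S) / p) ^ (1 / S.σ) = c at *
      have h2 : z.2 ^ (bb S) = c ^ S.σ * p := by rw [hcσ, div_mul_cancel₀ _ hp0.ne']
      have h3 : c ^ S.σ * c ^ (-sg S) = c := by
        rw [← Real.rpow_add hc]; unfold sg
        rw [show S.σ + -(S.σ - 1) = 1 by ring, Real.rpow_one]
      rw [← hcp, h2]
      unfold sg at h3 ⊢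
      linear_combination (S.σ - 1)⁻¹ * p * h3
end

/-- Under Assumption 1 and `γ(σ-1) ≤ 1`, the value function is a viscosity supersolution of
the HJB equation `θV = H_max(k,h,∇V,D²V)` on `(0,∞)²`. -/
theorem V_viscosity_supersolution (S : Setting Ω) (hA : Assumption1 S)
    (hγσ : S.γ * (S.σ - 1) ≤ 1) (ψ : ℝ × ℝ → ℝ)
    (hψ : ContDiffOn ℝ 2 ψ (Set.Ioi (0:ℝ) ×ˢ Set.Ioi (0:ℝ)))
    (z : ℝ × ℝ) (hz : z ∈ Set.Ioi (0:ℝ) ×ˢ Set.Ioi (0:ℝ))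
    (hmin : IsLocalMinOn (fun w => (V S w.1 w.2).toReal - ψ w)
      (Set.Ioi (0:ℝ) ×ˢ Set.Ioi (0:ℝ)) z) :
    0 ≤ S.θ * (V S z.1 z.2).toReal -
      Hmax S.B S.β₁ S.β₂ S.ρ S.σ S.γ S.R z.1 z.2 (gradVec ψ z) (hessMat ψ z) := by
  exact final_aux S hψ hz hmin

end HabitModel
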